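/- arXiv:1702.04971 — 2 statements merged into one kernel-verified Lean document; each statement's English description precedes it below -/
import Mathlib

section
/- Let 0 < c₀, τ₀ sufficiently small, H₀ > 0, C_c > 0, T > t₀ and filter constants C₁,…,C₈ be given. There exist τ₀ > 0 and C > 0 depending only on T − t₀, c₀, H₀, C_c and C₁,…,C₈ — in particular independent of ω̃, of the step size τ, of the step number n and of the dimension d — such that for every dimension d, every C_E, Ω, ω̃ as in the Setup, all filter functions ψ_E, φ_E satisfying filter conditions (i)–(viii), all initial data (p₀, e₀, b₀) satisfying the Initial-data bounds, every step size τ with 0 < τ ≤ τ₀ and τ·ω̃ ≥ c₀, and every n ∈ ℕ with t_n := t₀ + n·τ ≤ T, the iterates (p_n, e_n, b_n) of the triple splitting scheme and the exact solution (p, e, b) of the semidiscrete Maxwell system satisfy ‖p_n − p(t_n)‖ ≤ C·τ², ‖e_n − e(t_n)‖ ≤ C·τ² and ‖b_n − b(t_n)‖ ≤ C·τ². -/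
noncomputable def sinc (z : ℝ) : ℝ := if z = 0 then 1 else Real.sin z / z

noncomputable def mulE {d : ℕ} (A : Matrix (Fin d) (Fin d) ℝ)
    (v : EuclideanSpace ℝ (Fin d)) : EuclideanSpace ℝ (Fin d) :=
  (WithLp.equiv 2 (Fin d → ℝ)).symm (A.mulVec ((WithLp.equiv 2 (Fin d → ℝ)) v))

noncomputable def fDiag {d : ℕ} (f : ℝ → ℝ) (s : ℝ) (ωv : Fin d → ℝ) :
    Matrix (Fin d) (Fin d) ℝ :=
  Matrix.diagonal fun i => f (s * ωv i)

/-- One step of the triple splitting scheme (with `ψ_B ≡ φ_B ≡ 1`),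
acting on a state `(p, e, b)`. -/
noncomputable def tripleSplitStep {d : ℕ} (CE CB : Matrix (Fin d) (Fin d) ℝ)
    (ψE φE : ℝ → ℝ) (τ : ℝ) (ωv : Fin d → ℝ)
    (s : EuclideanSpace ℝ (Fin d) × EuclideanSpace ℝ (Fin d) × EuclideanSpace ℝ (Fin d)) :
    EuclideanSpace ℝ (Fin d) × EuclideanSpace ℝ (Fin d) × EuclideanSpace ℝ (Fin d) :=
  let p := s.1
  let e := s.2.1
  let b := s.2.2
  let bh := b - (τ/2) • mulE CE (mulE (fDiag φE (τ/2) ωv) e)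
  let ep := e + (τ/2) • mulE (fDiag ψE (τ/2) ωv) (mulE CB bh)
  let p1 := mulE (fDiag Real.cos τ ωv) p + τ • mulE (fDiag sinc τ ωv) ep
  let em := -mulE (Matrix.diagonal fun i => ωv i * Real.sin (τ * ωv i)) p
              + mulE (fDiag Real.cos τ ωv) ep
  let e1 := em + (τ/2) • mulE (fDiag ψE (τ/2) ωv) (mulE CB bh)
  let b1 := bh - (τ/2) • mulE CE (mulE (fDiag φE (τ/2) ωv) e1)
  (p1, e1, b1)

namespace TripleSplitting

open Set

section PairNorm

variable {E : Type*} [NormedAddCommGroup E]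

/-- The Euclidean norm of a pair. -/
noncomputable def pairNorm (x q : E) : ℝ :=
  ‖WithLp.toLp 2 (x, q)‖

lemma sq_pairNorm (x q : E) : pairNorm x q ^ 2 = ‖x‖ ^ 2 + ‖q‖ ^ 2 :=
  WithLp.prod_norm_sq_eq_of_L2 _

lemma pairNorm_nonneg (x q : E) : 0 ≤ pairNorm x q := norm_nonneg _

lemma pairNorm_add_le (x q x' q' : E) :
    pairNorm (x + x') (q + q') ≤ pairNorm x q + pairNorm x' q' :=
  norm_add_le (WithLp.toLp 2 (x, q)) (WithLp.toLp 2 (x', q'))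

lemma norm_fst_le_pairNorm (x q : E) : ‖x‖ ≤ pairNorm x q :=
  le_of_sq_le_sq (by rw [sq_pairNorm]; nlinarith [sq_nonneg ‖q‖]) (pairNorm_nonneg x q)

lemma norm_snd_le_pairNorm (x q : E) : ‖q‖ ≤ pairNorm x q :=
  le_of_sq_le_sq (by rw [sq_pairNorm]; nlinarith [sq_nonneg ‖x‖]) (pairNorm_nonneg x q)

lemma pairNorm_le (x q : E) : pairNorm x q ≤ ‖x‖ + ‖q‖ :=
  le_of_sq_le_sq (by rw [sq_pairNorm]; nlinarith [norm_nonneg x, norm_nonneg q])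
    (by positivity)

end PairNorm

section Abstract

variable {E : Type*} [NormedAddCommGroup E] [InnerProductSpace ℝ E]

/-- A slowly and a rapidly oscillating component `y`, `x` coupled through `b`. -/
structure SlowFastSolution (A U V : E →L[ℝ] E) (ω : ℝ) (x q y b : ℝ → E) : Prop where
  deriv_x : ∀ t, HasDerivAt x (U (b t) - ω • q t) t
  deriv_q : ∀ t, HasDerivAt q (ω • x t) t
  deriv_y : ∀ t, HasDerivAt y (V (b t)) t
  deriv_b : ∀ t, HasDerivAt b (-A (x t + y t)) t

/-- Bounds on a solution, uniform in the frequency. -/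
structure EnergyBound (U : E →L[ℝ] E) (ω M : ℝ) (x q y b : ℝ → E) (I : Set ℝ) : Prop where
  norm_x : ∀ t ∈ I, ‖ω • x t‖ ≤ M
  norm_w : ∀ t ∈ I, ‖ω • q t - U (b t)‖ ≤ M
  norm_y : ∀ t ∈ I, ‖y t‖ ≤ M
  norm_b : ∀ t ∈ I, ‖b t‖ ≤ M

lemma norm_sub_le_of_deriv {f f' : ℝ → E} {t τ C : ℝ} (hτ : 0 ≤ τ)
    (hf : ∀ s, HasDerivAt f (f' s) s) (hC : ∀ s ∈ Icc t (t + τ), ‖f' s‖ ≤ C) :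
    ∀ s ∈ Icc t (t + τ), ‖f s - f t‖ ≤ C * τ := by
  intro s hs
  have hC0 : 0 ≤ C := (norm_nonneg _).trans (hC t ⟨le_rfl, by linarith⟩)
  have h := norm_image_sub_le_of_norm_deriv_le_segment' (a := t) (b := t + τ)
    (fun r _ => (hf r).hasDerivWithinAt) (fun r hr => hC r (Ico_subset_Icc_self hr)) s hs
  exact h.trans (by gcongr; linarith [hs.2])

lemma energy_le {A U V : E →L[ℝ] E} {ω K : ℝ} {x q y b : ℝ → E}
    (h : SlowFastSolution A U V ω x q y b) (hK : 1 ≤ K) (hω : 1 ≤ ω)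
    (hA : ∀ v, ‖A v‖ ≤ K * ‖v‖) (hU : ∀ v, ‖U v‖ ≤ K * ‖v‖) (hV : ∀ v, ‖V v‖ ≤ K * ‖v‖)
    {t0 t : ℝ} (ht : t0 ≤ t) :
    ‖ω • x t‖ ^ 2 + ‖ω • q t - U (b t)‖ ^ 2 + ‖y t‖ ^ 2 + ‖b t‖ ^ 2 ≤
      (‖ω • x t0‖ ^ 2 + ‖ω • q t0 - U (b t0)‖ ^ 2 + ‖y t0‖ ^ 2 + ‖b t0‖ ^ 2) *
        Real.exp (6 * K ^ 2 * (t - t0)) := by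
  set w : ℝ → E := fun t => ω • q t - U (b t) with hw
  set N : ℝ → ℝ := fun t => ‖ω • x t‖ ^ 2 + ‖w t‖ ^ 2 + ‖y t‖ ^ 2 + ‖b t‖ ^ 2 with hN
  set N' : ℝ → ℝ := fun t => 2 * (inner ℝ (w t) (U (A (x t + y t))) + inner ℝ (y t) (V (b t))
    - inner ℝ (b t) (A (x t + y t))) with hN'
  have hNd : ∀ t, HasDerivAt N (N' t) t := by
    intro t
    have h1 := ((h.deriv_x t).const_smul ω).norm_sq
    have h2 : HasDerivAt w (ω • ω • x t - U (-A (x t + y t))) t :=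
      ((h.deriv_q t).const_smul ω).sub (U.hasFDerivAt.comp_hasDerivAt t (h.deriv_b t))
    have h3 := ((h1.add h2.norm_sq).add (h.deriv_y t).norm_sq).add (h.deriv_b t).norm_sq
    refine h3.congr_deriv ?_
    simp only [hN', map_neg, sub_neg_eq_add, inner_add_right, inner_neg_right]
    have e1 : U (b t) - ω • q t = - w t := by simp [hw]
    rw [e1]
    simp only [Pi.smul_apply, real_inner_smul_left, inner_smul_right, inner_neg_right,
      real_inner_comm (x t) (w t)]
    ring
  have hle : ∀ t, N' t ≤ 6 * K ^ 2 * N t := by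
    intro t
    have hx : ‖x t‖ ≤ ‖ω • x t‖ := by
      rw [norm_smul, Real.norm_of_nonneg (by linarith)]
      exact le_mul_of_one_le_left (norm_nonneg _) hω
    have hAe : ‖A (x t + y t)‖ ≤ K * (‖ω • x t‖ + ‖y t‖) :=
      (hA _).trans (by gcongr; exact (norm_add_le _ _).trans (by gcongr))
    have i1 : inner ℝ (w t) (U (A (x t + y t))) ≤ ‖w t‖ * (K * (K * (‖ω • x t‖ + ‖y t‖))) :=
      (real_inner_le_norm _ _).trans (by gcongr; exact (hU _).trans (by gcongr))
    have i2 : inner ℝ (y t) (V (b t)) ≤ ‖y t‖ * (K * ‖b t‖) :=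
      (real_inner_le_norm _ _).trans (by gcongr; exact hV _)
    have i3 : - inner ℝ (b t) (A (x t + y t)) ≤ ‖b t‖ * (K * (‖ω • x t‖ + ‖y t‖)) := by
      rw [← inner_neg_right]
      exact (real_inner_le_norm _ _).trans (by rw [norm_neg]; gcongr)
    simp only [hN', hN]
    generalize ‖ω • x t‖ = a at *
    generalize ‖w t‖ = a2 at *
    generalize ‖y t‖ = a3 at *
    generalize ‖b t‖ = a4 at *
    have j1 : a2 * (K * (K * (a + a3))) ≤ K ^ 2 * (a ^ 2 + a2 ^ 2 + a3 ^ 2 + a4 ^ 2) := by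
      nlinarith [mul_nonneg (sq_nonneg K) (sq_nonneg (a - a2)),
        mul_nonneg (sq_nonneg K) (sq_nonneg (a3 - a2)), mul_nonneg (sq_nonneg K) (sq_nonneg a),
        mul_nonneg (sq_nonneg K) (sq_nonneg a3), mul_nonneg (sq_nonneg K) (sq_nonneg a4)]
    have hKK : K ≤ K ^ 2 := by nlinarith
    have j2 : a3 * (K * a4) + a4 * (K * (a + a3)) ≤
        K * (2 * (a ^ 2 + a2 ^ 2 + a3 ^ 2 + a4 ^ 2)) := by
      have : a3 * a4 + a4 * (a + a3) ≤ 2 * (a ^ 2 + a2 ^ 2 + a3 ^ 2 + a4 ^ 2) := by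
        nlinarith [sq_nonneg (a3 - a4), sq_nonneg (a - a4), sq_nonneg a, sq_nonneg a2,
          sq_nonneg a3, sq_nonneg a4]
      nlinarith
    have j3 : K * (2 * (a ^ 2 + a2 ^ 2 + a3 ^ 2 + a4 ^ 2)) ≤
        K ^ 2 * (2 * (a ^ 2 + a2 ^ 2 + a3 ^ 2 + a4 ^ 2)) := by gcongr
    nlinarith
  have hanti : Antitone fun t => N t * Real.exp (-(6 * K ^ 2 * (t - t0))) := by
    have hd : ∀ t, HasDerivAt (fun t => N t * Real.exp (-(6 * K ^ 2 * (t - t0))))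
        (N' t * Real.exp (-(6 * K ^ 2 * (t - t0))) +
          N t * (Real.exp (-(6 * K ^ 2 * (t - t0))) * (-(6 * K ^ 2 * 1)))) t := fun t =>
      (hNd t).mul ((((hasDerivAt_id t).sub_const t0).const_mul (6 * K ^ 2)).neg.exp)
    refine antitone_of_deriv_nonpos (fun t => (hd t).differentiableAt) fun t => ?_
    rw [(hd t).deriv]
    have := Real.exp_pos (-(6 * K ^ 2 * (t - t0)))
    nlinarith [hle t]
  have h0 := hanti ht
  simp only [sub_self, mul_zero, neg_zero, Real.exp_zero, mul_one] at h0
  rw [Real.exp_neg, ← div_eq_mul_inv, div_le_iff₀ (Real.exp_pos _)] at h0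
  exact h0

lemma trapezoid_error {F y w : ℝ → E} {t τ L : ℝ} (hτ : 0 ≤ τ)
    (hF : ∀ s, HasDerivAt F (y s) s) (hy : ∀ s, HasDerivAt y (w s) s)
    (hw : ∀ s ∈ Icc t (t + τ), ‖w s - w t‖ ≤ L * τ) :
    ‖F (t + τ) - F t - (τ / 2) • (y t + y (t + τ))‖ ≤ L * τ ^ 3 := by
  have hyw : ∀ s ∈ Icc t (t + τ), ‖(y s - s • w t) - (y t - t • w t)‖ ≤ L * τ * τ :=
    norm_sub_le_of_deriv hτ (f' := fun s => w s - w t)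
      (fun s => ((hy s).sub ((hasDerivAt_id s).smul_const (w t))).congr_deriv (by simp)) hw
  have h := norm_sub_le_of_deriv (t := t) (C := L * τ ^ 2) hτ
    (f := fun s => F s - ((s - t) / 2) • (y t + y s))
    (f' := fun s => (2⁻¹ : ℝ) • ((y s - s • w t) - (y t - t • w t)) -
      ((s - t) / 2) • (w s - w t))
    (fun s => ((hF s).sub ((((hasDerivAt_id s).sub_const t).div_const 2).smul
      ((hy s).const_add (y t)))).congr_deriv (by simp only [id]; module))
    (fun s hs => by
      have hs0 : 0 ≤ s - t := by linarith [hs.1]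
      have hs1 : s - t ≤ τ := by linarith [hs.2]
      calc _ ≤ ‖(2⁻¹ : ℝ) • ((y s - s • w t) - (y t - t • w t))‖
            + ‖((s - t) / 2) • (w s - w t)‖ := norm_sub_le _ _
        _ ≤ 2⁻¹ * (L * τ * τ) + τ / 2 * (L * τ) := by
            rw [norm_smul, norm_smul, Real.norm_of_nonneg (by norm_num),
              Real.norm_of_nonneg (by linarith)]
            gcongr
            · exact hyw s hs
            · exact hw s hs
        _ = L * τ ^ 2 := by ring)
    (t + τ) ⟨by linarith, le_rfl⟩
  have e : F (t + τ) - F t - (τ / 2) • (y t + y (t + τ)) =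
      F (t + τ) - ((t + τ - t) / 2) • (y t + y (t + τ)) -
        (F t - ((t - t) / 2) • (y t + y t)) := by
    rw [add_sub_cancel_left, sub_self]; module
  rw [e]
  exact h.trans_eq (by ring)

lemma rotation_error {u v r : ℝ → E} {ω t τ R : ℝ} (hτ : 0 ≤ τ)
    (hu : ∀ s, HasDerivAt u (r s - ω • v s) s) (hv : ∀ s, HasDerivAt v (ω • u s) s)
    (hr : ∀ s ∈ Icc t (t + τ), ‖r s‖ ≤ R) :
    ‖u (t + τ) - (Real.cos (τ * ω) • u t - Real.sin (τ * ω) • v t)‖ ≤ R * τ ∧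
    ‖v (t + τ) - (Real.sin (τ * ω) • u t + Real.cos (τ * ω) • v t)‖ ≤ R * τ := by
  have hc : ∀ s, HasDerivAt (fun s => Real.cos ((t + τ - s) * ω))
      (-Real.sin ((t + τ - s) * ω) * (-1 * ω)) s := fun s =>
    (((hasDerivAt_id s).const_sub (t + τ)).mul_const ω).cos
  have hs : ∀ s, HasDerivAt (fun s => Real.sin ((t + τ - s) * ω))
      (Real.cos ((t + τ - s) * ω) * (-1 * ω)) s := fun s =>
    (((hasDerivAt_id s).const_sub (t + τ)).mul_const ω).sin
  have hend : t + τ ∈ Icc t (t + τ) := ⟨by linarith, le_rfl⟩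
  have hR : ∀ a : ℝ, |a| ≤ 1 → ∀ s ∈ Icc t (t + τ), ‖a • r s‖ ≤ R := fun a ha s hs' => by
    rw [norm_smul, Real.norm_eq_abs]
    exact (mul_le_of_le_one_left (norm_nonneg _) ha).trans (hr s hs')
  constructor
  · have h := norm_sub_le_of_deriv (t := t) (C := R) hτ
      (f := fun s => Real.cos ((t + τ - s) * ω) • u s - Real.sin ((t + τ - s) * ω) • v s)
      (f' := fun s => Real.cos ((t + τ - s) * ω) • r s)
      (fun s => (((hc s).smul (hu s)).sub ((hs s).smul (hv s))).congr_deriv (by module))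
      (fun s hs' => hR _ (Real.abs_cos_le_one _) s hs') (t + τ) hend
    simpa using h
  · have h := norm_sub_le_of_deriv (t := t) (C := R) hτ
      (f := fun s => Real.sin ((t + τ - s) * ω) • u s + Real.cos ((t + τ - s) * ω) • v s)
      (f' := fun s => Real.sin ((t + τ - s) * ω) • r s)
      (fun s => (((hs s).smul (hu s)).add ((hc s).smul (hv s))).congr_deriv (by module))
      (fun s hs' => hR _ (Real.abs_sin_le_one _) s hs') (t + τ) hend
    simpa using h

/-- Estimates for one time step of a slow-fast solution in corrected variables: `u`, `v` rotate,
and `β` is slow. -/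
structure LocalConsistency (A U V : E →L[ℝ] E) (τ ω L : ℝ) (u v y β u1 v1 y1 β1 : E) :
    Prop where
  rot_u : ‖u1 - (Real.cos (τ * ω) • u - Real.sin (τ * ω) • v)‖ ≤ L * τ ^ 3
  rot_v : ‖v1 - (Real.sin (τ * ω) • u + Real.cos (τ * ω) • v)‖ ≤ L * τ ^ 3
  taylor_y : ‖y1 - y - τ • V (β - (τ / 2) • A y)‖ ≤ L * τ ^ 3
  trapezoid_β : ‖β1 - β + (τ / 2) • A (y + y1)‖ ≤ L * τ ^ 3
  taylor_β : ‖β1 - β + τ • A y‖ ≤ L * τ ^ 2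
  diff_y : ‖y1 - y‖ ≤ L * τ

/-- Size of the corrected variables and of the corrections. -/
structure CorrectionBound (A : E →L[ℝ] E) (τ ω L : ℝ) (x q y b u v β : E) : Prop where
  norm_u : ‖u‖ ≤ L * τ
  norm_v : ‖v‖ ≤ L * τ
  norm_y : ‖y‖ ≤ L
  norm_β : ‖β‖ ≤ L
  sub_u : ‖x - u‖ ≤ L * τ ^ 2
  sub_β : ‖b - β‖ ≤ L * τ ^ 2
  norm_q : ‖ω⁻¹ • q‖ ≤ L * τ ^ 2

section Consistency

variable {A U V : E →L[ℝ] E} {ω K M τ t0 T : ℝ} {x q y b : ℝ → E}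

/-- The rapidly oscillating component with its slow drift removed. -/
noncomputable def fastU (A U : E →L[ℝ] E) (ω : ℝ) (x y : ℝ → E) (t : ℝ) : E :=
  x t + (ω⁻¹ ^ 2) • U (A (x t + y t))

noncomputable def fastV (U : E →L[ℝ] E) (ω : ℝ) (q b : ℝ → E) (t : ℝ) : E :=
  ω⁻¹ • (ω • q t - U (b t))

noncomputable def slowB (A : E →L[ℝ] E) (ω : ℝ) (q b : ℝ → E) (t : ℝ) : E :=
  b t + A (ω⁻¹ • q t)

lemma norm_smul_inv_q_le (hK : 1 ≤ K) (hM : 0 ≤ M) (hω : 1 ≤ ω) (hωτ : ω⁻¹ ≤ K * τ)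
    (hU : ∀ v, ‖U v‖ ≤ K * ‖v‖) {I : Set ℝ} (hb : EnergyBound U ω M x q y b I)
    {s : ℝ} (hs : s ∈ I) : ‖ω⁻¹ • q s‖ ≤ 2 * K ^ 3 * M * τ ^ 2 := by
  have hω0 : ω ≠ 0 := by positivity
  have e : ω⁻¹ • q s = (ω⁻¹ ^ 2) • ((ω • q s - U (b s)) + U (b s)) := by
    rw [sub_add_cancel, smul_smul]; congr 1; field_simp
  have h1 : ‖(ω • q s - U (b s)) + U (b s)‖ ≤ M + K * M :=
    (norm_add_le _ _).trans (add_le_add (hb.norm_w s hs) ((hU _).trans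
      (by gcongr; exact hb.norm_b s hs)))
  have h2 : M + K * M ≤ 2 * K * M := by nlinarith
  have h3 : ω⁻¹ ^ 2 ≤ (K * τ) ^ 2 := by gcongr
  rw [e, norm_smul, Real.norm_of_nonneg (by positivity)]
  calc _ ≤ (K * τ) ^ 2 * (2 * K * M) := by gcongr; exact h1.trans h2
    _ = _ := by ring

lemma norm_x_le (hω : 1 ≤ ω) {I : Set ℝ} (hb : EnergyBound U ω M x q y b I)
    {s : ℝ} (hs : s ∈ I) : ‖x s‖ ≤ ω⁻¹ * M := by
  have h := hb.norm_x s hs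
  rw [norm_smul, Real.norm_of_nonneg (by linarith)] at h
  rw [inv_mul_eq_div, le_div_iff₀ (by linarith)]
  linarith

lemma norm_add_xy_le (hM : 0 ≤ M) (hω : 1 ≤ ω) {I : Set ℝ}
    (hb : EnergyBound U ω M x q y b I) {s : ℝ} (hs : s ∈ I) : ‖x s + y s‖ ≤ 2 * M := by
  have h1 := norm_x_le hω hb hs
  have h2 : ω⁻¹ * M ≤ M := mul_le_of_le_one_left hM (inv_le_one_of_one_le₀ hω)
  linarith [norm_add_le (x s) (y s), hb.norm_y s hs]

lemma correctionBound (hK : 1 ≤ K) (hM : 0 ≤ M) (hτ : 0 ≤ τ) (hτ1 : τ ≤ 1) (hω : 1 ≤ ω)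
    (hωτ : ω⁻¹ ≤ K * τ) (hA : ∀ v, ‖A v‖ ≤ K * ‖v‖) (hU : ∀ v, ‖U v‖ ≤ K * ‖v‖)
    {I : Set ℝ} (hb : EnergyBound U ω M x q y b I) {s : ℝ} (hs : s ∈ I) :
    CorrectionBound A τ ω (3 * K ^ 5 * M) (x s) (q s) (y s) (b s)
      (fastU A U ω x y s) (fastV U ω q b s) (slowB A ω q b s) := by
  have hω0 : 0 < ω⁻¹ := by positivity
  have k3 : K ^ 3 * M ≤ K ^ 5 * M := by gcongr; norm_num
  have k4 : K ^ 4 * M ≤ K ^ 5 * M := by gcongr; norm_num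
  have k0 : 1 * M ≤ K ^ 5 * M := by gcongr; exact one_le_pow₀ hK
  have k1 : K ^ 1 * M ≤ K ^ 5 * M := by gcongr; norm_num
  have k5 : 0 ≤ K ^ 5 * M := by positivity
  have ht2 : τ ^ 2 ≤ τ := by nlinarith
  have hq := norm_smul_inv_q_le hK hM hω hωτ hU hb hs
  have hx : ‖x s‖ ≤ K * M * τ := (norm_x_le hω hb hs).trans (by nlinarith)
  have hcor : ‖(ω⁻¹ ^ 2) • U (A (x s + y s))‖ ≤ 2 * (K ^ 4 * M) * τ ^ 2 := by
    rw [norm_smul, Real.norm_of_nonneg (by positivity)]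
    calc _ ≤ (K * τ) ^ 2 * (K * (K * (2 * M))) := by
          gcongr
          refine (hU _).trans ?_
          gcongr
          refine (hA _).trans ?_
          gcongr
          exact norm_add_xy_le hM hω hb hs
      _ = _ := by ring
  have hAq : ‖A (ω⁻¹ • q s)‖ ≤ 2 * (K ^ 4 * M) * τ ^ 2 :=
    (hA _).trans (by calc _ ≤ K * (2 * K ^ 3 * M * τ ^ 2) := by gcongr
                      _ = _ := by ring)
  refine ⟨?_, ?_, ?_, ?_, ?_, ?_, ?_⟩
  · calc _ ≤ K * M * τ + 2 * (K ^ 4 * M) * τ ^ 2 :=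
          (norm_add_le _ _).trans (add_le_add hx hcor)
      _ ≤ K * M * τ + 2 * (K ^ 4 * M) * τ := by gcongr
      _ ≤ _ := by nlinarith
  · rw [fastV, norm_smul, Real.norm_of_nonneg hω0.le]
    calc _ ≤ K * τ * M := by gcongr; exact hb.norm_w s hs
      _ ≤ _ := by nlinarith
  · linarith [hb.norm_y s hs]
  · calc _ ≤ M + 2 * (K ^ 4 * M) * τ ^ 2 :=
          (norm_add_le _ _).trans (add_le_add (hb.norm_b s hs) hAq)
      _ ≤ M + 2 * (K ^ 4 * M) * 1 := by gcongr; nlinarith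
      _ ≤ _ := by linarith
  · rw [fastU, sub_add_cancel_left, norm_neg]
    exact hcor.trans (mul_le_mul_of_nonneg_right (by linarith) (by positivity))
  · rw [slowB, sub_add_cancel_left, norm_neg]
    exact hAq.trans (mul_le_mul_of_nonneg_right (by linarith) (by positivity))
  · exact hq.trans (mul_le_mul_of_nonneg_right (by linarith) (by positivity))

lemma hasDerivAt_slowB (h : SlowFastSolution A U V ω x q y b) (hω : ω ≠ 0) (s : ℝ) :
    HasDerivAt (slowB A ω q b) (-A (y s)) s := by
  refine ((h.deriv_b s).add
    (A.hasFDerivAt.comp_hasDerivAt s ((h.deriv_q s).const_smul ω⁻¹))).congr_deriv ?_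
  rw [smul_smul, inv_mul_cancel₀ hω, one_smul, map_add]
  abel

lemma norm_b_sub_le (h : SlowFastSolution A U V ω x q y b) (hM : 0 ≤ M) (hτ : 0 ≤ τ)
    (hK : 1 ≤ K) (hω : 1 ≤ ω) (hA : ∀ v, ‖A v‖ ≤ K * ‖v‖) {t : ℝ}
    (hb : EnergyBound U ω M x q y b (Icc t (t + τ))) :
    ∀ s ∈ Icc t (t + τ), ‖b s - b t‖ ≤ K * (2 * M) * τ :=
  norm_sub_le_of_deriv hτ h.deriv_b fun s hs => by
    rw [norm_neg]
    exact (hA _).trans (by gcongr; exact norm_add_xy_le hM hω hb hs)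

lemma trapezoid_error_slow (h : SlowFastSolution A U V ω x q y b) (hM : 0 ≤ M) (hτ : 0 ≤ τ)
    (hK : 1 ≤ K) (hω : 1 ≤ ω) (hA : ∀ v, ‖A v‖ ≤ K * ‖v‖) (hV : ∀ v, ‖V v‖ ≤ K * ‖v‖)
    {t : ℝ} (hb : EnergyBound U ω M x q y b (Icc t (t + τ))) {z : ℝ → E}
    (hz : ∀ s, HasDerivAt z (y s) s) :
    ‖z (t + τ) - z t - (τ / 2) • (y t + y (t + τ))‖ ≤ 2 * K ^ 2 * M * τ ^ 3 :=
  trapezoid_error hτ hz h.deriv_y fun s hs => by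
    rw [← map_sub]
    refine (hV _).trans ?_
    calc _ ≤ K * (K * (2 * M) * τ) := by gcongr; exact norm_b_sub_le h hM hτ hK hω hA hb s hs
      _ = _ := by ring

lemma localConsistency (h : SlowFastSolution A U V ω x q y b) (hK : 1 ≤ K) (hM : 0 ≤ M)
    (hτ : 0 ≤ τ) (hω : 1 ≤ ω)
    (hωτ : ω⁻¹ ≤ K * τ) (hA : ∀ v, ‖A v‖ ≤ K * ‖v‖) (hU : ∀ v, ‖U v‖ ≤ K * ‖v‖)
    (hV : ∀ v, ‖V v‖ ≤ K * ‖v‖)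
    {t : ℝ} (hb : EnergyBound U ω M x q y b (Icc t (t + τ))) :
    LocalConsistency A U V τ ω (3 * K ^ 5 * M)
      (fastU A U ω x y t) (fastV U ω q b t) (y t) (slowB A ω q b t)
      (fastU A U ω x y (t + τ)) (fastV U ω q b (t + τ)) (y (t + τ))
      (slowB A ω q b (t + τ)) := by
  have hω0 : ω ≠ 0 := by positivity
  have hend : t + τ ∈ Icc t (t + τ) := ⟨by linarith, le_rfl⟩
  have k2 : K ^ 2 * M ≤ K ^ 5 * M := by gcongr; norm_num
  have k1 : K ^ 1 * M ≤ K ^ 5 * M := by gcongr; norm_num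
  have k3 : K ^ 3 * M ≤ K ^ 5 * M := by gcongr; norm_num
  have k5 : 0 ≤ K ^ 5 * M := by positivity
  have hrot := rotation_error (u := fastU A U ω x y) (v := fastV U ω q b) (ω := ω) (t := t)
    (τ := τ) (R := 2 * K ^ 5 * M * τ ^ 2)
    (r := fun s => (ω⁻¹ ^ 2) • U (A (-(ω • q s - U (b s)) + V (b s)))) hτ
    (fun s => ((h.deriv_x s).add (((U.comp A).hasFDerivAt.comp_hasDerivAt s
      ((h.deriv_x s).add (h.deriv_y s))).const_smul (ω⁻¹ ^ 2))).congr_deriv (by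
        simp only [ContinuousLinearMap.comp_apply, fastV]
        rw [smul_inv_smul₀ hω0, neg_sub]
        abel))
    (fun s => ((((h.deriv_q s).const_smul ω).sub
      (U.hasFDerivAt.comp_hasDerivAt s (h.deriv_b s))).const_smul ω⁻¹).congr_deriv (by
        have : ω * ω⁻¹ ^ 2 = ω⁻¹ := by field_simp
        simp only [fastU]
        rw [smul_add, smul_smul ω (ω⁻¹ ^ 2), this, smul_sub, inv_smul_smul₀ hω0, map_neg,
          smul_neg, sub_neg_eq_add]))
    (fun s hs => by
      rw [norm_smul, Real.norm_of_nonneg (by positivity)]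
      calc _ ≤ (K * τ) ^ 2 * (K * (K * (M + K * M))) := by
            gcongr
            refine (hU _).trans ?_
            gcongr
            refine (hA _).trans ?_
            gcongr
            refine (norm_add_le _ _).trans ?_
            rw [norm_neg]
            gcongr
            · exact hb.norm_w s hs
            · exact (hV _).trans (by gcongr; exact hb.norm_b s hs)
        _ ≤ (K * τ) ^ 2 * (K * (K * (K * M + K * M))) := by gcongr; nlinarith
        _ = _ := by ring)
  have hy : ∀ s ∈ Icc t (t + τ), ‖y s - y t‖ ≤ K * M * τ :=
    norm_sub_le_of_deriv hτ h.deriv_y fun s hs => (hV _).trans (by gcongr; exact hb.norm_b s hs)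
  have hβ : ∀ s ∈ Icc t (t + τ),
      ‖slowB A ω q b s - slowB A ω q b t + (s - t) • A (y t)‖ ≤ K * (K * M * τ) * τ := by
    intro s hs
    have := norm_sub_le_of_deriv (t := t) (C := K * (K * M * τ)) hτ
      (f := fun s => slowB A ω q b s + (s - t) • A (y t))
      (f' := fun s => -A (y s - y t))
      (fun s => ((hasDerivAt_slowB h hω0 s).add
        (((hasDerivAt_id s).sub_const t).smul_const (A (y t)))).congr_deriv (by
          rw [one_smul, map_sub]; abel))
      (fun s hs => by rw [norm_neg]; exact (hA _).trans (by gcongr; exact hy s hs)) s hs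
    convert this using 2
    simp only [sub_self, zero_smul]
    abel
  refine ⟨?_, ?_, ?_, ?_, ?_, ?_⟩
  · refine hrot.1.trans ?_
    nlinarith [pow_nonneg hτ 3]
  · refine hrot.2.trans ?_
    nlinarith [pow_nonneg hτ 3]
  · have := norm_sub_le_of_deriv (t := t) (C := 3 * K ^ 5 * M * τ ^ 2) hτ
      (f := fun s => y s - (s - t) • V (slowB A ω q b t) + ((s - t) ^ 2 / 2) • V (A (y t)))
      (f' := fun s => V (slowB A ω q b s - slowB A ω q b t + (s - t) • A (y t))
        - V (A (ω⁻¹ • q s)))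
      (fun s => (((h.deriv_y s).sub (((hasDerivAt_id s).sub_const t).smul_const _)).add
        (((((hasDerivAt_id s).sub_const t).pow 2).div_const 2).smul_const
          (V (A (y t))))).congr_deriv (by
            simp only [slowB, map_add, map_sub, map_smul, id]
            module))
      (fun s hs => by
        refine (norm_sub_le _ _).trans ?_
        calc _ ≤ K * (K * (K * M * τ) * τ) + K * (K * (2 * K ^ 3 * M * τ ^ 2)) := by
              gcongr
              · exact (hV _).trans (by gcongr; exact hβ s hs)
              · refine (hV _).trans ?_
                gcongr
                refine (hA _).trans ?_
                gcongr
                exact norm_smul_inv_q_le hK hM hω hωτ hU hb hs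
          _ = (K ^ 3 * M + 2 * (K ^ 5 * M)) * τ ^ 2 := by ring
          _ ≤ _ := by gcongr; linarith)
      (t + τ) hend
    calc _ = ‖(y (t + τ) - (t + τ - t) • V (slowB A ω q b t)
            + ((t + τ - t) ^ 2 / 2) • V (A (y t))) -
            (y t - (t - t) • V (slowB A ω q b t) + ((t - t) ^ 2 / 2) • V (A (y t)))‖ := by
          rw [add_sub_cancel_left, sub_self, map_sub, map_smul]
          congr 1
          module
      _ ≤ _ := this
      _ = _ := by ring
  · have := trapezoid_error (t := t) (τ := τ) (L := 2 * K ^ 3 * M) hτ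
      (hasDerivAt_slowB h hω0)
      (fun s => (A.hasFDerivAt.comp_hasDerivAt s (h.deriv_y s)).neg)
      (fun s hs => by
        rw [← neg_sub', norm_neg, ← map_sub, ← map_sub]
        refine (hA _).trans ?_
        calc _ ≤ K * (K * (K * (2 * M) * τ)) := by
              gcongr
              refine (hV _).trans ?_
              gcongr
              exact norm_b_sub_le h hM hτ hK hω hA hb s hs
          _ = _ := by ring)
    calc _ = _ := by
          congr 1
          rw [map_add]
          simp only [smul_add, smul_neg]
          abel
      _ ≤ _ := this
      _ ≤ _ := mul_le_mul_of_nonneg_right (by linarith) (by positivity)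
  · have := hβ (t + τ) hend
    rw [add_sub_cancel_left] at this
    refine this.trans ?_
    nlinarith [sq_nonneg τ]
  · refine (hy _ hend).trans ?_
    exact mul_le_mul_of_nonneg_right (by linarith) hτ

end Consistency

/-- Scalar coefficients of the scheme, together with the coefficients `κ`, `μ`, `ν` of a change of
variables that removes the leading part of its local defect. -/
structure StepCoefficients (K τ φ ψ c s κ μ ν : ℝ) : Prop where
  sq_add_sq : c ^ 2 + s ^ 2 = 1
  abs_φ : |φ| ≤ K
  abs_ψ : |ψ| ≤ K
  abs_κ : |κ| ≤ K * τ
  abs_μ : |μ| ≤ K * τ ^ 2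
  abs_ν : |ν| ≤ K * τ
  s_mul_κ : s * κ = τ / 2 * ψ * (1 + c)
  κ_mul : κ * (1 - c) = τ / 2 * ψ * s
  μ_mul : μ * (1 - c) = s * κ * (τ / 2)
  s_mul_μ : s * μ + κ * (1 - c) * (τ / 2) = κ * τ
  ν_mul_s : ν * s = τ / 2 * φ * (1 + c)
  ν_mul : ν * (1 - c) = τ / 2 * φ * s

/-- The value of `b` after the first half step. -/
noncomputable def halfStep (A : E →L[ℝ] E) (τ φ : ℝ) (x y b : E) : E :=
  b - (τ / 2) • A (φ • x + y)

/-- One step of the scheme for a slow-fast system, with defects `dx`, `dq`, `dy`, `db`. -/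
structure PerturbedStep (A U V : E →L[ℝ] E) (τ φ ψ c s : ℝ)
    (x q y b x1 q1 y1 b1 dx dq dy db : E) : Prop where
  eq_x : x1 = c • (x + (τ / 2 * ψ) • U (halfStep A τ φ x y b)) - s • q
    + (τ / 2 * ψ) • U (halfStep A τ φ x y b) + dx
  eq_q : q1 = s • (x + (τ / 2 * ψ) • U (halfStep A τ φ x y b)) + c • q + dq
  eq_y : y1 = y + τ • V (halfStep A τ φ x y b) + dy
  eq_b : b1 = halfStep A τ φ x y b - (τ / 2) • A (φ • x1 + y1) + db

lemma PerturbedStep.sub {A U V : E →L[ℝ] E} {τ φ ψ c s : ℝ}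
    {x q y b x1 q1 y1 b1 dx dq dy db x' q' y' b' x1' q1' y1' b1' dx' dq' dy' db' : E}
    (h : PerturbedStep A U V τ φ ψ c s x q y b x1 q1 y1 b1 dx dq dy db)
    (h' : PerturbedStep A U V τ φ ψ c s x' q' y' b' x1' q1' y1' b1' dx' dq' dy' db') :
    PerturbedStep A U V τ φ ψ c s (x - x') (q - q') (y - y') (b - b')
      (x1 - x1') (q1 - q1') (y1 - y1') (b1 - b1') (dx - dx') (dq - dq') (dy - dy')
      (db - db') := by
  have hh : halfStep A τ φ (x - x') (y - y') (b - b') =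
      halfStep A τ φ x y b - halfStep A τ φ x' y' b' := by
    simp only [halfStep, map_add, map_sub, map_smul]
    module
  refine ⟨?_, ?_, ?_, ?_⟩
  · rw [hh, h.eq_x, h'.eq_x, map_sub]; module
  · rw [hh, h.eq_q, h'.eq_q, map_sub]; module
  · rw [hh, h.eq_y, h'.eq_y, map_sub]; module
  · rw [hh, h.eq_b, h'.eq_b]
    simp only [map_add, map_sub, map_smul]
    module

lemma pairNorm_rotate {c s : ℝ} (h : c ^ 2 + s ^ 2 = 1) (x q : E) :
    pairNorm (c • x - s • q) (s • x + c • q) = pairNorm x q := by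
  refine (sq_eq_sq₀ (pairNorm_nonneg _ _) (pairNorm_nonneg _ _)).1 ?_
  rw [sq_pairNorm, sq_pairNorm, norm_sub_sq_real, norm_add_sq_real]
  simp only [norm_smul, mul_pow, Real.norm_eq_abs, sq_abs, real_inner_smul_left,
    real_inner_smul_right]
  linear_combination (‖x‖ ^ 2 + ‖q‖ ^ 2) * h

lemma PerturbedStep.norm_le {A U V : E →L[ℝ] E} {K τ φ ψ c s Δ : ℝ}
    {x q y b x1 q1 y1 b1 dx dq dy db : E} (hK : 1 ≤ K) (hτ : 0 ≤ τ) (hτ1 : τ ≤ 1)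
    (hA : ∀ v, ‖A v‖ ≤ K * ‖v‖) (hU : ∀ v, ‖U v‖ ≤ K * ‖v‖) (hV : ∀ v, ‖V v‖ ≤ K * ‖v‖)
    (hcs : c ^ 2 + s ^ 2 = 1) (hφ : |φ| ≤ K) (hψ : |ψ| ≤ K)
    (h : PerturbedStep A U V τ φ ψ c s x q y b x1 q1 y1 b1 dx dq dy db)
    (hdx : ‖dx‖ ≤ Δ) (hdq : ‖dq‖ ≤ Δ) (hdy : ‖dy‖ ≤ Δ) (hdb : ‖db‖ ≤ Δ) :
    pairNorm x1 q1 + ‖y1‖ + ‖b1‖ ≤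
      (1 + 10 * K ^ 6 * τ) * (pairNorm x q + ‖y‖ + ‖b‖) + 6 * K ^ 2 * Δ := by
  set N := pairNorm x q + ‖y‖ + ‖b‖ with hN
  have hρ0 := pairNorm_nonneg x q
  have hN0 : 0 ≤ N := by positivity
  have hΔ : 0 ≤ Δ := (norm_nonneg _).trans hdx
  have hAφ : ∀ x y : E, ‖(τ / 2) • A (φ • x + y)‖ ≤ τ / 2 * (K * (K * ‖x‖ + ‖y‖)) := by
    intro x y
    rw [norm_smul, Real.norm_of_nonneg (by positivity)]
    gcongr
    refine (hA _).trans ?_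
    gcongr
    refine (norm_add_le _ _).trans ?_
    rw [norm_smul]
    gcongr
    exact hφ
  have hxy : K * ‖x‖ + ‖y‖ ≤ K * N := by
    nlinarith [norm_fst_le_pairNorm x q, norm_nonneg y, norm_nonneg b]
  have hbh : ‖halfStep A τ φ x y b‖ ≤ ‖b‖ + τ / 2 * (K * (K * N)) :=
    (norm_sub_le _ _).trans (add_le_add le_rfl ((hAφ x y).trans (by gcongr)))
  have hK2 : 1 ≤ K ^ 2 := one_le_pow₀ hK
  have hbh' : ‖halfStep A τ φ x y b‖ ≤ 2 * K ^ 2 * N := by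
    have h1 : τ / 2 * (K * (K * N)) ≤ 1 * (K * (K * N)) := by gcongr; linarith
    have h2 : ‖b‖ ≤ 1 * N := by linarith [norm_nonneg y]
    nlinarith
  have hk : ‖(τ / 2 * ψ) • U (halfStep A τ φ x y b)‖ ≤ K ^ 4 * τ * N := by
    rw [norm_smul, norm_mul, Real.norm_of_nonneg (by positivity : 0 ≤ τ / 2)]
    calc _ ≤ τ / 2 * K * (K * (2 * K ^ 2 * N)) := by
          gcongr
          · exact hψ
          · exact (hU _).trans (by gcongr)
      _ = _ := by ring
  have h_x := h.eq_x
  have h_q := h.eq_q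
  set k := (τ / 2 * ψ) • U (halfStep A τ φ x y b) with hkdef
  have hρ : pairNorm x1 q1 ≤ pairNorm x q + 2 * (K ^ 4 * τ * N) + 2 * Δ := by
    have e1 : x1 = (c • (x + k) - s • q) + (k + dx) := by rw [h_x]; abel
    rw [e1, h_q]
    refine (pairNorm_add_le _ _ _ _).trans ?_
    rw [pairNorm_rotate hcs]
    have e2 : pairNorm (x + k) q ≤ pairNorm x q + ‖k‖ := by
      have := pairNorm_add_le x q k 0
      have h3 := pairNorm_le k (0 : E)
      rw [add_zero] at this
      rw [norm_zero, add_zero] at h3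
      linarith
    linarith [pairNorm_le (k + dx) dq, norm_add_le k dx]
  have hy : ‖y1‖ ≤ ‖y‖ + τ * (K * (2 * K ^ 2 * N)) + Δ := by
    rw [h.eq_y]
    refine (norm_add_le _ _).trans (add_le_add ((norm_add_le _ _).trans
      (add_le_add le_rfl ?_)) hdy)
    rw [norm_smul, Real.norm_of_nonneg hτ]
    gcongr
    exact (hV _).trans (by gcongr)
  have hb : ‖b1‖ ≤ ‖b‖ + τ / 2 * (K * (K * N)) + τ / 2 * (K * (K * ‖x1‖ + ‖y1‖)) + Δ := by
    rw [h.eq_b]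
    exact (norm_add_le _ _).trans (add_le_add ((norm_sub_le _ _).trans
      (add_le_add hbh (hAφ _ _))) hdb)
  have p3 : 1 ≤ K ^ 3 := one_le_pow₀ hK
  have p4 : 1 ≤ K ^ 4 := one_le_pow₀ hK
  have p26 : K ^ 2 ≤ K ^ 6 := by gcongr; norm_num
  have p36 : K ^ 3 ≤ K ^ 6 := by gcongr; norm_num
  have p46 : K ^ 4 ≤ K ^ 6 := by gcongr; norm_num
  have p12 : K ≤ K ^ 2 := by nlinarith
  have hx1 : ‖x1‖ ≤ 3 * K ^ 4 * N + 2 * Δ := by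
    have h1 : K ^ 4 * τ * N ≤ K ^ 4 * 1 * N := by gcongr
    have h2 : 1 * N ≤ K ^ 4 * N := by gcongr
    linarith [norm_fst_le_pairNorm x1 q1, norm_nonneg y, norm_nonneg b]
  have hy1 : ‖y1‖ ≤ 3 * K ^ 3 * N + Δ := by
    have h1 : τ * (K * (2 * K ^ 2 * N)) ≤ 1 * (K * (2 * K ^ 2 * N)) := by gcongr
    have h2 : 1 * N ≤ K ^ 3 * N := by gcongr
    linarith [norm_nonneg b]
  have hlast : τ / 2 * (K * (K * ‖x1‖ + ‖y1‖)) ≤ 3 * K ^ 6 * τ * N + 2 * K ^ 2 * Δ := by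
    calc _ ≤ τ / 2 * (K * (K * (3 * K ^ 4 * N + 2 * Δ) + (3 * K ^ 3 * N + Δ))) := by gcongr
      _ = (3 * K ^ 6 + 3 * K ^ 4) / 2 * (τ * N) + τ / 2 * (2 * K ^ 2 + K) * Δ := by ring
      _ ≤ (3 * K ^ 6 + 3 * K ^ 6) / 2 * (τ * N) + 1 / 2 * (2 * K ^ 2 + K ^ 2) * Δ := by gcongr
      _ ≤ _ := by nlinarith
  have t2 : K ^ 2 * (τ * N) ≤ K ^ 6 * (τ * N) := by gcongr
  have t3 : K ^ 3 * (τ * N) ≤ K ^ 6 * (τ * N) := by gcongr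
  have t4 : K ^ 4 * (τ * N) ≤ K ^ 6 * (τ * N) := by gcongr
  have t6 : 0 ≤ K ^ 6 * (τ * N) := by positivity
  have u2 : 1 * Δ ≤ K ^ 2 * Δ := by gcongr
  calc _ ≤ N + 2 * (K ^ 4 * (τ * N)) + 2 * (K ^ 3 * (τ * N)) + K ^ 2 * (τ * N) / 2
        + 3 * (K ^ 6 * (τ * N)) + 2 * (K ^ 2 * Δ) + 4 * Δ := by linarith
    _ ≤ _ := by linarith

lemma norm_smul_map_le {A : E →L[ℝ] E} {K a α β : ℝ} {v : E} (hA : ∀ v, ‖A v‖ ≤ K * ‖v‖)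
    (hK : 0 ≤ K) (ha : |a| ≤ α) (hv : ‖v‖ ≤ β) : ‖a • A v‖ ≤ α * (K * β) := by
  rw [norm_smul, Real.norm_eq_abs]
  gcongr
  · exact (abs_nonneg _).trans ha
  · exact (hA v).trans (by gcongr)

lemma LocalConsistency.perturbedStep {A U V : E →L[ℝ] E} {K L τ ω φ ψ κ μ ν : ℝ}
    {u v y β u1 v1 y1 β1 X Q B X1 Q1 B1 : E} (hK : 1 ≤ K) (hL : 0 ≤ L) (hτ : 0 ≤ τ) (hτ1 : τ ≤ 1)
    (hA : ∀ v, ‖A v‖ ≤ K * ‖v‖) (hU : ∀ v, ‖U v‖ ≤ K * ‖v‖) (hV : ∀ v, ‖V v‖ ≤ K * ‖v‖)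
    (hc : StepCoefficients K τ φ ψ (Real.cos (τ * ω)) (Real.sin (τ * ω)) κ μ ν)
    (h : LocalConsistency A U V τ ω L u v y β u1 v1 y1 β1)
    (hX : X = u - μ • U (A y)) (hQ : Q = v + κ • U β) (hB : B = β - ν • A Q)
    (hX1 : X1 = u1 - μ • U (A y1)) (hQ1 : Q1 = v1 + κ • U β1) (hB1 : B1 = β1 - ν • A Q1)
    (hXn : ‖X‖ ≤ 2 * K ^ 3 * L * τ) (hQn : ‖Q‖ ≤ 2 * K ^ 2 * L * τ) :
    ∃ dx dq dy db, PerturbedStep A U V τ φ ψ (Real.cos (τ * ω)) (Real.sin (τ * ω))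
        X Q y B X1 Q1 y1 B1 dx dq dy db ∧
      ‖dx‖ ≤ 12 * K ^ 9 * L * τ ^ 3 ∧ ‖dq‖ ≤ 12 * K ^ 9 * L * τ ^ 3 ∧
      ‖dy‖ ≤ 12 * K ^ 9 * L * τ ^ 3 ∧ ‖db‖ ≤ 12 * K ^ 9 * L * τ ^ 3 := by
  have hcos := Real.abs_cos_le_one (τ * ω)
  have hsin := Real.abs_sin_le_one (τ * ω)
  have hru := h.rot_u
  have hrv := h.rot_v
  set c := Real.cos (τ * ω)
  set s := Real.sin (τ * ω)
  have hK0 : 0 ≤ K := by linarith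
  set ε := ν • A Q + (τ / 2 * φ) • A X with hε
  have hhalf : halfStep A τ φ X y B = β - (τ / 2) • A y - ε := by
    rw [halfStep, hB, hε, map_add, map_smul]; module
  have hpow : ∀ n, n ≤ 9 → K ^ n * (L * τ ^ 3) ≤ K ^ 9 * (L * τ ^ 3) := fun n hn => by
    gcongr
  have k9 : 0 ≤ K ^ 9 * (L * τ ^ 3) := by positivity
  have k0 := hpow 0 (by norm_num)
  have k2 := hpow 2 (by norm_num)
  have k3 := hpow 3 (by norm_num)
  have k6 := hpow 6 (by norm_num)
  have k7 : K ^ 7 * (L * τ ^ 3) ≤ K ^ 9 * (L * τ ^ 3) := hpow 7 (by norm_num)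
  have j0 : K ^ 0 * (L * τ ^ 3) ≤ K ^ 7 * (L * τ ^ 3) := by gcongr; norm_num
  have j2 : K ^ 2 * (L * τ ^ 3) ≤ K ^ 7 * (L * τ ^ 3) := by gcongr; norm_num
  have j3 : K ^ 3 * (L * τ ^ 3) ≤ K ^ 7 * (L * τ ^ 3) := by gcongr; norm_num
  have hφ : |τ / 2 * φ| ≤ τ / 2 * K := by
    rw [abs_mul, abs_of_nonneg (by positivity : 0 ≤ τ / 2)]
    gcongr
    exact hc.abs_φ
  have hεn : ‖ε‖ ≤ 3 * K ^ 5 * L * τ ^ 2 := by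
    have k45 : K ^ 4 * (L * τ ^ 2) ≤ K ^ 5 * (L * τ ^ 2) := by gcongr; norm_num
    calc _ ≤ K * τ * (K * (2 * K ^ 2 * L * τ)) + τ / 2 * K * (K * (2 * K ^ 3 * L * τ)) :=
          (norm_add_le _ _).trans (add_le_add (norm_smul_map_le hA hK0 hc.abs_ν hQn)
            (norm_smul_map_le hA hK0 hφ hXn))
      _ ≤ _ := by linarith
  set dx := X1 - (c • (X + (τ / 2 * ψ) • U (halfStep A τ φ X y B)) - s • Q
    + (τ / 2 * ψ) • U (halfStep A τ φ X y B)) with hdx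
  set dq := Q1 - (s • (X + (τ / 2 * ψ) • U (halfStep A τ φ X y B)) + c • Q) with hdq
  have hκs : |s * κ| ≤ K * τ := by
    rw [abs_mul]
    exact (mul_le_of_le_one_left (abs_nonneg _) hsin).trans hc.abs_κ
  have hκc : |κ * (1 - c)| ≤ 2 * (K * τ) := by
    rw [abs_mul]
    have : |1 - c| ≤ 2 := by rw [abs_le] at hcos ⊢; constructor <;> linarith
    calc _ ≤ (K * τ) * 2 := by gcongr; exact hc.abs_κ
      _ = _ := by ring
  have edx : dx = (u1 - (c • u - s • v)) - μ • U (A (y1 - y)) + (s * κ) • U ε := by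
    rw [hdx, hhalf, hX1, hX, hQ]
    simp only [map_sub, map_smul]
    linear_combination (norm := module) hc.s_mul_κ • (U β - (τ / 2) • U (A y) - U ε)
      - hc.μ_mul • U (A y)
  have edq : dq = (v1 - (s • u + c • v)) + κ • U (β1 - β + τ • A y)
      + (κ * (1 - c)) • U ε := by
    rw [hdq, hhalf, hQ1, hX, hQ]
    simp only [map_sub, map_add, map_smul]
    linear_combination (norm := module) hc.κ_mul • (U β - (τ / 2) • U (A y) - U ε)
      + hc.s_mul_μ • U (A y)
  have ndx : ‖dx‖ ≤ 5 * (K ^ 7 * (L * τ ^ 3)) := by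
    rw [edx]
    have h1 : ‖U (A (y1 - y))‖ ≤ K * (K * (L * τ)) :=
      (hU _).trans (by gcongr; exact (hA _).trans (by gcongr; exact h.diff_y))
    calc _ ≤ L * τ ^ 3 + K * τ ^ 2 * (K * (K * (L * τ)))
          + K * τ * (K * (3 * K ^ 5 * L * τ ^ 2)) := by
          refine (norm_add_le _ _).trans (add_le_add ((norm_sub_le _ _).trans
            (add_le_add hru ?_)) (norm_smul_map_le hU hK0 hκs hεn))
          rw [norm_smul]
          gcongr
          exact hc.abs_μ
      _ ≤ _ := by linarith
  have ndq : ‖dq‖ ≤ 8 * (K ^ 7 * (L * τ ^ 3)) := by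
    rw [edq]
    calc _ ≤ L * τ ^ 3 + K * τ * (K * (L * τ ^ 2))
          + 2 * (K * τ) * (K * (3 * K ^ 5 * L * τ ^ 2)) :=
          (norm_add_le _ _).trans (add_le_add ((norm_add_le _ _).trans
            (add_le_add hrv (norm_smul_map_le hU hK0 hc.abs_κ h.taylor_β)))
              (norm_smul_map_le hU hK0 hκc hεn))
      _ ≤ _ := by linarith
  refine ⟨dx, dq, (y1 - y - τ • V (β - (τ / 2) • A y)) + τ • V ε,
    (β1 - β + (τ / 2) • A (y + y1)) - ν • A dq + (τ / 2 * φ) • A dx, ⟨?_, ?_, ?_, ?_⟩,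
    ?_, ?_, ?_, ?_⟩
  · rw [hdx]; abel
  · rw [hdq]; abel
  · rw [hhalf, map_sub V _ ε]; module
  · have hrel : ν • A dq - (τ / 2 * φ) • A dx = ν • A (Q1 - Q) - (τ / 2 * φ) • A (X1 + X) := by
      rw [hdx, hdq]
      generalize (τ / 2 * ψ) • U (halfStep A τ φ X y B) = k
      simp only [map_sub, map_add, map_smul]
      linear_combination (norm := module) hc.ν_mul • A Q - hc.ν_mul_s • A X - hc.ν_mul_s • A k
    rw [hhalf, hε, hB1]
    simp only [map_sub, map_add, map_smul] at hrel ⊢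
    linear_combination (norm := module) hrel
  · linarith
  · linarith
  · calc _ ≤ L * τ ^ 3 + τ * (K * (3 * K ^ 5 * L * τ ^ 2)) :=
          (norm_add_le _ _).trans (add_le_add h.taylor_y
            (norm_smul_map_le hV hK0 (abs_of_nonneg hτ).le hεn))
      _ ≤ _ := by linarith
  · calc _ ≤ L * τ ^ 3 + K * τ * (K * (8 * (K ^ 7 * (L * τ ^ 3))))
          + τ / 2 * K * (K * (5 * (K ^ 7 * (L * τ ^ 3)))) :=
          (norm_add_le _ _).trans (add_le_add ((norm_sub_le _ _).trans
            (add_le_add h.trapezoid_β (norm_smul_map_le hA hK0 hc.abs_ν ndq)))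
              (norm_smul_map_le hA hK0 hφ ndx))
      _ ≤ L * τ ^ 3 + K * 1 * (K * (8 * (K ^ 7 * (L * τ ^ 3))))
          + 1 / 2 * K * (K * (5 * (K ^ 7 * (L * τ ^ 3)))) := by gcongr
      _ ≤ _ := by linarith

lemma le_of_step_le {N : ℕ → ℝ} {a δ : ℝ} (ha : 0 ≤ a) (hδ : 0 ≤ δ) (h0 : 0 ≤ N 0) {m : ℕ}
    (h : ∀ n < m, N (n + 1) ≤ (1 + a) * N n + δ) :
    ∀ n ≤ m, N n ≤ Real.exp (n * a) * (N 0 + n * δ) := by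
  intro n
  induction n with
  | zero => intro _; simp
  | succ n ih =>
    intro hn
    have h1 := h n (by omega)
    have h2 := ih (by omega)
    have h3 : 1 + a ≤ Real.exp a := by linarith [Real.add_one_le_exp a]
    have h4 : 1 ≤ Real.exp ((n + 1) * a) := Real.one_le_exp (by positivity)
    have h5 : Real.exp ((n + 1) * a) = Real.exp a * Real.exp (n * a) := by
      rw [← Real.exp_add]; congr 1; ring
    push_cast
    calc N (n + 1) ≤ (1 + a) * (Real.exp (n * a) * (N 0 + n * δ)) + δ := by
          refine h1.trans ?_; gcongr
      _ ≤ Real.exp a * (Real.exp (n * a) * (N 0 + n * δ)) + Real.exp ((n + 1) * a) * δ := by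
          gcongr
          exact le_mul_of_one_le_left hδ h4
      _ = _ := by rw [h5]; ring

end Abstract

section Convergence

variable {E : Type*} [NormedAddCommGroup E] [InnerProductSpace ℝ E]
  {A U V : E →L[ℝ] E} {K L M T t0 τ ω φ ψ κ μ ν : ℝ}

/-- The corrected exact solution has a small fast part and is close to the exact solution. -/
lemma CorrectionBound.reference {x q y b u v β : E} (h : CorrectionBound A τ ω L x q y b u v β)
    (hK : 1 ≤ K) (hL : 0 ≤ L) (hτ : 0 ≤ τ) (hτ1 : τ ≤ 1)
    (hA : ∀ v, ‖A v‖ ≤ K * ‖v‖) (hU : ∀ v, ‖U v‖ ≤ K * ‖v‖)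
    {c s : ℝ} (hc : StepCoefficients K τ φ ψ c s κ μ ν) {X Q B : E}
    (hX : X = u - μ • U (A y)) (hQ : Q = v + κ • U β) (hB : B = β - ν • A Q) :
    ‖X‖ ≤ 2 * K ^ 3 * L * τ ∧ ‖Q‖ ≤ 2 * K ^ 2 * L * τ ∧ ‖X - x‖ ≤ 2 * K ^ 3 * L * τ ^ 2 ∧
      ‖B - b‖ ≤ 3 * K ^ 4 * L * τ ^ 2 := by
  have hK0 : 0 ≤ K := by linarith
  have hμ : ‖μ • U (A y)‖ ≤ K ^ 3 * (L * τ ^ 2) :=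
    (norm_smul_map_le hU hK0 hc.abs_μ ((hA y).trans
      (mul_le_mul_of_nonneg_left h.norm_y hK0))).trans_eq (by ring)
  have hκ : ‖κ • U β‖ ≤ K ^ 2 * (L * τ) :=
    (norm_smul_map_le hU hK0 hc.abs_κ h.norm_β).trans_eq (by ring)
  have hττ : L * τ ^ 2 ≤ L * τ := by gcongr; nlinarith
  have k2 : 1 * (L * τ) ≤ K ^ 2 * (L * τ) := by gcongr; exact one_le_pow₀ hK
  have hQn : ‖Q‖ ≤ 2 * K ^ 2 * L * τ := by
    rw [hQ]
    linarith [norm_add_le v (κ • U β), h.norm_v]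
  refine ⟨?_, hQn, ?_, ?_⟩
  · have k3 : 1 * (L * τ) ≤ K ^ 3 * (L * τ) := by gcongr; exact one_le_pow₀ hK
    have : K ^ 3 * (L * τ ^ 2) ≤ K ^ 3 * (L * τ) := by gcongr
    rw [hX]
    linarith [norm_sub_le u (μ • U (A y)), h.norm_u]
  · have k3 : 1 * (L * τ ^ 2) ≤ K ^ 3 * (L * τ ^ 2) := by gcongr; exact one_le_pow₀ hK
    have e : X - x = -(x - u) - μ • U (A y) := by rw [hX]; abel
    rw [e]
    have := norm_sub_le (-(x - u)) (μ • U (A y))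
    rw [norm_neg] at this
    linarith [h.sub_u]
  · have k4 : 1 * (L * τ ^ 2) ≤ K ^ 4 * (L * τ ^ 2) := by gcongr; exact one_le_pow₀ hK
    have hν : ‖ν • A Q‖ ≤ 2 * (K ^ 4 * (L * τ ^ 2)) :=
      (norm_smul_map_le hA hK0 hc.abs_ν hQn).trans_eq (by ring)
    have e : B - b = -(b - β) - ν • A Q := by rw [hB]; abel
    rw [e]
    have := norm_sub_le (-(b - β)) (ν • A Q)
    rw [norm_neg] at this
    linarith [h.sub_β]

/-- The error constant of the corrected variables, on a time interval of length `T`. -/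
noncomputable def growthConst (K L T : ℝ) : ℝ :=
  Real.exp (10 * K ^ 6 * T) * (8 * K ^ 4 * L + 72 * K ^ 11 * L * T)

lemma growthConst_nonneg (hK : 1 ≤ K) (hL : 0 ≤ L) (hT : 0 ≤ T) : 0 ≤ growthConst K L T := by
  unfold growthConst; positivity

/-- Second order convergence for slow-fast systems, uniformly in the frequency. -/
theorem error_le {x q y b z : ℝ → E} (h : SlowFastSolution A U V ω x q y b)
    (hz : ∀ t, HasDerivAt z (y t) t) (hK : 1 ≤ K) (hM : 0 ≤ M) (hτ : 0 ≤ τ) (hτ1 : τ ≤ 1)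
    (hω : 1 ≤ ω) (hωτ : ω⁻¹ ≤ K * τ) (hA : ∀ v, ‖A v‖ ≤ K * ‖v‖) (hU : ∀ v, ‖U v‖ ≤ K * ‖v‖)
    (hV : ∀ v, ‖V v‖ ≤ K * ‖v‖) (hb : EnergyBound U ω M x q y b (Icc t0 T))
    (hb0 : ‖U (b t0)‖ ≤ ω⁻¹ * M)
    (hc : StepCoefficients K τ φ ψ (Real.cos (τ * ω)) (Real.sin (τ * ω)) κ μ ν)
    {xn qn yn bn zn : ℕ → E}
    (hn : ∀ n, PerturbedStep A U V τ φ ψ (Real.cos (τ * ω)) (Real.sin (τ * ω))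
      (xn n) (qn n) (yn n) (bn n) (xn (n + 1)) (qn (n + 1)) (yn (n + 1)) (bn (n + 1)) 0 0 0 0)
    (hzn : ∀ n, zn (n + 1) = zn n + (τ / 2) • (yn n + yn (n + 1)))
    (hx0 : xn 0 = x t0) (hq0 : qn 0 = q t0) (hy0 : yn 0 = y t0) (hbn0 : bn 0 = b t0)
    (hz0 : zn 0 = z t0) {m : ℕ} (hm : t0 + m * τ ≤ T) {G : ℝ}
    (hL : L = 3 * K ^ 5 * M) (hG : G = growthConst K L (T - t0)) :
    ‖(xn m + yn m) - (x (t0 + m * τ) + y (t0 + m * τ))‖ ≤ (2 * G + 2 * K ^ 3 * L) * τ ^ 2 ∧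
    ‖bn m - b (t0 + m * τ)‖ ≤ (G + 3 * K ^ 4 * L) * τ ^ 2 ∧
    ‖ω⁻¹ • qn m - ω⁻¹ • q (t0 + m * τ)‖ ≤ (K * G + 3 * K ^ 3 * L) * τ ^ 2 ∧
    ‖zn m - z (t0 + m * τ)‖ ≤ (T - t0) * (G + L) * τ ^ 2 := by
  have hK0 : 0 ≤ K := by linarith
  have hL0 : 0 ≤ L := by rw [hL]; positivity
  have hω0 : 0 < ω⁻¹ := by positivity
  have hmT : m * τ ≤ T - t0 := by linarith
  have hT0 : 0 ≤ T - t0 := le_trans (by positivity) hmT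
  have hG0 : 0 ≤ G := hG ▸ growthConst_nonneg hK hL0 hT0
  have hML : M ≤ L := by
    have : 1 * M ≤ K ^ 5 * M := by gcongr; exact one_le_pow₀ hK
    rw [hL]; linarith
  have hmem : ∀ n ≤ m, t0 + n * τ ∈ Icc t0 T := fun n hnm => by
    have : (n : ℝ) * τ ≤ m * τ := by gcongr
    exact ⟨le_add_of_nonneg_right (by positivity), by linarith⟩
  set X : ℝ → E := fun t => fastU A U ω x y t - μ • U (A (y t)) with hX
  set Q : ℝ → E := fun t => fastV U ω q b t + κ • U (slowB A ω q b t) with hQ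
  set B : ℝ → E := fun t => slowB A ω q b t - ν • A (Q t) with hB
  have hcb : ∀ n ≤ m, _ := fun n hnm =>
    hL ▸ correctionBound hK hM hτ hτ1 hω hωτ hA hU hb (hmem n hnm)
  have href : ∀ n ≤ m, _ := fun n hnm => (hcb n hnm).reference hK hL0 hτ hτ1 hA hU hc
    (X := X (t0 + n * τ)) (Q := Q (t0 + n * τ)) (B := B (t0 + n * τ)) rfl rfl rfl
  have hbloc : ∀ n < m, EnergyBound U ω M x q y b (Icc (t0 + n * τ) (t0 + n * τ + τ)) := by
    intro n hnm
    have hsub : Icc (t0 + n * τ) (t0 + n * τ + τ) ⊆ Icc t0 T := by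
      have h1 := (hmem n hnm.le).1
      have h2 := (hmem (n + 1) hnm).2
      push_cast at h2
      exact Icc_subset_Icc h1 (by linarith)
    exact ⟨fun t ht => hb.norm_x t (hsub ht), fun t ht => hb.norm_w t (hsub ht),
      fun t ht => hb.norm_y t (hsub ht), fun t ht => hb.norm_b t (hsub ht)⟩
  set N : ℕ → ℝ := fun n => pairNorm (xn n - X (t0 + n * τ)) (qn n - Q (t0 + n * τ)) +
    ‖yn n - y (t0 + n * τ)‖ + ‖bn n - B (t0 + n * τ)‖ with hN
  have hN0 : ∀ n, 0 ≤ N n := fun n =>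
    add_nonneg (add_nonneg (pairNorm_nonneg _ _) (norm_nonneg _)) (norm_nonneg _)
  have hsucc : ∀ n : ℕ, t0 + (n + 1 : ℕ) * τ = t0 + n * τ + τ := fun n => by push_cast; ring
  have hrec : ∀ n < m, N (n + 1) ≤
      (1 + 10 * K ^ 6 * τ) * N n + 6 * K ^ 2 * (12 * K ^ 9 * L * τ ^ 3) := by
    intro n hnm
    have hloc := localConsistency h hK hM hτ hω hωτ hA hU hV (hbloc n hnm)
    rw [← hL] at hloc
    obtain ⟨hXn, hQn, -, -⟩ := href n hnm.le
    obtain ⟨dx, dq, dy, db, hp, h1, h2, h3, h4⟩ := hloc.perturbedStep (X := X (t0 + n * τ))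
      (Q := Q (t0 + n * τ)) (B := B (t0 + n * τ)) (X1 := X (t0 + n * τ + τ))
      (Q1 := Q (t0 + n * τ + τ)) (B1 := B (t0 + n * τ + τ))
      hK hL0 hτ hτ1 hA hU hV hc rfl rfl rfl rfl rfl rfl hXn hQn
    have hs := (hn n).sub hp
    simp only [hN, hsucc]
    refine hs.norm_le hK hτ hτ1 hA hU hV hc.sq_add_sq hc.abs_φ hc.abs_ψ ?_ ?_ ?_ ?_ <;>
      rwa [zero_sub, norm_neg]
  have hstart : N 0 ≤ 8 * K ^ 4 * L * τ ^ 2 := by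
    obtain ⟨-, -, h1, h2⟩ := href 0 (Nat.zero_le m)
    have hcb0 := hcb 0 (Nat.zero_le m)
    simp only [Nat.cast_zero, zero_mul, add_zero] at h1 h2 hcb0
    simp only [hN, Nat.cast_zero, zero_mul, add_zero, hx0, hq0, hy0, hbn0, sub_self, norm_zero]
    have hUb : ‖U (b t0)‖ ≤ K * τ * L := hb0.trans (by gcongr)
    have hq : ‖Q t0 - q t0‖ ≤ 3 * (K ^ 2 * (L * τ ^ 2)) := by
      have e : Q t0 - q t0 = (κ - ω⁻¹) • U (b t0)
          - κ • U (b t0 - slowB A ω q b t0) := by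
        simp only [hQ, fastV, smul_sub, map_sub]
        rw [inv_smul_smul₀ (by positivity)]
        module
      have hκω : |κ - ω⁻¹| ≤ 2 * (K * τ) := by
        have := abs_sub κ ω⁻¹
        rw [abs_of_pos hω0] at this
        linarith [hc.abs_κ]
      rw [e]
      calc _ ≤ 2 * (K * τ) * (K * τ * L) + K * τ * (K * (L * τ ^ 2)) := by
            refine (norm_sub_le _ _).trans (add_le_add ?_
              (norm_smul_map_le hU hK0 hc.abs_κ hcb0.sub_β))
            rw [norm_smul]
            gcongr
            exact hκω
        _ = 2 * (K ^ 2 * (L * τ ^ 2)) + K * 1 * (K * (L * τ ^ 2)) * τ := by ring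
        _ ≤ 2 * (K ^ 2 * (L * τ ^ 2)) + K * 1 * (K * (L * τ ^ 2)) * 1 := by gcongr
        _ = _ := by ring
    have h3 := pairNorm_le (x t0 - X t0) (q t0 - Q t0)
    rw [norm_sub_rev] at h1 h2 hq
    have k2 : K ^ 2 * (L * τ ^ 2) ≤ K ^ 4 * (L * τ ^ 2) := by gcongr; norm_num
    have k3 : K ^ 3 * (L * τ ^ 2) ≤ K ^ 4 * (L * τ ^ 2) := by gcongr; norm_num
    linarith
  have hNG : ∀ n ≤ m, N n ≤ G * τ ^ 2 := by
    intro n hnm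
    have hnT : n * τ ≤ T - t0 := by linarith [(hmem n hnm).2]
    calc N n ≤ Real.exp (n * (10 * K ^ 6 * τ)) *
          (N 0 + n * (6 * K ^ 2 * (12 * K ^ 9 * L * τ ^ 3))) :=
          le_of_step_le (by positivity) (by positivity) (hN0 0) hrec n hnm
      _ = Real.exp (10 * K ^ 6 * (n * τ)) *
          (N 0 + 72 * K ^ 11 * L * (n * τ) * τ ^ 2) := by ring_nf
      _ ≤ Real.exp (10 * K ^ 6 * (T - t0)) *
          (8 * K ^ 4 * L * τ ^ 2 + 72 * K ^ 11 * L * (T - t0) * τ ^ 2) := by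
          gcongr
          exact add_nonneg (hN0 0) (by positivity)
      _ = _ := by rw [hG, growthConst]; ring
  have hpart : ∀ n ≤ m, ‖xn n - X (t0 + n * τ)‖ ≤ G * τ ^ 2 ∧
      ‖qn n - Q (t0 + n * τ)‖ ≤ G * τ ^ 2 ∧ ‖yn n - y (t0 + n * τ)‖ ≤ G * τ ^ 2 ∧
      ‖bn n - B (t0 + n * τ)‖ ≤ G * τ ^ 2 := by
    intro n hnm
    have h0 := hNG n hnm
    simp only [hN] at h0
    have h1 := norm_fst_le_pairNorm (xn n - X (t0 + n * τ)) (qn n - Q (t0 + n * τ))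
    have h2 := norm_snd_le_pairNorm (xn n - X (t0 + n * τ)) (qn n - Q (t0 + n * τ))
    have h3 := norm_nonneg (yn n - y (t0 + n * τ))
    have h4 := norm_nonneg (bn n - B (t0 + n * τ))
    have h5 := pairNorm_nonneg (xn n - X (t0 + n * τ)) (qn n - Q (t0 + n * τ))
    refine ⟨?_, ?_, ?_, ?_⟩ <;> linarith
  obtain ⟨p1, p2, p3, p4⟩ := hpart m le_rfl
  obtain ⟨-, r2, r3, r4⟩ := href m le_rfl
  have hcbm := hcb m le_rfl
  refine ⟨?_, ?_, ?_, ?_⟩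
  · have e : (xn m + yn m) - (x (t0 + m * τ) + y (t0 + m * τ)) =
        (xn m - X (t0 + m * τ)) + (yn m - y (t0 + m * τ)) + (X (t0 + m * τ) - x (t0 + m * τ)) := by
      abel
    rw [e]
    refine (norm_add₃_le).trans ?_
    linarith
  · rw [← sub_add_sub_cancel (bn m) (B (t0 + m * τ))]
    refine (norm_add_le _ _).trans ?_
    linarith
  · have hqn : ‖ω⁻¹ • qn m‖ ≤ K * τ * (G * τ ^ 2 + 2 * K ^ 2 * L * τ) := by
      rw [norm_smul, Real.norm_of_nonneg hω0.le]
      gcongr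
      rw [← sub_add_cancel (qn m) (Q (t0 + m * τ))]
      exact (norm_add_le _ _).trans (add_le_add p2 r2)
    have k3 : 1 * (L * τ ^ 2) ≤ K ^ 3 * (L * τ ^ 2) := by gcongr; exact one_le_pow₀ hK
    calc _ ≤ K * τ * (G * τ ^ 2 + 2 * K ^ 2 * L * τ) + L * τ ^ 2 :=
          (norm_sub_le _ _).trans (add_le_add hqn hcbm.norm_q)
      _ = K * (G * τ ^ 2) * τ + 2 * (K ^ 3 * (L * τ ^ 2)) + L * τ ^ 2 := by ring
      _ ≤ K * (G * τ ^ 2) * 1 + 2 * (K ^ 3 * (L * τ ^ 2)) + K ^ 3 * (L * τ ^ 2) :=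
          add_le_add (add_le_add (by gcongr) le_rfl) (by linarith)
      _ = _ := by ring
  · have hzstep : ∀ n < m, ‖zn (n + 1) - z (t0 + (n + 1 : ℕ) * τ)‖ ≤
        ‖zn n - z (t0 + n * τ)‖ + (G + L) * τ ^ 3 := by
      intro n hnm
      have h1 := trapezoid_error_slow h hM hτ hK hω hA hV (hbloc n hnm) hz
      have h2 := (hpart n hnm.le).2.2.1
      have h3 := (hpart (n + 1) hnm).2.2.1
      rw [hsucc] at h3 ⊢
      have e : zn (n + 1) - z (t0 + n * τ + τ) = (zn n - z (t0 + n * τ))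
          + (τ / 2) • ((yn n - y (t0 + n * τ)) + (yn (n + 1) - y (t0 + n * τ + τ)))
          - (z (t0 + n * τ + τ) - z (t0 + n * τ)
            - (τ / 2) • (y (t0 + n * τ) + y (t0 + n * τ + τ))) := by
        rw [hzn]; module
      have h4 : ‖(τ / 2) • ((yn n - y (t0 + n * τ)) + (yn (n + 1) - y (t0 + n * τ + τ)))‖ ≤
          τ / 2 * (G * τ ^ 2 + G * τ ^ 2) := by
        rw [norm_smul, Real.norm_of_nonneg (by positivity)]
        gcongr
        exact (norm_add_le _ _).trans (add_le_add h2 h3)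
      have h5 : 2 * K ^ 2 * M * τ ^ 3 ≤ L * τ ^ 3 := by
        rw [hL]
        have : K ^ 2 * (M * τ ^ 3) ≤ K ^ 5 * (M * τ ^ 3) := by gcongr; norm_num
        have : 0 ≤ K ^ 5 * (M * τ ^ 3) := by positivity
        linarith
      rw [e]
      refine (norm_sub_le _ _).trans ?_
      linarith [norm_add_le (zn n - z (t0 + n * τ))
        ((τ / 2) • ((yn n - y (t0 + n * τ)) + (yn (n + 1) - y (t0 + n * τ + τ))))]
    have hzall : ∀ n ≤ m, ‖zn n - z (t0 + n * τ)‖ ≤ n * ((G + L) * τ ^ 3) := by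
      intro n
      induction n with
      | zero => intro _; simp [hz0]
      | succ n ih =>
        intro hnm
        have h1 := hzstep n hnm
        have h2 := ih (by omega)
        push_cast at h1 ⊢
        linarith
    calc _ ≤ m * ((G + L) * τ ^ 3) := hzall m le_rfl
      _ = m * τ * (G + L) * τ ^ 2 := by ring
      _ ≤ _ := by gcongr

end Convergence

lemma exists_mul_eq_of_abs_le {a s D : ℝ} (hD : 0 ≤ D) (h : |a| ≤ D * |s|) :
    ∃ r, r * s = a ∧ |r| ≤ D := by
  rcases eq_or_ne s 0 with rfl | hs
  · exact ⟨0, by simpa [eq_comm] using h, by simpa⟩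
  · exact ⟨a / s, div_mul_cancel₀ a hs, by
      rw [abs_div]; exact div_le_of_le_mul₀ (abs_nonneg _) hD h⟩

/-- The filter conditions yield the coefficients of the corrections, uniformly in the
angle `θ = τ ω ≥ c0`, also when `sin (θ / 2)` is small. -/
lemma exists_stepCoefficients {c0 C1 C2 C7 K τ θ φ ψ : ℝ} (hc0 : 0 < c0) (hθ : c0 ≤ θ)
    (hτ : 0 ≤ τ) (hK1 : 2 * |C1| / c0 ^ 2 + |C7| ≤ K) (hK2 : |C2| ≤ K) (hK3 : |C2| / c0 ≤ K)
    (h1 : |(Real.cos θ + 1) * ψ| ≤ C1 * (Real.sin (θ / 2) / (θ / 2)) ^ 2)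
    (h2 : |φ| ≤ C2 * |Real.sin (θ / 2) / (θ / 2)|) (h7 : |ψ| ≤ C7) :
    ∃ κ μ ν, StepCoefficients K τ φ ψ (Real.cos θ) (Real.sin θ) κ μ ν := by
  have hθ0 : 0 < θ := hc0.trans_le hθ
  have hcos : Real.cos θ = 2 * Real.cos (θ / 2) ^ 2 - 1 := by
    rw [← Real.cos_two_mul]; ring_nf
  have hsin : Real.sin θ = 2 * Real.sin (θ / 2) * Real.cos (θ / 2) := by
    rw [← Real.sin_two_mul]; ring_nf
  have hpy := Real.sin_sq_add_cos_sq (θ / 2)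
  have hC1 := Real.abs_cos_le_one (θ / 2)
  have hS1 := Real.abs_sin_le_one (θ / 2)
  have hSθ : |Real.sin (θ / 2)| ≤ θ / 2 := by
    have := Real.abs_sin_le_abs (x := θ / 2)
    rwa [abs_of_pos (by positivity : 0 < θ / 2)] at this
  have hunit := Real.sin_sq_add_cos_sq θ
  set S := Real.sin (θ / 2)
  set C := Real.cos (θ / 2)
  have hψ : |τ / 2 * ψ * C| ≤ (2 * |C1| / c0 ^ 2 + |C7|) * τ * |S ^ 2| := by
    have hmain : |ψ| * |C| ≤ 2 * (2 * |C1| / c0 ^ 2 + |C7|) * S ^ 2 := by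
      have hC7 : 0 ≤ |C7| * S ^ 2 := by positivity
      have hC1' : 0 ≤ |C1| / c0 ^ 2 * S ^ 2 := by positivity
      rcases le_total (1 / 2) (C ^ 2) with hC | hC
      · have h3 : |ψ| * |C| ≤ (Real.cos θ + 1) * |ψ| := by
          rw [hcos, mul_comm]
          gcongr
          linarith
        have h4 : (Real.cos θ + 1) * |ψ| ≤ C1 * (S / (θ / 2)) ^ 2 := by
          rwa [abs_mul, abs_of_nonneg (by rw [hcos]; nlinarith)] at h1
        have h5 : C1 * (S / (θ / 2)) ^ 2 ≤ 4 * (|C1| / c0 ^ 2 * S ^ 2) := by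
          calc _ = C1 * (4 * S ^ 2 / θ ^ 2) := by field_simp; ring
            _ ≤ |C1| * (4 * S ^ 2 / c0 ^ 2) := by
              gcongr
              exact le_abs_self C1
            _ = _ := by ring
        calc _ ≤ _ := (h3.trans h4).trans h5
          _ ≤ 4 * (|C1| / c0 ^ 2 * S ^ 2) + 2 * (|C7| * S ^ 2) := by linarith
          _ = _ := by ring
      · calc |ψ| * |C| ≤ |C7| * 1 :=
              mul_le_mul (h7.trans (le_abs_self _)) hC1 (abs_nonneg _) (abs_nonneg _)
          _ ≤ |C7| * (2 * S ^ 2) := by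
              gcongr
              linarith
          _ ≤ 4 * (|C1| / c0 ^ 2 * S ^ 2) + 2 * (|C7| * S ^ 2) := by linarith
          _ = _ := by ring
    rw [mul_assoc, abs_mul, abs_mul, abs_of_nonneg (by positivity : 0 ≤ τ / 2),
      abs_of_nonneg (sq_nonneg S)]
    calc _ ≤ τ / 2 * (2 * (2 * |C1| / c0 ^ 2 + |C7|) * S ^ 2) := by gcongr
      _ = _ := by ring
  have hφ : |τ / 2 * φ| ≤ |C2| / c0 * τ * |S| := by
    rw [abs_mul, abs_of_nonneg (by positivity : 0 ≤ τ / 2)]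
    rw [abs_div, abs_of_pos (by positivity : 0 < θ / 2)] at h2
    calc _ ≤ τ / 2 * (|C2| * (|S| / (c0 / 2))) := by
          gcongr
          refine h2.trans ?_
          gcongr
          exact le_abs_self C2
      _ = _ := by field_simp
  obtain ⟨κ, hκ, hκ'⟩ := exists_mul_eq_of_abs_le (by positivity) hψ
  obtain ⟨η, hη, hη'⟩ := exists_mul_eq_of_abs_le (by positivity) hφ
  have hκK : |κ| ≤ K * τ := hκ'.trans (by gcongr)
  have hηK : |η| ≤ K * τ := hη'.trans (by gcongr)
  have hKτ : 0 ≤ K * τ := (abs_nonneg _).trans hκK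
  refine ⟨κ * S, C * κ * (τ / 2), η * C, ?_⟩
  rw [hsin, hcos] at hunit ⊢
  constructor
  · linarith
  · refine h2.trans ?_
    rw [abs_div, abs_of_pos (by positivity : 0 < θ / 2)]
    calc _ ≤ |C2| * 1 := by
          gcongr
          · exact le_abs_self C2
          · exact div_le_one_of_le₀ hSθ (by positivity)
      _ ≤ K := by linarith
  · have : 0 ≤ 2 * |C1| / c0 ^ 2 := by positivity
    linarith [le_abs_self C7]
  · rw [abs_mul]
    calc _ ≤ K * τ * 1 := by gcongr
      _ = _ := mul_one _
  · rw [abs_mul, abs_mul, abs_of_nonneg (by positivity : 0 ≤ τ / 2)]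
    calc _ ≤ 1 * (K * τ) * τ := by gcongr; linarith
      _ = _ := by ring
  · rw [abs_mul]
    calc _ ≤ K * τ * 1 := by gcongr
      _ = _ := mul_one _
  · linear_combination 2 * C * hκ
  · linear_combination (2 * S) * hκ - 2 * κ * S * hpy
  · linear_combination -(C * κ * τ) * hpy
  · ring
  · linear_combination 2 * C ^ 2 * hη
  · linear_combination 2 * C * S * hη - 2 * η * C * hpy

section Discretization

variable {d : ℕ}

lemma energyBound {E : Type*} [NormedAddCommGroup E] [InnerProductSpace ℝ E]
    {A U V : E →L[ℝ] E} {ω K H t0 T : ℝ} {x q y b : ℝ → E}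
    (h : SlowFastSolution A U V ω x q y b) (hK : 1 ≤ K) (hω : 1 ≤ ω)
    (hA : ∀ v, ‖A v‖ ≤ K * ‖v‖) (hU : ∀ v, ‖U v‖ ≤ K * ‖v‖) (hV : ∀ v, ‖V v‖ ≤ K * ‖v‖)
    (hH : ‖ω • x t0‖ ^ 2 + ‖ω • q t0 - U (b t0)‖ ^ 2 + ‖y t0‖ ^ 2 + ‖b t0‖ ^ 2 ≤ H) :
    EnergyBound U ω √(H * Real.exp (6 * K ^ 2 * (T - t0))) x q y b (Icc t0 T) := by
  have hH0 : 0 ≤ H := le_trans (by positivity) hH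
  have key : ∀ t ∈ Icc t0 T, ‖ω • x t‖ ^ 2 + ‖ω • q t - U (b t)‖ ^ 2 + ‖y t‖ ^ 2 + ‖b t‖ ^ 2 ≤
      H * Real.exp (6 * K ^ 2 * (T - t0)) := fun t ht =>
    (energy_le h hK hω hA hU hV ht.1).trans (by gcongr; exact ht.2)
  constructor <;> intro t ht <;> refine Real.le_sqrt_of_sq_le (le_trans ?_ (key t ht)) <;>
    linarith [sq_nonneg ‖ω • x t‖, sq_nonneg ‖ω • q t - U (b t)‖, sq_nonneg ‖y t‖,
      sq_nonneg ‖b t‖]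

/-- The projection onto the coordinates in which `ωv` does not vanish. -/
noncomputable def fastProj (ωv : Fin d → ℝ) :
    EuclideanSpace ℝ (Fin d) →L[ℝ] EuclideanSpace ℝ (Fin d) :=
  Matrix.toEuclideanCLM (𝕜 := ℝ) (Matrix.diagonal fun i => if ωv i = 0 then 0 else 1)

lemma mulE_eq_toEuclideanCLM (A : Matrix (Fin d) (Fin d) ℝ) (v : EuclideanSpace ℝ (Fin d)) :
    mulE A v = Matrix.toEuclideanCLM (𝕜 := ℝ) A v := rfl

lemma mulE_diagonal_apply (D : Fin d → ℝ) (v : EuclideanSpace ℝ (Fin d)) (i : Fin d) :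
    mulE (Matrix.diagonal D) v i = D i * v i :=
  Matrix.mulVec_diagonal D _ i

lemma fastProj_apply (ωv : Fin d → ℝ) (v : EuclideanSpace ℝ (Fin d)) (i : Fin d) :
    fastProj ωv v i = if ωv i = 0 then 0 else v i :=
  (mulE_diagonal_apply _ v i).trans (by split_ifs <;> simp)

lemma fastProj_fastProj (ωv : Fin d → ℝ) (v : EuclideanSpace ℝ (Fin d)) :
    fastProj ωv (fastProj ωv v) = fastProj ωv v := by
  ext i
  simp only [fastProj_apply]
  split_ifs <;> rfl

lemma norm_fastProj_le (ωv : Fin d → ℝ) (v : EuclideanSpace ℝ (Fin d)) :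
    ‖fastProj ωv v‖ ≤ ‖v‖ := by
  rw [EuclideanSpace.norm_eq, EuclideanSpace.norm_eq]
  refine Real.sqrt_le_sqrt (Finset.sum_le_sum fun i _ => ?_)
  rw [fastProj_apply]
  split_ifs
  · simp; positivity
  · rfl

lemma norm_sub_fastProj_le (ωv : Fin d → ℝ) (v : EuclideanSpace ℝ (Fin d)) :
    ‖v - fastProj ωv v‖ ≤ ‖v‖ := by
  rw [EuclideanSpace.norm_eq, EuclideanSpace.norm_eq]
  refine Real.sqrt_le_sqrt (Finset.sum_le_sum fun i _ => ?_)
  rw [PiLp.sub_apply, fastProj_apply]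
  split_ifs
  · simp
  · simp; positivity

lemma mulE_diagonal_eq {ωv : Fin d → ℝ} {ow : ℝ} (hωv : ∀ i, ωv i = 0 ∨ ωv i = ow)
    (how : ow ≠ 0) {D : Fin d → ℝ} (g : ℝ → ℝ) (hD : ∀ i, D i = g (ωv i))
    (v : EuclideanSpace ℝ (Fin d)) :
    mulE (Matrix.diagonal D) v = g ow • fastProj ωv v + g 0 • (v - fastProj ωv v) := by
  ext i
  simp only [mulE_diagonal_apply, PiLp.add_apply, PiLp.smul_apply, PiLp.sub_apply, smul_eq_mul,
    fastProj_apply, hD]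
  rcases hωv i with h | h <;> simp [h, how]

/-- The coupling from `b` to the fast component. -/
noncomputable def fastCoupling (ωv : Fin d → ℝ) (CB : Matrix (Fin d) (Fin d) ℝ) :
    EuclideanSpace ℝ (Fin d) →L[ℝ] EuclideanSpace ℝ (Fin d) :=
  (fastProj ωv).comp (Matrix.toEuclideanCLM (𝕜 := ℝ) CB)

/-- The coupling from `b` to the slow component. -/
noncomputable def slowCoupling (ωv : Fin d → ℝ) (CB : Matrix (Fin d) (Fin d) ℝ) :
    EuclideanSpace ℝ (Fin d) →L[ℝ] EuclideanSpace ℝ (Fin d) :=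
  Matrix.toEuclideanCLM (𝕜 := ℝ) CB - fastCoupling ωv CB

lemma fastCoupling_apply (ωv : Fin d → ℝ) (CB : Matrix (Fin d) (Fin d) ℝ)
    (v : EuclideanSpace ℝ (Fin d)) : fastCoupling ωv CB v = fastProj ωv (mulE CB v) := rfl

lemma slowCoupling_apply (ωv : Fin d → ℝ) (CB : Matrix (Fin d) (Fin d) ℝ)
    (v : EuclideanSpace ℝ (Fin d)) :
    slowCoupling ωv CB v = mulE CB v - fastProj ωv (mulE CB v) := rfl

lemma tripleSplitStep_perturbedStep {CE CB : Matrix (Fin d) (Fin d) ℝ} {ψE φE : ℝ → ℝ}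
    {τ ow : ℝ} {ωv : Fin d → ℝ} (hωv : ∀ i, ωv i = 0 ∨ ωv i = ow) (how : 0 < ow) (hτ : 0 < τ)
    (hψ : ψE 0 = 1) (hφ : φE 0 = 1)
    {s s' : EuclideanSpace ℝ (Fin d) × EuclideanSpace ℝ (Fin d) × EuclideanSpace ℝ (Fin d)}
    (hs : s' = tripleSplitStep CE CB ψE φE τ ωv s) :
    PerturbedStep (Matrix.toEuclideanCLM (𝕜 := ℝ) CE) (fastCoupling ωv CB) (slowCoupling ωv CB)
      τ (φE (τ / 2 * ow)) (ψE (τ / 2 * ow)) (Real.cos (τ * ow)) (Real.sin (τ * ow))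
      (fastProj ωv s.2.1) (ow • fastProj ωv s.1) (s.2.1 - fastProj ωv s.2.1) s.2.2
      (fastProj ωv s'.2.1) (ow • fastProj ωv s'.1) (s'.2.1 - fastProj ωv s'.2.1) s'.2.2
      0 0 0 0 ∧
    s'.1 - fastProj ωv s'.1 = (s.1 - fastProj ωv s.1) + (τ / 2) •
      ((s.2.1 - fastProj ωv s.2.1) + (s'.2.1 - fastProj ωv s'.2.1)) := by
  obtain ⟨p, e, b⟩ := s
  have how0 : ow ≠ 0 := how.ne'
  have hθ : τ * ow ≠ 0 := by positivity
  have hsinc : ow * (τ * sinc (τ * ow)) = Real.sin (τ * ow) := by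
    rw [sinc, if_neg hθ]; field_simp
  have hφe : ∀ v, mulE (fDiag φE (τ / 2) ωv) v = φE (τ / 2 * ow) • fastProj ωv v
      + (v - fastProj ωv v) := fun v => by
    rw [fDiag, mulE_diagonal_eq hωv how0 (fun w => φE (τ / 2 * w)) (fun _ => rfl)]
    simp [hφ]
  have hψe : ∀ v, mulE (fDiag ψE (τ / 2) ωv) v = ψE (τ / 2 * ow) • fastProj ωv v
      + (v - fastProj ωv v) := fun v => by
    rw [fDiag, mulE_diagonal_eq hωv how0 (fun w => ψE (τ / 2 * w)) (fun _ => rfl)]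
    simp [hψ]
  have hcos : ∀ v, mulE (fDiag Real.cos τ ωv) v = Real.cos (τ * ow) • fastProj ωv v
      + (v - fastProj ωv v) := fun v => by
    rw [fDiag, mulE_diagonal_eq hωv how0 (fun w => Real.cos (τ * w)) (fun _ => rfl)]
    simp
  have hsin : ∀ v, mulE (fDiag sinc τ ωv) v = sinc (τ * ow) • fastProj ωv v
      + (v - fastProj ωv v) := fun v => by
    rw [fDiag, mulE_diagonal_eq hωv how0 (fun w => sinc (τ * w)) (fun _ => rfl)]
    simp [sinc]
  have hωsin : ∀ v, mulE (Matrix.diagonal fun i => ωv i * Real.sin (τ * ωv i)) v =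
      (ow * Real.sin (τ * ow)) • fastProj ωv v := fun v => by
    rw [mulE_diagonal_eq hωv how0 (fun w => w * Real.sin (τ * w)) (fun _ => rfl)]
    simp
  have hbh : b - (τ / 2) • mulE CE (mulE (fDiag φE (τ / 2) ωv) e) =
      halfStep (Matrix.toEuclideanCLM (𝕜 := ℝ) CE) τ (φE (τ / 2 * ow)) (fastProj ωv e)
        (e - fastProj ωv e) b := by
    rw [hφe, halfStep, mulE_eq_toEuclideanCLM]
  simp only [tripleSplitStep, hbh] at hs
  set bh := halfStep (Matrix.toEuclideanCLM (𝕜 := ℝ) CE) τ (φE (τ / 2 * ow)) (fastProj ωv e)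
        (e - fastProj ωv e) b with hbh'
  rw [hψe, hcos, hcos, hsin, hωsin, hφe] at hs
  subst hs
  refine ⟨⟨?_, ?_, ?_, ?_⟩, ?_⟩
  · simp only [fastCoupling_apply, ← hbh', map_add, map_sub, map_neg, map_smul,
      fastProj_fastProj]
    module
  · simp only [fastCoupling_apply, ← hbh', map_add, map_sub, map_smul, fastProj_fastProj]
    rw [← hsinc]
    module
  · simp only [slowCoupling_apply, ← hbh', map_add, map_sub, map_neg, map_smul,
      fastProj_fastProj]
    module
  · simp only [← hbh', mulE_eq_toEuclideanCLM, add_zero]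
  · simp only [map_add, map_sub, map_neg, map_smul, fastProj_fastProj]
    module

lemma mulE_diagonal_sq_eq {ωv : Fin d → ℝ} {ow : ℝ} (hωv : ∀ i, ωv i = 0 ∨ ωv i = ow)
    (how : ow ≠ 0) (v : EuclideanSpace ℝ (Fin d)) :
    mulE (Matrix.diagonal ωv ^ 2) v = (ow ^ 2) • fastProj ωv v := by
  rw [Matrix.diagonal_pow, mulE_diagonal_eq (D := ωv ^ 2) hωv how (fun w => w ^ 2) (fun _ => rfl)]
  simp

lemma slowFastSolution_maxwell {CE CB : Matrix (Fin d) (Fin d) ℝ} {ow : ℝ} {ωv : Fin d → ℝ}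
    (hωv : ∀ i, ωv i = 0 ∨ ωv i = ow) (how : ow ≠ 0) {p e b : ℝ → EuclideanSpace ℝ (Fin d)}
    (hp : ∀ t, HasDerivAt p (e t) t)
    (he : ∀ t, HasDerivAt e (mulE CB (b t) - mulE (Matrix.diagonal ωv ^ 2) (p t)) t)
    (hb : ∀ t, HasDerivAt b (-mulE CE (e t)) t) :
    SlowFastSolution (Matrix.toEuclideanCLM (𝕜 := ℝ) CE) (fastCoupling ωv CB)
      (slowCoupling ωv CB) ow (fun t => fastProj ωv (e t)) (fun t => ow • fastProj ωv (p t))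
      (fun t => e t - fastProj ωv (e t)) b := by
  have hPe := fun t => (fastProj ωv).hasFDerivAt.comp_hasDerivAt t (he t)
  refine ⟨fun t => ?_, fun t => ?_, fun t => ?_, fun t => ?_⟩
  · refine (hPe t).congr_deriv ?_
    rw [mulE_diagonal_sq_eq hωv how, fastCoupling_apply, map_sub, map_smul, fastProj_fastProj]
    module
  · exact ((fastProj ωv).hasFDerivAt.comp_hasDerivAt t (hp t)).const_smul ow
  · refine ((he t).sub (hPe t)).congr_deriv ?_
    rw [mulE_diagonal_sq_eq hωv how, slowCoupling_apply, map_sub, map_smul, fastProj_fastProj]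
    module
  · refine (hb t).congr_deriv ?_
    rw [add_sub_cancel, mulE_eq_toEuclideanCLM]

/-- Convergence of the scheme with explicit constants, given the correction coefficients. -/
theorem maxwell_error_le {CE CB : Matrix (Fin d) (Fin d) ℝ} {ψE φE : ℝ → ℝ}
    {K M L G H0 t0 T τ ow κ μ ν : ℝ} {ωv : Fin d → ℝ} (hωv : ∀ i, ωv i = 0 ∨ ωv i = ow)
    (hK : 1 ≤ K) (hH0 : 0 ≤ H0) (hT : t0 ≤ T) (hτ : 0 < τ) (hτ1 : τ ≤ 1) (hω : 1 ≤ ow)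
    (hωτ : ow⁻¹ ≤ K * τ) (hCE : ∀ v, ‖mulE CE v‖ ≤ K * ‖v‖) (hCB : ∀ v, ‖mulE CB v‖ ≤ K * ‖v‖)
    (hψ0 : ψE 0 = 1) (hφ0 : φE 0 = 1)
    (hc : StepCoefficients K τ (φE (τ / 2 * ow)) (ψE (τ / 2 * ow)) (Real.cos (τ * ow))
      (Real.sin (τ * ow)) κ μ ν)
    {p0 e0 b0 : EuclideanSpace ℝ (Fin d)}
    (hΩe0 : ‖mulE (Matrix.diagonal ωv) e0‖ ^ 2 ≤ 2 / 3 * H0)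
    (hCb0 : ‖mulE CB b0‖ ^ 2 ≤ 1 / 3 * H0)
    (hΩp0 : ‖mulE (Matrix.diagonal ωv ^ 2) p0‖ ^ 2 ≤ 1 / 3 * H0)
    (he0 : ‖e0‖ ^ 2 ≤ H0) (hb0 : ‖b0‖ ^ 2 ≤ H0)
    (hΩCb0 : ‖mulE (Matrix.diagonal ωv ^ 2) (mulE CB b0)‖ ^ 2 ≤ H0)
    {p e b : ℝ → EuclideanSpace ℝ (Fin d)} (hp : ∀ t, HasDerivAt p (e t) t)
    (he : ∀ t, HasDerivAt e (mulE CB (b t) - mulE (Matrix.diagonal ωv ^ 2) (p t)) t)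
    (hb : ∀ t, HasDerivAt b (-mulE CE (e t)) t)
    (hpt : p t0 = p0) (het : e t0 = e0) (hbt : b t0 = b0)
    {S : ℕ → EuclideanSpace ℝ (Fin d) × EuclideanSpace ℝ (Fin d) × EuclideanSpace ℝ (Fin d)}
    (hS0 : S 0 = (p0, e0, b0)) (hS : ∀ n, S (n + 1) = tripleSplitStep CE CB ψE φE τ ωv (S n))
    {n : ℕ} (hn : t0 + n * τ ≤ T)
    (hM : M = √(4 * H0 * Real.exp (6 * K ^ 2 * (T - t0)))) (hL : L = 3 * K ^ 5 * M)
    (hG : G = growthConst K L (T - t0)) :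
    ‖(S n).1 - p (t0 + n * τ)‖ ≤
      ((K * G + 3 * K ^ 3 * L) + (T - t0) * (G + L)) * τ ^ 2 ∧
    ‖(S n).2.1 - e (t0 + n * τ)‖ ≤
      (2 * G + 2 * K ^ 3 * L) * τ ^ 2 ∧
    ‖(S n).2.2 - b (t0 + n * τ)‖ ≤
      (G + 3 * K ^ 4 * L) * τ ^ 2 := by
  have how : 0 < ow := by linarith
  have hM0 : 0 ≤ M := hM ▸ Real.sqrt_nonneg _
  have hT0 : 0 ≤ T - t0 := by linarith
  have hA : ∀ v, ‖Matrix.toEuclideanCLM (𝕜 := ℝ) CE v‖ ≤ K * ‖v‖ := fun v => by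
    rw [← mulE_eq_toEuclideanCLM]
    exact hCE v
  have hU : ∀ v, ‖fastCoupling ωv CB v‖ ≤ K * ‖v‖ := fun v => by
    rw [fastCoupling_apply]
    exact (norm_fastProj_le _ _).trans (hCB v)
  have hV : ∀ v, ‖slowCoupling ωv CB v‖ ≤ K * ‖v‖ := fun v => by
    rw [slowCoupling_apply]
    exact (norm_sub_fastProj_le _ _).trans (hCB v)
  have hsol := slowFastSolution_maxwell hωv how.ne' hp he hb
  have hΩe0' : ‖ow • fastProj ωv e0‖ ^ 2 ≤ 2 / 3 * H0 := by
    rwa [mulE_diagonal_eq hωv how.ne' (fun w => w) (fun _ => rfl), zero_smul,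
      add_zero] at hΩe0
  have hUb0 : ‖fastCoupling ωv CB b0‖ ^ 2 ≤ 1 / 3 * H0 :=
    le_trans (by rw [fastCoupling_apply]; gcongr; exact norm_fastProj_le _ _) hCb0
  have hw0 : ‖ow • ow • fastProj ωv p0
      - fastCoupling ωv CB b0‖ ^ 2 ≤ 4 / 3 * H0 := by
    rw [mulE_diagonal_sq_eq hωv how.ne', pow_two ow, mul_smul] at hΩp0
    set v := ow • ow • fastProj ωv p0
    set w := fastCoupling ωv CB b0
    have h3 : ‖v - w‖ ^ 2 ≤ (‖v‖ + ‖w‖) ^ 2 := by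
      gcongr
      exact norm_sub_le _ _
    linarith [sq_nonneg (‖v‖ - ‖w‖)]
  have hy0 : ‖e0 - fastProj ωv e0‖ ^ 2 ≤ H0 :=
    le_trans (by gcongr; exact norm_sub_fastProj_le _ _) he0
  have hEB := energyBound (t0 := t0) (T := T) (H := 4 * H0) hsol hK hω hA hU hV
    (by rw [hpt, het, hbt]; linarith)
  rw [← hM] at hEB
  have hH0M : √H0 ≤ M := by
    rw [hM]
    refine Real.sqrt_le_sqrt ?_
    have : 1 ≤ Real.exp (6 * K ^ 2 * (T - t0)) := Real.one_le_exp (by positivity)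
    nlinarith
  have hUb : ‖fastCoupling ωv CB (b t0)‖ ≤ ow⁻¹ * M := by
    rw [hbt, inv_mul_eq_div, le_div_iff₀ how]
    rw [mulE_diagonal_sq_eq hωv how.ne',
      ← fastCoupling_apply] at hΩCb0
    have h3 := (Real.le_sqrt_of_sq_le hΩCb0).trans hH0M
    rw [norm_smul, Real.norm_of_nonneg (by positivity)] at h3
    set r := ‖fastCoupling ωv CB b0‖
    calc r * ow ≤ r * ow ^ 2 := by gcongr; nlinarith
      _ ≤ M := by linarith
  have hstep := fun n => tripleSplitStep_perturbedStep hωv how hτ hψ0 hφ0 (hS n)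
  obtain ⟨r1, r2, r3, r4⟩ := error_le hsol
    (z := fun t => p t - fastProj ωv (p t)) (xn := fun n => fastProj ωv (S n).2.1)
    (qn := fun n => ow • fastProj ωv (S n).1) (yn := fun n => (S n).2.1 - fastProj ωv (S n).2.1)
    (bn := fun n => (S n).2.2) (zn := fun n => (S n).1 - fastProj ωv (S n).1)
    (fun t => (hp t).sub ((fastProj ωv).hasFDerivAt.comp_hasDerivAt t (hp t)))
    hK hM0 hτ.le hτ1 hω hωτ hA hU hV hEB hUb hc (fun n => (hstep n).1) (fun n => (hstep n).2)
    (by simp [hS0, het]) (by simp [hS0, hpt]) (by simp [hS0, het]) (by simp [hS0, hbt])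
    (by simp [hS0, hpt]) hn hL hG
  generalize S n = s at r1 r2 r3 r4 ⊢
  refine ⟨?_, ?_, r2⟩
  · rw [inv_smul_smul₀ how.ne', inv_smul_smul₀ how.ne'] at r3
    set t := t0 + (n : ℝ) * τ
    have e1 : s.1 - p t = (s.1 - fastProj ωv s.1
        - (p t - fastProj ωv (p t)))
        + (fastProj ωv s.1 - fastProj ωv (p t)) := by abel
    rw [e1, add_mul]
    exact (norm_add_le _ _).trans (by linarith)
  · rwa [add_sub_cancel, add_sub_cancel] at r1

end Discretization

end TripleSplitting

/-- Main theorem, second order convergence of the triple splitting.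
There exist `τ₀ > 0` and `C > 0`, depending only on `T − t₀`, `c₀`, `H₀`, `C_c` and the
filter constants `C₁,…,C₈` (in particular independent of `ω̃`, `τ`, `n` and `d`), such
that for every dimension `d`, matrices `C_E`, `C_B = C_Eᵀ`, diagonal `Ω` with entries in
`{0, ω̃}`, filter functions satisfying conditions (i)–(viii), initial data satisfying the
initial-data bounds, step size `0 < τ ≤ τ₀` with `τ·ω̃ ≥ c₀`, and every `n` with
`t_n = t₀ + n·τ ≤ T`, the triple splitting iterates are `O(τ²)`-close to the exact
solution of the semidiscrete Maxwell system in `p`, `e` and `b`. -/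
theorem stmt0
    (t0 T c0 H0 Cc C1 C2 C3 C4 C5 C6 C7 C8 : ℝ)
    (hT : t0 < T) (hc0 : 0 < c0) (hH0 : 0 < H0) (hCc : 0 < Cc) :
    ∃ τ0 : ℝ, 0 < τ0 ∧ ∃ C : ℝ, 0 < C ∧
      ∀ (d : ℕ), 1 ≤ d →
      ∀ (CE CB : Matrix (Fin d) (Fin d) ℝ), CB = CE.transpose →
      ∀ (ow : ℝ), 0 < ow →
      ∀ (ωv : Fin d → ℝ), (∀ i, ωv i = 0 ∨ ωv i = ow) →
      (∀ v : EuclideanSpace ℝ (Fin d), ‖mulE CE v‖ ≤ Cc * ‖v‖) →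
      (∀ v : EuclideanSpace ℝ (Fin d), ‖mulE CB v‖ ≤ Cc * ‖v‖) →
      ∀ (ψE φE : ℝ → ℝ),
        (∀ z, ψE (-z) = ψE z) → (∀ z, φE (-z) = φE z) → ψE 0 = 1 → φE 0 = 1 →
        (∀ z : ℝ, |(Real.cos z + 1) * ψE (z/2)| ≤ C1 * (sinc (z/2))^2) →
        (∀ z : ℝ, |φE (z/2)| ≤ C2 * |sinc (z/2)|) →
        (∀ z : ℝ, |(Real.cos z + 1) * ψE (z/2) * φE (z/2)| ≤ C3 * |sinc z|) →
        (∀ z : ℝ, |(Real.cos z + 1) * ψE (z/2)| ≤ C4 * |sinc z|) →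
        (∀ z : ℝ, |sinc z - (1/2) * (Real.cos z + 1) * ψE (z/2)| ≤ C5 * z^2 * |sinc z|) →
        (∀ z : ℝ, |sinc z - φE (z/2)| ≤ C6 * |z * Real.sin (z/2)|) →
        (∀ z : ℝ, |ψE z| ≤ C7) →
        (∀ z : ℝ, |(sinc (z/2))^2 - sinc z * φE (z/2)| ≤ C8 * (Real.sin (z/2))^2) →
      ∀ (p0 e0 b0 : EuclideanSpace ℝ (Fin d)),
        ‖mulE (Matrix.diagonal ωv) e0‖^2 ≤ (2/3) * H0 →
        ‖mulE CB b0‖^2 ≤ (1/3) * min 1 (4 / C4^2) * H0 →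
        ‖mulE ((Matrix.diagonal ωv)^2) p0‖^2 ≤ (1/3) * H0 →
        ‖mulE CE e0‖^2 ≤ 2 * H0 →
        ‖e0‖^2 ≤ H0 →
        ‖b0‖^2 ≤ H0 →
        ‖mulE ((Matrix.diagonal ωv)^2) (mulE CB b0)‖^2 ≤ H0 →
      ∀ (p e b : ℝ → EuclideanSpace ℝ (Fin d)),
        (∀ t, HasDerivAt p (e t) t) →
        (∀ t, HasDerivAt e (mulE CB (b t) - mulE ((Matrix.diagonal ωv)^2) (p t)) t) →
        (∀ t, HasDerivAt b (-mulE CE (e t)) t) →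
        p t0 = p0 → e t0 = e0 → b t0 = b0 →
      ∀ (τ : ℝ), 0 < τ → τ ≤ τ0 → c0 ≤ τ * ow →
      ∀ n : ℕ, t0 + (n : ℝ) * τ ≤ T →
        ‖((tripleSplitStep CE CB ψE φE τ ωv)^[n] (p0, e0, b0)).1
            - p (t0 + (n : ℝ) * τ)‖ ≤ C * τ^2 ∧
        ‖((tripleSplitStep CE CB ψE φE τ ωv)^[n] (p0, e0, b0)).2.1
            - e (t0 + (n : ℝ) * τ)‖ ≤ C * τ^2 ∧
        ‖((tripleSplitStep CE CB ψE φE τ ωv)^[n] (p0, e0, b0)).2.2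
            - b (t0 + (n : ℝ) * τ)‖ ≤ C * τ^2 := by
  obtain ⟨K, hKdef⟩ : ∃ K : ℝ, K = 1 + Cc + 1 / c0 + |C2| + |C2| / c0 + (2 * |C1| / c0 ^ 2 + |C7|) := ⟨_, rfl⟩
  obtain ⟨M, hM⟩ : ∃ M : ℝ, M = √(4 * H0 * Real.exp (6 * K ^ 2 * (T - t0))) := ⟨_, rfl⟩
  obtain ⟨L, hL⟩ : ∃ L : ℝ, L = 3 * K ^ 5 * M := ⟨_, rfl⟩
  obtain ⟨G, hG⟩ : ∃ G : ℝ, G = TripleSplitting.growthConst K L (T - t0) := ⟨_, rfl⟩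
  have hC2 : 0 ≤ |C2| / c0 := by positivity
  have hC1 : 0 ≤ 2 * |C1| / c0 ^ 2 + |C7| := by positivity
  have hc0' : 0 < 1 / c0 := by positivity
  have hK : 1 ≤ K := by linarith [abs_nonneg C2]
  have hK0 : 0 ≤ K := by linarith
  have hM0 : 0 ≤ M := hM ▸ Real.sqrt_nonneg _
  have hL0 : 0 ≤ L := by rw [hL]; positivity
  have hT0 : 0 < T - t0 := by linarith
  have hG0 : 0 ≤ G := hG ▸ TripleSplitting.growthConst_nonneg hK hL0 hT0.le
  have k1 : 0 ≤ 2 * G + 2 * K ^ 3 * L := by positivity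
  have k2 : 0 ≤ G + 3 * K ^ 4 * L := by positivity
  have k3 : 0 ≤ (K * G + 3 * K ^ 3 * L) + (T - t0) * (G + L) := by positivity
  refine ⟨min 1 c0, by positivity, (2 * G + 2 * K ^ 3 * L) + (G + 3 * K ^ 4 * L)
    + ((K * G + 3 * K ^ 3 * L) + (T - t0) * (G + L)) + 1, by linarith, ?_⟩
  intro d _ CE CB _ ow how ωv hωv hCE hCB ψE φE _ _ hψ0 hφ0 hf1 hf2 _ _ _ _ hf7 _ p0 e0 b0
    hΩe0 hCb0 hΩp0 _ he0 hb0 hΩCb0 p e b hp he hb hpt het hbt τ hτ hττ hθ n hn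
  have hτ1 : τ ≤ 1 := hττ.trans (min_le_left _ _)
  have hω : 1 ≤ ow := by
    have : τ * 1 ≤ τ * ow := by linarith [hττ.trans (min_le_right _ _)]
    exact le_of_mul_le_mul_left this hτ
  have hωτ : ow⁻¹ ≤ K * τ := by
    rw [inv_le_iff_one_le_mul₀ how]
    calc (1 : ℝ) = 1 / c0 * c0 := by field_simp
      _ ≤ K * (τ * ow) := by gcongr; linarith [abs_nonneg C2]
      _ = _ := by ring
  have hCcK : Cc ≤ K := by linarith [abs_nonneg C2]
  have hsinc : sinc (τ * ow / 2) = Real.sin (τ * ow / 2) / (τ * ow / 2) :=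
    if_neg (by positivity)
  have h1 := hf1 (τ * ow)
  have h2 := hf2 (τ * ow)
  rw [hsinc] at h1 h2
  obtain ⟨κ, μ, ν, hc⟩ := TripleSplitting.exists_stepCoefficients hc0 hθ hτ.le
    (by linarith [abs_nonneg C2] : 2 * |C1| / c0 ^ 2 + |C7| ≤ K) (by linarith)
    (by linarith [abs_nonneg C2]) h1 h2 (hf7 (τ * ow / 2))
  rw [mul_div_right_comm] at hc
  have hmin : 1 / 3 * min 1 (4 / C4 ^ 2) * H0 ≤ 1 / 3 * 1 * H0 := by
    gcongr
    exact min_le_left _ _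
  obtain ⟨r1, r2, r3⟩ := TripleSplitting.maxwell_error_le hωv hK hH0.le hT.le hτ hτ1 hω hωτ
    (fun v => (hCE v).trans (by gcongr)) (fun v => (hCB v).trans (by gcongr)) hψ0 hφ0 hc hΩe0
    (by linarith) hΩp0 he0 hb0 hΩCb0 hp he hb hpt het hbt
    (S := fun n => (tripleSplitStep CE CB ψE φE τ ωv)^[n] (p0, e0, b0)) rfl
    (fun n => Function.iterate_succ_apply' _ n _) hn hM hL hG
  exact ⟨r1.trans (mul_le_mul_of_nonneg_right (by linarith) (sq_nonneg τ)),
    r2.trans (mul_le_mul_of_nonneg_right (by linarith) (sq_nonneg τ)),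
    r3.trans (mul_le_mul_of_nonneg_right (by linarith) (sq_nonneg τ))⟩
end

section
/- There exist τ₀ > 0 and C > 0 depending only on T − t₀, c₀, H₀, C_g := C_c² and C₁,…,C₅ (independent of ω̃, τ, n, d) such that: if the filter functions ψ_E, φ_E satisfy filter conditions (i)–(v), the initial data satisfy the Initial-data bounds, and the step size satisfies 0 < τ ≤ τ₀ and τ·ω̃ ≥ c₀, then the electric-field iterates e_n of the triple splitting scheme and the exact solution e of the semidiscrete Maxwell system satisfy ‖e_n − e(t_n)‖ ≤ C·τ² for all n with t_n := t₀ + n·τ ≤ T. -/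
theorem norm_propagator_sub_le {X : Type*} [NormedAddCommGroup X] [NormedSpace ℝ X]
    {ω : ℝ} {S K : ℝ → ℝ} (hS : ∀ r, HasDerivAt S (K r) r)
    (hK : ∀ r, HasDerivAt K (-(ω ^ 2 * S r)) r)
    {x v g : ℝ → X} (hx : ∀ s, HasDerivAt x (v s) s)
    (hv : ∀ s, HasDerivAt v (g s - ω ^ 2 • x s) s)
    {r β M : ℝ} (hr : 0 ≤ r) (hβ : ∀ s ∈ Set.Icc 0 r, |S s| ≤ β)
    (hg : ∀ s ∈ Set.Icc 0 r, ‖g s‖ ≤ M) :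
    ‖K 0 • x r + S 0 • v r - (K r • x 0 + S r • v 0)‖ ≤ β * M * r := by
  have hd : ∀ s, HasDerivAt (fun s => K (r - s) • x s + S (r - s) • v s) (S (r - s) • g s) s := by
    intro s
    have h1 := ((hK (r - s)).comp_const_sub r s).smul (hx s)
    have h2 := ((hS (r - s)).comp_const_sub r s).smul (hv s)
    refine (h1.add h2).congr_deriv ?_
    module
  have hb : ∀ s ∈ Set.Ico 0 r, ‖S (r - s) • g s‖ ≤ β * M := by
    intro s hs
    have h1 := hβ (r - s) ⟨by linarith [hs.2], by linarith [hs.1]⟩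
    rw [norm_smul, Real.norm_eq_abs]
    exact mul_le_mul h1 (hg s ⟨hs.1, hs.2.le⟩) (norm_nonneg _) ((abs_nonneg _).trans h1)
  have := norm_image_sub_le_of_norm_deriv_le_segment' (fun s _ => (hd s).hasDerivWithinAt) hb r
    ⟨hr, le_rfl⟩
  simpa using this

theorem abs_sin_mul_div_le {ω : ℝ} (hω : 0 < ω) {s : ℝ} (hs : 0 ≤ s) :
    |Real.sin (s * ω) / ω| ≤ s := by
  rw [abs_div, abs_of_pos hω, div_le_iff₀ hω]
  exact (Real.abs_sin_le_abs).trans_eq (abs_of_nonneg (by positivity))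

theorem hasDerivAt_sin_mul_div {ω : ℝ} (hω : 0 < ω) (r : ℝ) :
    HasDerivAt (fun r => Real.sin (r * ω) / ω) (Real.cos (r * ω)) r := by
  have := ((hasDerivAt_mul_const (x := r) ω).sin).div_const ω
  exact this.congr_deriv (by field_simp)

theorem hasDerivAt_cos_mul (ω r : ℝ) :
    HasDerivAt (fun r => Real.cos (r * ω)) (-(Real.sin (r * ω) * ω)) r := by
  have := ((hasDerivAt_mul_const (x := r) ω).cos)
  exact this.congr_deriv (by ring)

theorem norm_sub_taylor_le {X : Type*} [NormedAddCommGroup X] [NormedSpace ℝ X]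
    {x v g : ℝ → X} (hx : ∀ s, HasDerivAt x (v s) s) (hv : ∀ s, HasDerivAt v (g s) s)
    {r M : ℝ} (hr : 0 ≤ r) (hg : ∀ s ∈ Set.Icc 0 r, ‖g s‖ ≤ M) :
    ‖x r - x 0 - r • v 0‖ ≤ M * r ^ 2 := by
  have := norm_propagator_sub_le (ω := 0) (S := id) (K := fun _ => 1) hasDerivAt_id
    (fun r => by simpa using hasDerivAt_const r (1 : ℝ)) hx (by simpa using hv) hr
    (β := r) (fun s hs => by simpa [abs_of_nonneg hs.1] using hs.2) hg
  simp only [id, one_smul, zero_smul, add_zero] at this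
  rw [sub_sub]
  exact this.trans_eq (by ring)

theorem norm_sub_oscillation_le {X : Type*} [NormedAddCommGroup X] [NormedSpace ℝ X]
    {ω : ℝ} (hω : 0 < ω) {x v g : ℝ → X} (hx : ∀ s, HasDerivAt x (v s) s)
    (hv : ∀ s, HasDerivAt v (g s - ω ^ 2 • x s) s)
    {r M : ℝ} (hr : 0 ≤ r) (hg : ∀ s ∈ Set.Icc 0 r, ‖g s‖ ≤ M) :
    ‖x r - Real.cos (r * ω) • x 0 - (Real.sin (r * ω) / ω) • v 0‖ ≤ M * r ^ 2 := by
  have := norm_propagator_sub_le (hasDerivAt_sin_mul_div hω)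
    (fun r => (hasDerivAt_cos_mul ω r).congr_deriv (by field_simp)) hx hv hr
    (β := r) (fun s hs => (abs_sin_mul_div_le hω hs.1).trans hs.2) hg
  simp only [zero_mul, Real.sin_zero, Real.cos_zero, one_smul, zero_smul, add_zero, zero_div]
    at this
  rw [sub_sub]
  exact this.trans_eq (by ring)

theorem sq_mul_sinc_half_sq {ω : ℝ} (hω : 0 < ω) {τ : ℝ} (hτ : 0 < τ) :
    τ ^ 2 * sinc (τ * ω / 2) ^ 2 = 2 * (1 - Real.cos (τ * ω)) / ω ^ 2 := by
  have hz : τ * ω / 2 ≠ 0 := by positivity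
  have h : Real.cos (τ * ω) = 1 - 2 * Real.sin (τ * ω / 2) ^ 2 := by
    rw [Real.sin_sq_eq_half_sub]; ring_nf
  rw [sinc, if_neg hz, h]
  field_simp
  ring

theorem mul_sinc {ω : ℝ} (hω : 0 < ω) {τ : ℝ} (hτ : 0 < τ) :
    τ * sinc (τ * ω) = Real.sin (τ * ω) / ω := by
  rw [sinc, if_neg (by positivity)]
  field_simp

/-- Local expansion of the coupled system `y'' = A (y + u)`, `u'' = C (y + u) - ω² u`. -/
theorem coupled_expansion {X : Type*} [NormedAddCommGroup X] [NormedSpace ℝ X]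
    {A C : X →ₗ[ℝ] X} {M F k ω τ : ℝ} (hA : ∀ v, ‖A v‖ ≤ M * ‖v‖) (hC : ∀ v, ‖C v‖ ≤ M * ‖v‖)
    (hM : 0 ≤ M) (hω : 0 < ω) (hτ : 0 < τ) {y y' u u' : ℝ → X}
    (hy : ∀ s, HasDerivAt y (y' s) s) (hy' : ∀ s, HasDerivAt y' (A (y s + u s)) s)
    (hu : ∀ s, HasDerivAt u (u' s) s)
    (hu' : ∀ s, HasDerivAt u' (C (y s + u s) - ω ^ 2 • u s) s)
    (hAF : ∀ s, ‖A (y s + u s)‖ ≤ F) (hCF : ∀ s, ‖C (y s + u s)‖ ≤ F)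
    (hk : ‖y' 0‖ ≤ k) (hk' : ‖u' 0‖ ≤ k) :
    ‖y τ - y 0 - τ • y' 0 - (τ ^ 2 / 2) • A (y 0 + sinc (τ * ω / 2) ^ 2 • u 0)‖
        ≤ M * (2 * (k * τ + F * τ ^ 2)) * τ ^ 2 ∧
    ‖u τ - Real.cos (τ * ω) • u 0 - (τ * sinc (τ * ω)) • u' 0
        - (τ ^ 2 / 2) • C (sinc (τ * ω / 2) ^ 2 • y 0 + sinc (τ * ω) • u 0)‖
        ≤ M * (2 * (k * τ + F * τ ^ 2)) * τ ^ 2 := by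
  have hF0 : 0 ≤ F := (norm_nonneg _).trans (hAF 0)
  have hk0 : 0 ≤ k := (norm_nonneg _).trans hk
  have hmono : ∀ s ∈ Set.Icc 0 τ, k * s + F * s ^ 2 ≤ k * τ + F * τ ^ 2 := by
    intro s hs
    have := hs.1
    have := hs.2
    gcongr
  have hyd : ∀ s ∈ Set.Icc 0 τ, ‖y s - y 0‖ ≤ k * τ + F * τ ^ 2 := by
    intro s hs
    have h1 := norm_sub_taylor_le hy hy' hs.1 (fun t _ => hAF t)
    have h2 : ‖s • y' 0‖ ≤ k * s := by
      rw [norm_smul, Real.norm_eq_abs, abs_of_nonneg hs.1, mul_comm]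
      exact mul_le_mul_of_nonneg_right hk hs.1
    calc ‖y s - y 0‖ = ‖(y s - y 0 - s • y' 0) + s • y' 0‖ := by congr 1; abel
      _ ≤ F * s ^ 2 + k * s := (norm_add_le _ _).trans (add_le_add h1 h2)
      _ ≤ _ := by linarith [hmono s hs]
  have hud : ∀ s ∈ Set.Icc 0 τ, ‖u s - Real.cos (s * ω) • u 0‖ ≤ k * τ + F * τ ^ 2 := by
    intro s hs
    have h1 := norm_sub_oscillation_le hω hu hu' hs.1 (fun t _ => hCF t)
    have h2 : ‖(Real.sin (s * ω) / ω) • u' 0‖ ≤ k * s := by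
      rw [norm_smul, Real.norm_eq_abs, mul_comm]
      exact mul_le_mul hk' (abs_sin_mul_div_le hω hs.1) (abs_nonneg _) hk0
    calc ‖u s - Real.cos (s * ω) • u 0‖
        = ‖(u s - Real.cos (s * ω) • u 0 - (Real.sin (s * ω) / ω) • u' 0)
            + (Real.sin (s * ω) / ω) • u' 0‖ := by congr 1; abel
      _ ≤ F * s ^ 2 + k * s := (norm_add_le _ _).trans (add_le_add h1 h2)
      _ ≤ _ := by linarith [hmono s hs]
  have hgen : ∀ B : X →ₗ[ℝ] X, (∀ v, ‖B v‖ ≤ M * ‖v‖) → ∀ s ∈ Set.Icc 0 τ,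
      ‖B (y s + u s) - B (y 0) - Real.cos (s * ω) • B (u 0)‖
        ≤ M * (2 * (k * τ + F * τ ^ 2)) := by
    intro B hB s hs
    have : B (y s + u s) - B (y 0) - Real.cos (s * ω) • B (u 0)
        = B ((y s - y 0) + (u s - Real.cos (s * ω) • u 0)) := by
      simp only [map_add, map_sub, map_smul]; abel
    rw [this]
    refine (hB _).trans (mul_le_mul_of_nonneg_left ?_ hM)
    exact (norm_add_le _ _).trans (by linarith [hyd s hs, hud s hs])
  have hsin : ∀ s, HasDerivAt (fun s => Real.sin (s * ω)) (Real.cos (s * ω) * ω) s := fun s =>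
    (hasDerivAt_mul_const (x := s) ω).sin
  have hcos := hasDerivAt_cos_mul ω
  have hid : ∀ s : ℝ, HasDerivAt (fun s : ℝ => s) 1 s := fun s => hasDerivAt_id s
  have hq1 : ∀ s, HasDerivAt (fun s => (1 - Real.cos (s * ω)) / ω ^ 2)
      (Real.sin (s * ω) / ω) s := fun s =>
    (((hcos s).const_sub 1).div_const (ω ^ 2)).congr_deriv (by field_simp)
  have hq2 := hasDerivAt_sin_mul_div hω
  constructor
  · have h1 := norm_sub_taylor_le
      (x := fun s => y s - ((s ^ 2 / 2) • A (y 0) + ((1 - Real.cos (s * ω)) / ω ^ 2) • A (u 0)))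
      (v := fun s => y' s - (s • A (y 0) + (Real.sin (s * ω) / ω) • A (u 0)))
      (fun s => (hy s).sub (((((hid s).pow 2).div_const 2).smul_const _ |>.add
        ((hq1 s).smul_const _)).congr_deriv (by simp)))
      (fun s => (hy' s).sub (((hid s).smul_const (A (y 0))).add ((hq2 s).smul_const (A (u 0)))))
      hτ.le (M := M * (2 * (k * τ + F * τ ^ 2)))
      (fun s hs => by
        have := hgen A hA s hs
        rwa [one_smul, ← sub_sub])
    refine (le_of_eq ?_).trans h1
    congr 1
    have := sq_mul_sinc_half_sq hω hτ
    have e : (1 - Real.cos (τ * ω)) / ω ^ 2 = τ ^ 2 / 2 * sinc (τ * ω / 2) ^ 2 := by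
      linear_combination (-1/2 : ℝ) * this
    simp only [e, map_add, map_smul]
    simp
    module
  · have h1 := norm_sub_oscillation_le hω
      (x := fun s => u s - (((1 - Real.cos (s * ω)) / ω ^ 2) • C (y 0)
        + (s / 2 * (Real.sin (s * ω) / ω)) • C (u 0)))
      (v := fun s => u' s - ((Real.sin (s * ω) / ω) • C (y 0)
        + (1 / 2 * (Real.sin (s * ω) / ω) + s / 2 * Real.cos (s * ω)) • C (u 0)))
      (g := fun s => C (y s + u s) - C (y 0) - Real.cos (s * ω) • C (u 0))
      (fun s => (hu s).sub (((hq1 s).smul_const _).add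
        ((((hid s).div_const 2).mul (hq2 s)).smul_const _)))
      (fun s => ((hu' s).sub (((hq2 s).smul_const (C (y 0))).add
        ((((hq2 s).const_mul (1 / 2)).add (((hid s).div_const 2).mul (hcos s))).smul_const
          (C (u 0))))).congr_deriv (by
            match_scalars <;> field_simp <;> ring))
      hτ.le (M := M * (2 * (k * τ + F * τ ^ 2))) (hgen C hC)
    refine (le_of_eq ?_).trans h1
    congr 1
    have := sq_mul_sinc_half_sq hω hτ
    have e : (1 - Real.cos (τ * ω)) / ω ^ 2 = τ ^ 2 / 2 * sinc (τ * ω / 2) ^ 2 := by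
      linear_combination (-1/2 : ℝ) * this
    simp only [e, ← mul_sinc hω hτ, map_add, map_smul]
    simp
    module

/-- `sin (n z) / sin z`, extended continuously. -/
noncomputable def sinQuotient (z : ℝ) : ℕ → ℝ
  | 0 => 0
  | n + 1 => Real.cos z * sinQuotient z n + Real.cos (n * z)

theorem sinQuotient_mul_sin (z : ℝ) (n : ℕ) :
    sinQuotient z n * Real.sin z = Real.sin (n * z) := by
  induction n with
  | zero => simp [sinQuotient]
  | succ n ih =>
    rw [sinQuotient, Nat.cast_succ, add_mul (n : ℝ), one_mul, Real.sin_add]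
    linear_combination Real.cos z * ih

theorem sinQuotient_add_two (z : ℝ) (n : ℕ) :
    sinQuotient z (n + 2) = 2 * Real.cos z * sinQuotient z (n + 1) - sinQuotient z n := by
  have h1 : sinQuotient z (n + 2)
      = Real.cos z * sinQuotient z (n + 1) + Real.cos ((n + 1 : ℕ) * z) := rfl
  have h2 : sinQuotient z (n + 1) = Real.cos z * sinQuotient z n + Real.cos (n * z) := rfl
  rw [h1, h2, Nat.cast_succ, add_mul (n : ℝ), one_mul, Real.cos_add]
  linear_combination Real.sin z * sinQuotient_mul_sin z n
    - sinQuotient z n * Real.sin_sq_add_cos_sq z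

theorem abs_sinQuotient_le (z : ℝ) (n : ℕ) : |sinQuotient z n| ≤ n := by
  induction n with
  | zero => simp [sinQuotient]
  | succ n ih =>
    rw [sinQuotient, Nat.cast_succ]
    refine (abs_add_le _ _).trans (add_le_add ?_ (Real.abs_cos_le_one _))
    rw [abs_mul]
    exact (mul_le_of_le_one_left (abs_nonneg _) (Real.abs_cos_le_one _)).trans ih

theorem abs_sinQuotient_mul_sinc_le {z : ℝ} (hz : 0 < z) (n : ℕ) :
    |sinQuotient z n| * |sinc z| ≤ 1 / z := by
  rw [← abs_mul, sinc, if_neg hz.ne', ← mul_div_assoc, sinQuotient_mul_sin, abs_div,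
    abs_of_pos hz]
  gcongr
  exact Real.abs_sin_le_one _

theorem eq_sinQuotient_sum {X : Type*} [AddCommGroup X] [Module ℝ X] {z : ℝ}
    (m : ℕ) (x f : ℕ → X)
    (h : ∀ n, x (n + 2) = (2 * Real.cos z) • x (n + 1) - x n + f n) :
    x (m + 1) = sinQuotient z (m + 1) • x 1 - sinQuotient z m • x 0
      + ∑ k ∈ Finset.range m, sinQuotient z (m - k) • f k := by
  induction m generalizing x f with
  | zero => simp [sinQuotient]
  | succ m ih =>
    have := ih (fun n => x (n + 1)) (fun n => f (n + 1)) (fun n => h (n + 1))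
    simp only [zero_add] at this
    rw [this, Finset.sum_range_succ', sinQuotient_add_two z m, show (1 + 1 : ℕ) = 0 + 2 from rfl,
      h 0]
    simp only [Nat.add_sub_add_right, tsub_zero]
    module

theorem norm_le_of_three_term {X : Type*} [NormedAddCommGroup X] [NormedSpace ℝ X] {z : ℝ}
    (x f : ℕ → X) (h : ∀ n, x (n + 2) = (2 * Real.cos z) • x (n + 1) - x n + f n) (m : ℕ) :
    ‖x (m + 1)‖ ≤ ‖x 0‖ + |sinQuotient z (m + 1)| * ‖x 1 - Real.cos z • x 0‖
      + ∑ k ∈ Finset.range m, |sinQuotient z (m - k)| * ‖f k‖ := by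
  have hc : Real.cos z * sinQuotient z (m + 1) - sinQuotient z m = Real.cos ((m + 1 : ℕ) * z) := by
    have h1 := sinQuotient_add_two z m
    have h2 : sinQuotient z (m + 2)
      = Real.cos z * sinQuotient z (m + 1) + Real.cos ((m + 1 : ℕ) * z) := rfl
    linarith
  have hx : x (m + 1) = Real.cos ((m + 1 : ℕ) * z) • x 0
      + sinQuotient z (m + 1) • (x 1 - Real.cos z • x 0)
      + ∑ k ∈ Finset.range m, sinQuotient z (m - k) • f k := by
    rw [eq_sinQuotient_sum m x f h, ← hc]
    module
  rw [hx]
  refine (norm_add_le _ _).trans (add_le_add ((norm_add_le _ _).trans (add_le_add ?_ ?_)) ?_)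
  · rw [norm_smul, Real.norm_eq_abs]
    exact mul_le_of_le_one_left (norm_nonneg _) (Real.abs_cos_le_one _)
  · rw [norm_smul, Real.norm_eq_abs]
  · refine (norm_sum_le _ _).trans_eq (Finset.sum_congr rfl fun k _ => ?_)
    rw [norm_smul, Real.norm_eq_abs]

/-- Cancellation in sums of an oscillating function. -/
theorem norm_sum_oscillation_le {X : Type*} [NormedAddCommGroup X] [NormedSpace ℝ X]
    {ω : ℝ} (hω : 0 < ω) {x v g : ℝ → X} (hx : ∀ s, HasDerivAt x (v s) s)
    (hv : ∀ s, HasDerivAt v (g s - ω ^ 2 • x s) s) {τ k M : ℝ} (hτ : 0 < τ)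
    (hg : ∀ s, ‖g s‖ ≤ M) (hxk : ∀ s, ω * ‖x s‖ ≤ k) (hvk : ∀ s, ‖v s‖ ≤ k) (t : ℝ) (N : ℕ) :
    2 * |Real.sin (τ * ω / 2)| * ‖∑ n ∈ Finset.range N, x (t + n * τ)‖
      ≤ (4 * k + 2 * (N * τ) * M) / ω := by
  set σ := Real.sin (τ * ω / 2)
  set κ := Real.cos (τ * ω / 2)
  set Su := ∑ n ∈ Finset.range N, x (t + n * τ)
  set Sv := ∑ n ∈ Finset.range N, ω⁻¹ • v (t + n * τ)
  have hcos : Real.cos (τ * ω) = 1 - 2 * σ ^ 2 := by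
    rw [Real.sin_sq_eq_half_sub]; ring_nf
  have hsin : Real.sin (τ * ω) = 2 * σ * κ := by
    rw [← Real.sin_two_mul]; ring_nf
  have hκ : κ ^ 2 = 1 - σ ^ 2 := Real.cos_sq' _
  have hω' : ω⁻¹ * ω = 1 := inv_mul_cancel₀ hω.ne'
  have hxs : ∀ t s, HasDerivAt (fun s => x (t + s)) (v (t + s)) s := fun t s =>
    (hx (t + s)).comp_const_add t s
  have hvs : ∀ t s, HasDerivAt (fun s => v (t + s)) (g (t + s) - ω ^ 2 • x (t + s)) s := fun t s =>
    (hv (t + s)).comp_const_add t s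
  have hcosStep : ∀ t, ‖x (t + τ) - (Real.cos (τ * ω) • x t + Real.sin (τ * ω) • ω⁻¹ • v t)‖
      ≤ τ * M / ω := by
    intro t
    have := norm_propagator_sub_le (hasDerivAt_sin_mul_div hω)
      (fun r => (hasDerivAt_cos_mul ω r).congr_deriv (by field_simp)) (hxs t) (hvs t) hτ.le
      (β := ω⁻¹) (M := M) (fun s _ => by
        rw [abs_div, abs_of_pos hω, div_eq_mul_inv]
        exact mul_le_of_le_one_left (by positivity) (Real.abs_sin_le_one _)) (fun s _ => hg _)
    simp only [zero_mul, Real.sin_zero, Real.cos_zero, one_smul, zero_smul, add_zero, zero_div]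
      at this
    convert this using 1
    · congr 3
      rw [smul_smul, div_eq_mul_inv]
    · field_simp
  have hsinStep : ∀ t, ‖ω⁻¹ • v (t + τ)
        - (Real.cos (τ * ω) • ω⁻¹ • v t - Real.sin (τ * ω) • x t)‖ ≤ τ * M / ω := by
    intro t
    have := norm_propagator_sub_le (S := fun r => ω⁻¹ * Real.cos (r * ω))
      (K := fun r => - Real.sin (r * ω))
      (fun r => ((hasDerivAt_cos_mul ω r).const_mul _).congr_deriv (by field_simp))
      (fun r => (((hasDerivAt_mul_const (x := r) ω).sin).neg).congr_deriv (by field_simp))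
      (hxs t) (hvs t) hτ.le
      (β := ω⁻¹) (M := M) (fun s _ => by
        rw [abs_mul, abs_of_pos (inv_pos.2 hω)]
        exact mul_le_of_le_one_right (by positivity) (Real.abs_cos_le_one _)) (fun s _ => hg _)
    simp only [zero_mul, Real.sin_zero, Real.cos_zero, mul_one, neg_zero, zero_smul, add_zero,
      zero_add] at this
    convert this using 1
    · congr 1
      module
    · field_simp
  have hshift : ∀ w : ℝ → X, ∑ n ∈ Finset.range N, w (t + n * τ + τ)
      = ∑ n ∈ Finset.range N, w (t + n * τ) + w (t + N * τ) - w t := by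
    intro w
    have h1 := Finset.sum_range_succ (fun n : ℕ => w (t + n * τ)) N
    rw [Finset.sum_range_succ'] at h1
    simp only [Nat.cast_zero, zero_mul, add_zero, Nat.cast_succ] at h1
    rw [← h1, add_sub_cancel_right]
    refine Finset.sum_congr rfl fun n _ => ?_
    congr 1; ring
  have hsum : ∀ w h : ℝ → X, (∀ t, ‖w (t + τ) - h t‖ ≤ τ * M / ω) → (∀ t, ‖w t‖ ≤ k / ω) →
      ‖∑ n ∈ Finset.range N, w (t + n * τ) - ∑ n ∈ Finset.range N, h (t + n * τ)‖
        ≤ (2 * k + N * τ * M) / ω := by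
    intro w h hw hwk
    have e : ∑ n ∈ Finset.range N, w (t + n * τ) - ∑ n ∈ Finset.range N, h (t + n * τ)
        = ∑ n ∈ Finset.range N, (w (t + n * τ + τ) - h (t + n * τ)) - w (t + N * τ) + w t := by
      rw [Finset.sum_sub_distrib, hshift]; abel
    rw [e]
    have h1 : ‖∑ n ∈ Finset.range N, (w (t + n * τ + τ) - h (t + n * τ))‖
        ≤ N * (τ * M / ω) := by
      refine (norm_sum_le_of_le (Finset.range N) (fun n _ => hw (t + n * τ))).trans_eq ?_
      simp
    have h2 := hwk (t + N * τ)
    have h3 := hwk t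
    calc _ ≤ N * (τ * M / ω) + k / ω + k / ω :=
          (norm_add_le _ _).trans (add_le_add ((norm_sub_le _ _).trans (add_le_add h1 h2)) h3)
      _ = _ := by ring
  have ha := hsum x (fun t => Real.cos (τ * ω) • x t + Real.sin (τ * ω) • ω⁻¹ • v t) hcosStep
    (fun t => by rw [le_div_iff₀ hω, mul_comm]; exact hxk t)
  have hb := hsum (fun t => ω⁻¹ • v t)
    (fun t => Real.cos (τ * ω) • ω⁻¹ • v t - Real.sin (τ * ω) • x t) hsinStep
    (fun t => by
      rw [norm_smul, Real.norm_eq_abs, abs_of_pos (inv_pos.2 hω), inv_mul_eq_div]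
      exact div_le_div_of_nonneg_right (hvk t) hω.le)
  simp only [Finset.sum_add_distrib, Finset.sum_sub_distrib, ← Finset.smul_sum] at ha hb
  have hSv : ω⁻¹ • ∑ n ∈ Finset.range N, v (t + n * τ) = Sv := Finset.smul_sum
  rw [hSv] at ha hb
  change ‖Su - _‖ ≤ _ at ha
  change ‖Sv - (Real.cos (τ * ω) • Sv - Real.sin (τ * ω) • Su)‖ ≤ _ at hb
  have key : (2 * σ) • Su = σ • (Su - (Real.cos (τ * ω) • Su + Real.sin (τ * ω) • Sv))
      + κ • (Sv - (Real.cos (τ * ω) • Sv - Real.sin (τ * ω) • Su)) := by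
    rw [hcos, hsin]
    match_scalars
    · linear_combination (-2 * σ) * hκ
    · ring
  calc 2 * |σ| * ‖Su‖ = ‖(2 * σ) • Su‖ := by
        rw [norm_smul, Real.norm_eq_abs, abs_mul, abs_two]
    _ ≤ (2 * k + N * τ * M) / ω + (2 * k + N * τ * M) / ω := by
        rw [key]
        refine (norm_add_le _ _).trans (add_le_add ?_ ?_)
        · rw [norm_smul, Real.norm_eq_abs]
          exact (mul_le_of_le_one_left (norm_nonneg _) (Real.abs_sin_le_one _)).trans ha
        · rw [norm_smul, Real.norm_eq_abs]
          exact (mul_le_of_le_one_left (norm_nonneg _) (Real.abs_cos_le_one _)).trans hb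
    _ = _ := by ring

theorem le_exp_of_le_sum {ε : ℕ → ℝ} {a b L τ : ℝ} (ha : 0 ≤ a) (hb : 0 ≤ b) (hτ : 0 ≤ τ)
    (h : ∀ n : ℕ, n * τ ≤ L → ε n ≤ a + b * τ * ∑ k ∈ Finset.range n, ε k) (n : ℕ)
    (hn : n * τ ≤ L) : ε n ≤ a * Real.exp (b * L) := by
  have key : ∀ n : ℕ, n * τ ≤ L → ε n ≤ a * (1 + b * τ) ^ n := by
    intro n
    induction n using Nat.strong_induction_on with
    | _ n ih =>
      intro hn
      have h1 : ∑ k ∈ Finset.range n, ε k ≤ ∑ k ∈ Finset.range n, a * (1 + b * τ) ^ k := by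
        refine Finset.sum_le_sum fun k hk => ?_
        have hk' := Finset.mem_range.1 hk
        refine ih k hk' (le_trans ?_ hn)
        gcongr
      have h2 : (∑ k ∈ Finset.range n, (1 + b * τ) ^ k) * (b * τ) = (1 + b * τ) ^ n - 1 := by
        have := geom_sum_mul (1 + b * τ) n
        rwa [add_sub_cancel_left] at this
      calc ε n ≤ a + b * τ * ∑ k ∈ Finset.range n, ε k := h n hn
        _ ≤ a + b * τ * ∑ k ∈ Finset.range n, a * (1 + b * τ) ^ k := by gcongr
        _ = a * (1 + b * τ) ^ n := by
          rw [← Finset.mul_sum]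
          linear_combination a * h2
  refine (key n hn).trans (mul_le_mul_of_nonneg_left ?_ ha)
  calc (1 + b * τ) ^ n ≤ Real.exp (b * τ) ^ n := by
        gcongr
        linarith [Real.add_one_le_exp (b * τ)]
    _ = Real.exp (b * (n * τ)) := by rw [← Real.exp_nat_mul]; ring_nf
    _ ≤ _ := by gcongr

theorem abs_sinc_le_one (z : ℝ) : |sinc z| ≤ 1 := by
  unfold sinc
  split_ifs with h
  · simp
  · rw [abs_div]
    exact div_le_one_of_le₀ Real.abs_sin_le_abs (abs_nonneg z)

theorem mul_abs_sinc_half {z : ℝ} (hz : 0 < z) : z * |sinc (z / 2)| = 2 * |Real.sin (z / 2)| := by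
  rw [sinc, if_neg (by positivity), abs_div, abs_of_pos (by positivity : 0 < z / 2)]
  field_simp

/-- A bounded-energy solution of `y'' = A (y + u)`, `u'' = C (y + u) - ω² u`, all of whose
bounds are controlled by the constant `K`. -/
structure TwoScaleFlow {X : Type*} [NormedAddCommGroup X] [NormedSpace ℝ X]
    (A C : X →ₗ[ℝ] X) (ω K : ℝ) (y y' u u' : ℝ → X) : Prop where
  one_le : 1 ≤ K
  freq_pos : 0 < ω
  norm_slow_le : ∀ v, ‖A v‖ ≤ K * ‖v‖
  norm_fast_le : ∀ v, ‖C v‖ ≤ K * ‖v‖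
  deriv_y : ∀ s, HasDerivAt y (y' s) s
  deriv_y' : ∀ s, HasDerivAt y' (A (y s + u s)) s
  deriv_u : ∀ s, HasDerivAt u (u' s) s
  deriv_u' : ∀ s, HasDerivAt u' (C (y s + u s) - ω ^ 2 • u s) s
  norm_y'_le : ∀ s, ‖y' s‖ ≤ K
  norm_u'_le : ∀ s, ‖u' s‖ ≤ K
  norm_u_le : ∀ s, ω * ‖u s‖ ≤ K
  norm_slow_force_le : ∀ s, ‖A (y s + u s)‖ ≤ K
  norm_fast_force_le : ∀ s, ‖C (y s + u s)‖ ≤ K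

namespace TwoScaleFlow

variable {X : Type*} [NormedAddCommGroup X] [NormedSpace ℝ X]
  {A C : X →ₗ[ℝ] X} {ω K : ℝ} {y y' u u' : ℝ → X}

theorem shift (h : TwoScaleFlow A C ω K y y' u u') (t : ℝ) :
    TwoScaleFlow A C ω K (fun s => y (t + s)) (fun s => y' (t + s)) (fun s => u (t + s))
      (fun s => u' (t + s)) where
  one_le := h.one_le
  freq_pos := h.freq_pos
  norm_slow_le := h.norm_slow_le
  norm_fast_le := h.norm_fast_le
  deriv_y s := (h.deriv_y (t + s)).comp_const_add t s
  deriv_y' s := (h.deriv_y' (t + s)).comp_const_add t s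
  deriv_u s := (h.deriv_u (t + s)).comp_const_add t s
  deriv_u' s := (h.deriv_u' (t + s)).comp_const_add t s
  norm_y'_le _ := h.norm_y'_le _
  norm_u'_le _ := h.norm_u'_le _
  norm_u_le _ := h.norm_u_le _
  norm_slow_force_le _ := h.norm_slow_force_le _
  norm_fast_force_le _ := h.norm_fast_force_le _

theorem one_step (h : TwoScaleFlow A C ω K y y' u u') {τ : ℝ} (hτ : 0 < τ) (hτ1 : τ ≤ 1) (t : ℝ) :
    ‖y (t + τ) - y t - τ • y' t - (τ ^ 2 / 2) • A (y t + sinc (τ * ω / 2) ^ 2 • u t)‖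
        ≤ 4 * K ^ 2 * τ ^ 3 ∧
    ‖u (t + τ) - Real.cos (τ * ω) • u t - (τ * sinc (τ * ω)) • u' t
        - (τ ^ 2 / 2) • C (sinc (τ * ω / 2) ^ 2 • y t + sinc (τ * ω) • u t)‖
        ≤ 4 * K ^ 2 * τ ^ 3 := by
  have hK := h.one_le
  have hs := h.shift t
  have := coupled_expansion h.norm_slow_le h.norm_fast_le (by linarith) h.freq_pos hτ hs.deriv_y
    hs.deriv_y' hs.deriv_u hs.deriv_u' hs.norm_slow_force_le hs.norm_fast_force_le
    (hs.norm_y'_le 0) (hs.norm_u'_le 0)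
  simp only [add_zero] at this
  have hb : K * (2 * (K * τ + K * τ ^ 2)) * τ ^ 2 ≤ 4 * K ^ 2 * τ ^ 3 := by
    have : τ ^ 2 ≤ τ := by nlinarith
    calc K * (2 * (K * τ + K * τ ^ 2)) * τ ^ 2 ≤ K * (2 * (K * τ + K * τ)) * τ ^ 2 := by gcongr
      _ = _ := by ring
  exact ⟨this.1.trans hb, this.2.trans hb⟩

theorem two_step (h : TwoScaleFlow A C ω K y y' u u') {τ : ℝ} (hτ : 0 < τ) (t : ℝ) :
    ‖y (t + τ) + y (t - τ) - (2 : ℝ) • y t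
        - τ ^ 2 • A (y t + sinc (τ * ω / 2) ^ 2 • u t)‖ ≤ 4 * K ^ 2 * τ ^ 4 ∧
    ‖u (t + τ) + u (t - τ) - (2 * Real.cos (τ * ω)) • u t
        - τ ^ 2 • C (sinc (τ * ω / 2) ^ 2 • y t + sinc (τ * ω) • u t)‖
        ≤ 4 * K ^ 2 * τ ^ 4 ∧
    ‖y (t + τ) + y (t - τ) - (2 : ℝ) • y t‖ ≤ 2 * K * τ ^ 2 := by
  have hK := h.one_le
  have hs := h.shift t
  have hy : ∀ s, HasDerivAt (fun s => y (t + s) + y (t - s)) (y' (t + s) - y' (t - s)) s :=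
    fun s => ((hs.deriv_y s).add ((h.deriv_y (t - s)).comp_const_sub t s)).congr_deriv (by abel)
  have hu : ∀ s, HasDerivAt (fun s => u (t + s) + u (t - s)) (u' (t + s) - u' (t - s)) s :=
    fun s => ((hs.deriv_u s).add ((h.deriv_u (t - s)).comp_const_sub t s)).congr_deriv (by abel)
  have hA : ∀ (B : X →ₗ[ℝ] X) s, B (y (t + s) + y (t - s) + (u (t + s) + u (t - s)))
      = B (y (t + s) + u (t + s)) + B (y (t - s) + u (t - s)) := fun B s => by
    rw [← map_add]; congr 1; abel
  have hy' : ∀ s, HasDerivAt (fun s => y' (t + s) - y' (t - s))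
      (A (y (t + s) + y (t - s) + (u (t + s) + u (t - s)))) s := fun s =>
    ((hs.deriv_y' s).sub ((h.deriv_y' (t - s)).comp_const_sub t s)).congr_deriv (by
      rw [hA]; abel)
  have hu' : ∀ s, HasDerivAt (fun s => u' (t + s) - u' (t - s))
      (C (y (t + s) + y (t - s) + (u (t + s) + u (t - s))) - ω ^ 2 • (u (t + s) + u (t - s))) s :=
    fun s => ((hs.deriv_u' s).sub ((h.deriv_u' (t - s)).comp_const_sub t s)).congr_deriv (by
      rw [hA]; module)
  have hAF : ∀ s, ‖A (y (t + s) + y (t - s) + (u (t + s) + u (t - s)))‖ ≤ 2 * K := fun s => by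
    rw [hA]
    exact (norm_add_le _ _).trans
      (by linarith [h.norm_slow_force_le (t + s), h.norm_slow_force_le (t - s)])
  have hCF : ∀ s, ‖C (y (t + s) + y (t - s) + (u (t + s) + u (t - s)))‖ ≤ 2 * K := fun s => by
    rw [hA]
    exact (norm_add_le _ _).trans
      (by linarith [h.norm_fast_force_le (t + s), h.norm_fast_force_le (t - s)])
  have h1 := coupled_expansion h.norm_slow_le h.norm_fast_le (by linarith) h.freq_pos hτ hy
    hy' hu hu' hAF hCF (k := 0) (by simp) (by simp)
  have h2 := norm_sub_taylor_le hy hy' hτ.le (fun s _ => hAF s)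
  simp only [add_zero, sub_zero, sub_self, smul_zero] at h1 h2
  refine ⟨?_, ?_, ?_⟩
  · convert h1.1 using 1
    · congr 1
      simp only [map_add, map_smul]
      module
    · ring
  · convert h1.2 using 1
    · congr 1
      simp only [map_add, map_smul]
      module
    · ring
  · convert h2 using 1
    congr 1
    module

theorem norm_fast_le_mul (h : TwoScaleFlow A C ω K y y' u u') {τ : ℝ} (hτ : 0 < τ)
    (hz : 1 ≤ K * (τ * ω)) (s : ℝ) : ‖u s‖ ≤ K ^ 2 * τ := by
  have hK := h.one_le
  calc ‖u s‖ ≤ K * (τ * ω) * ‖u s‖ := le_mul_of_one_le_left (norm_nonneg _) hz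
    _ = K * τ * (ω * ‖u s‖) := by ring
    _ ≤ K * τ * K := by gcongr; exact h.norm_u_le s
    _ = _ := by ring

theorem slow_error_le (h : TwoScaleFlow A C ω K y y' u u') {τ : ℝ} (hτ : 0 < τ) (hτ1 : τ ≤ 1)
    (hz : 1 ≤ K * (τ * ω)) {φ t₀ : ℝ} (hφ : |φ| ≤ K * |sinc (τ * ω / 2)|) {ye ue : ℕ → X}
    (hy0 : ye 0 = y t₀) (hu0 : ue 0 = u t₀)
    (hy1 : ye 1 = y t₀ + τ • y' t₀ + (τ ^ 2 / 2) • A (y t₀ + φ • u t₀))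
    (hy2 : ∀ n, ye (n + 2) = (2 : ℝ) • ye (n + 1) - ye n
      + τ ^ 2 • A (ye (n + 1) + φ • ue (n + 1)))
    {n : ℕ} (hn : n * τ ≤ K) :
    ‖ye n - y (t₀ + n * τ)‖ ≤ 21 * K ^ 7 * τ ^ 2 + K ^ 3 * τ * ∑ k ∈ Finset.range n,
      (‖ye k - y (t₀ + k * τ)‖ + ‖ue k - u (t₀ + k * τ)‖) := by
  have hK := h.one_le
  have hω := h.freq_pos
  set Y : ℕ → X := fun k => ye k - y (t₀ + k * τ) with hY
  set U : ℕ → X := fun k => ue k - u (t₀ + k * τ) with hU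
  set σ := sinc (τ * ω / 2) ^ 2 with hσ
  have hY0 : Y 0 = 0 := by simp [hY, hy0]
  have hU0 : U 0 = 0 := by simp [hU, hu0]
  have hσ1 := abs_sinc_le_one (τ * ω / 2)
  have hφ1 : |φ| ≤ K := hφ.trans (mul_le_of_le_one_right (by linarith) hσ1)
  have hφσ : |φ - σ| ≤ 2 * K * |sinc (τ * ω / 2)| := by
    have h1 : |σ| ≤ |sinc (τ * ω / 2)| := by
      rw [hσ, abs_pow, sq]
      exact mul_le_of_le_one_left (abs_nonneg _) hσ1
    have h2 : |sinc (τ * ω / 2)| ≤ K * |sinc (τ * ω / 2)| :=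
      le_mul_of_one_le_left (abs_nonneg _) hK
    linarith [abs_sub φ σ]
  have hφσ' : |φ - σ| ≤ 2 * K := hφσ.trans (mul_le_of_le_one_right (by linarith) hσ1)
  set R : ℕ → X := fun j => Y (j + 1) - Y j
    - τ ^ 2 • ∑ k ∈ Finset.range (j + 1), A (Y k + φ • U k)
    - (τ ^ 2 * (φ - σ)) • A (∑ k ∈ Finset.range (j + 1), u (t₀ + k * τ)) with hR
  have hR0 : ‖R 0‖ ≤ 5 * K ^ 4 * τ ^ 3 := by
    have e : R 0 = - (y (t₀ + τ) - y t₀ - τ • y' t₀ - (τ ^ 2 / 2) • A (y t₀ + σ • u t₀))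
        - (τ ^ 2 / 2 * (φ - σ)) • A (u t₀) := by
      simp only [hR, hY0, hU0, zero_add, Finset.sum_range_one]
      simp only [hY, hy1, smul_zero, add_zero, map_zero, Nat.cast_zero, zero_mul, Nat.cast_one,
        one_mul, map_add, map_smul]
      module
    rw [e]
    refine (norm_sub_le _ _).trans ?_
    rw [norm_neg, norm_smul, Real.norm_eq_abs, abs_mul, abs_of_nonneg (by positivity)]
    have h1 := (h.one_step hτ hτ1 t₀).1
    have h2 : ‖A (u t₀)‖ ≤ K * (K ^ 2 * τ) := (h.norm_slow_le _).trans
      (by gcongr; exact h.norm_fast_le_mul hτ hz t₀)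
    have h3 : τ ^ 2 / 2 * |φ - σ| * ‖A (u t₀)‖ ≤ τ ^ 2 / 2 * (2 * K) * (K * (K ^ 2 * τ)) := by
      gcongr
    have h4 : 4 * K ^ 2 * τ ^ 3 ≤ 4 * K ^ 4 * τ ^ 3 := by gcongr; norm_num
    linarith
  have hRs : ∀ j, ‖R (j + 1) - R j‖ ≤ 4 * K ^ 2 * τ ^ 4 := by
    intro j
    have h1 := (h.two_step hτ (t₀ + (j + 1 : ℕ) * τ)).1
    have e1 : t₀ + (j + 1 : ℕ) * τ + τ = t₀ + (j + 2 : ℕ) * τ := by push_cast; ring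
    have e2 : t₀ + (j + 1 : ℕ) * τ - τ = t₀ + j * τ := by push_cast; ring
    rw [e1, e2, ← norm_neg] at h1
    refine (le_of_eq ?_).trans h1
    congr 1
    simp only [hR, Finset.sum_range_succ _ (j + 1)]
    simp only [hY, hU, hy2, map_add, map_sub, map_smul]
    module
  have hRb : ∀ j : ℕ, j * τ ≤ K → ‖R j‖ ≤ 9 * K ^ 4 * τ ^ 3 := by
    intro j hj
    have h1 : ∀ j : ℕ, ‖R j‖ ≤ 5 * K ^ 4 * τ ^ 3 + j * (4 * K ^ 2 * τ ^ 4) := by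
      intro j
      induction j with
      | zero => simpa using hR0
      | succ j ih =>
        have := norm_add_le (R (j + 1) - R j) (R j)
        rw [sub_add_cancel] at this
        push_cast
        linarith [hRs j]
    have h2 : j * (4 * K ^ 2 * τ ^ 4) ≤ 4 * K ^ 4 * τ ^ 3 := by
      calc j * (4 * K ^ 2 * τ ^ 4) = (j * τ) * (4 * K ^ 2 * τ ^ 3) := by ring
        _ ≤ K * (4 * K ^ 2 * τ ^ 3) := by gcongr
        _ = 4 * K ^ 3 * τ ^ 3 := by ring
        _ ≤ _ := by gcongr; norm_num
    linarith [h1 j]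
  have hsum : ∀ N : ℕ, N * τ ≤ K →
      |φ - σ| * ‖∑ k ∈ Finset.range N, u (t₀ + k * τ)‖ ≤ 12 * K ^ 5 * τ := by
    intro N hN
    set S := ‖∑ k ∈ Finset.range N, u (t₀ + k * τ)‖
    have h1 := norm_sum_oscillation_le hω h.deriv_u h.deriv_u' hτ h.norm_fast_force_le
      h.norm_u_le h.norm_u'_le t₀ N
    rw [← mul_abs_sinc_half (by positivity : 0 < τ * ω), le_div_iff₀ hω] at h1
    have h2 : 4 * K + 2 * (N * τ) * K ≤ 6 * K ^ 2 := by
      have : N * τ * K ≤ K * K := by gcongr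
      nlinarith
    have hS : 0 ≤ S := norm_nonneg _
    calc |φ - σ| * S ≤ 2 * K * |sinc (τ * ω / 2)| * S := by gcongr
      _ = 2 * K * (|sinc (τ * ω / 2)| * S) * 1 ^ 2 := by ring
      _ ≤ 2 * K * (|sinc (τ * ω / 2)| * S) * (K * (τ * ω)) ^ 2 := by gcongr
      _ = 2 * K ^ 3 * τ * (τ * ω * |sinc (τ * ω / 2)| * S * ω) := by ring
      _ ≤ 2 * K ^ 3 * τ * (6 * K ^ 2) :=
        mul_le_mul_of_nonneg_left (h1.trans h2) (by positivity)
      _ = _ := by ring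
  have hD : ∀ j : ℕ, j < n → ‖Y (j + 1) - Y j‖ ≤
      K ^ 2 * τ ^ 2 * ∑ k ∈ Finset.range n, (‖Y k‖ + ‖U k‖) + 21 * K ^ 6 * τ ^ 3 := by
    intro j hj
    have hj1 : ((j + 1 : ℕ) : ℝ) * τ ≤ K := hn.trans' (by gcongr; exact hj)
    have e : Y (j + 1) - Y j = R j + τ ^ 2 • ∑ k ∈ Finset.range (j + 1), A (Y k + φ • U k)
        + (τ ^ 2 * (φ - σ)) • A (∑ k ∈ Finset.range (j + 1), u (t₀ + k * τ)) := by
      simp only [hR]; abel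
    rw [e]
    have h1 := hRb j (hn.trans' (by gcongr))
    have h2 : ‖τ ^ 2 • ∑ k ∈ Finset.range (j + 1), A (Y k + φ • U k)‖
        ≤ τ ^ 2 * (K ^ 2 * ∑ k ∈ Finset.range n, (‖Y k‖ + ‖U k‖)) := by
      rw [norm_smul, Real.norm_eq_abs, abs_of_nonneg (by positivity)]
      gcongr
      calc ‖∑ k ∈ Finset.range (j + 1), A (Y k + φ • U k)‖
          ≤ ∑ k ∈ Finset.range (j + 1), K ^ 2 * (‖Y k‖ + ‖U k‖) := by
            refine norm_sum_le_of_le _ fun k _ => (h.norm_slow_le _).trans ?_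
            rw [sq, mul_assoc]
            gcongr
            refine (norm_add_le _ _).trans ?_
            rw [norm_smul, Real.norm_eq_abs, mul_add]
            gcongr
            exact le_mul_of_one_le_left (norm_nonneg _) hK
        _ ≤ ∑ k ∈ Finset.range n, K ^ 2 * (‖Y k‖ + ‖U k‖) :=
            Finset.sum_le_sum_of_subset_of_nonneg (Finset.range_mono hj)
              fun k _ _ => by positivity
        _ = _ := (Finset.mul_sum _ _ _).symm
    have h3 : ‖(τ ^ 2 * (φ - σ)) • A (∑ k ∈ Finset.range (j + 1), u (t₀ + k * τ))‖
        ≤ 12 * K ^ 6 * τ ^ 3 := by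
      rw [norm_smul, Real.norm_eq_abs, abs_mul, abs_of_nonneg (sq_nonneg τ)]
      calc τ ^ 2 * |φ - σ| * ‖A (∑ k ∈ Finset.range (j + 1), u (t₀ + k * τ))‖
          ≤ τ ^ 2 * |φ - σ| * (K * ‖∑ k ∈ Finset.range (j + 1), u (t₀ + k * τ)‖) := by
            gcongr; exact h.norm_slow_le _
        _ = τ ^ 2 * K * (|φ - σ| * ‖∑ k ∈ Finset.range (j + 1), u (t₀ + k * τ)‖) := by ring
        _ ≤ τ ^ 2 * K * (12 * K ^ 5 * τ) :=
            mul_le_mul_of_nonneg_left (hsum _ hj1) (by positivity)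
        _ = _ := by ring
    have h4 : 9 * K ^ 4 * τ ^ 3 ≤ 9 * K ^ 6 * τ ^ 3 := by gcongr; norm_num
    refine (norm_add₃_le).trans ?_
    linarith
  set E := ∑ k ∈ Finset.range n, (‖Y k‖ + ‖U k‖) with hE
  have hE0 : 0 ≤ E := Finset.sum_nonneg fun k _ => by positivity
  have e : Y n = ∑ j ∈ Finset.range n, (Y (j + 1) - Y j) := by
    rw [Finset.sum_range_sub, hY0, sub_zero]
  change ‖Y n‖ ≤ 21 * K ^ 7 * τ ^ 2 + K ^ 3 * τ * E
  calc ‖Y n‖ ≤ n * (K ^ 2 * τ ^ 2 * E + 21 * K ^ 6 * τ ^ 3) := by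
        rw [e]
        refine (norm_sum_le_of_le _ fun j hj => hD j (Finset.mem_range.1 hj)).trans_eq ?_
        rw [Finset.sum_const, Finset.card_range, nsmul_eq_mul]
    _ = (n * τ) * (K ^ 2 * τ * E + 21 * K ^ 6 * τ ^ 2) := by ring
    _ ≤ K * (K ^ 2 * τ * E + 21 * K ^ 6 * τ ^ 2) := by gcongr
    _ = _ := by ring

theorem fast_error_le (h : TwoScaleFlow A C ω K y y' u u') {τ : ℝ} (hτ : 0 < τ) (hτ1 : τ ≤ 1)
    (hz : 1 ≤ K * (τ * ω)) {φ Ψ t₀ : ℝ} {β : X} (hβ : ω ^ 2 * ‖β‖ ≤ K)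
    (hφ : |φ| ≤ K * |sinc (τ * ω / 2)|) (hΨ : |Ψ| ≤ K * sinc (τ * ω / 2) ^ 2)
    (hΨφ : |Ψ * φ| ≤ K * |sinc (τ * ω)|)
    (hΨs : |sinc (τ * ω) - Ψ| ≤ K * (τ * ω) ^ 2 * |sinc (τ * ω)|) {ye ue : ℕ → X}
    (hy0 : ye 0 = y t₀) (hu0 : ue 0 = u t₀)
    (hu1 : ue 1 = Real.cos (τ * ω) • u t₀ + (τ * sinc (τ * ω)) • u' t₀
      + (τ * (Ψ - sinc (τ * ω))) • β + (τ ^ 2 / 2 * Ψ) • C (y t₀ + φ • u t₀))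
    (hu2 : ∀ n, ue (n + 2) = (2 * Real.cos (τ * ω)) • ue (n + 1) - ue n
      + (τ ^ 2 * Ψ) • C (ye (n + 1) + φ • ue (n + 1)))
    {n : ℕ} (hn : n * τ ≤ K) :
    ‖ue n - u (t₀ + n * τ)‖ ≤ 26 * K ^ 7 * τ ^ 2 + K ^ 4 * τ * ∑ k ∈ Finset.range n,
      (‖ye k - y (t₀ + k * τ)‖ + ‖ue k - u (t₀ + k * τ)‖) := by
  have hK := h.one_le
  have hω := h.freq_pos
  obtain _ | m := n
  · simp [hu0]
    positivity
  set z := τ * ω with hzdef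
  have hz0 : 0 < z := by positivity
  set Y : ℕ → X := fun k => ye k - y (t₀ + k * τ) with hY
  set U : ℕ → X := fun k => ue k - u (t₀ + k * τ) with hU
  set σ := sinc (z / 2) ^ 2 with hσ
  have hY0 : Y 0 = 0 := by simp [hY, hy0]
  have hU0 : U 0 = 0 := by simp [hU, hu0]
  have hσ0 : 0 ≤ σ := sq_nonneg _
  have hσ1 : σ ≤ 1 := by
    rw [hσ, ← sq_abs]; exact pow_le_one₀ (abs_nonneg _) (abs_sinc_le_one _)
  have hΨσ : |Ψ - σ| ≤ 2 * K * σ := by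
    have h2 : σ ≤ K * σ := le_mul_of_one_le_left hσ0 hK
    have := abs_sub Ψ σ
    rw [abs_of_nonneg hσ0] at this
    linarith
  have hσz : z ^ 2 * σ = 2 - 2 * Real.cos z := by
    have := sq_mul_sinc_half_sq hω hτ
    rw [← hzdef, ← hσ, eq_div_iff (by positivity)] at this
    rw [hzdef] at this ⊢
    linear_combination this
  obtain ⟨κ, hκe, hκb⟩ : ∃ κ : ℝ, κ * (2 - 2 * Real.cos z) = τ ^ 2 * (Ψ - σ) ∧
      |κ| ≤ 2 * K ^ 3 * τ ^ 2 := by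
    by_cases h0 : 2 - 2 * Real.cos z = 0
    · have hσ2 : σ = 0 := by
        rw [h0] at hσz
        exact (mul_eq_zero.1 hσz).resolve_left (by positivity)
      rw [hσ2, mul_zero, abs_nonpos_iff] at hΨσ
      exact ⟨0, by rw [hσ2, hΨσ, zero_mul, mul_zero], by rw [abs_zero]; positivity⟩
    · have hpos : 0 < 2 - 2 * Real.cos z := lt_of_le_of_ne
        (by linarith [Real.cos_le_one z]) (Ne.symm h0)
      refine ⟨τ ^ 2 * (Ψ - σ) / (2 - 2 * Real.cos z), div_mul_cancel₀ _ h0, ?_⟩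
      rw [abs_div, abs_of_pos hpos, div_le_iff₀ hpos, abs_mul, abs_of_nonneg (sq_nonneg τ),
        ← hσz]
      calc τ ^ 2 * |Ψ - σ| ≤ τ ^ 2 * (2 * K * σ) := by gcongr
        _ = 2 * K * τ ^ 2 * σ * 1 ^ 2 := by ring
        _ ≤ 2 * K * τ ^ 2 * σ * (K * z) ^ 2 := by gcongr
        _ = _ := by ring
  have hu := h.norm_fast_le_mul hτ hz
  have hCu : ∀ s, ‖C (u s)‖ ≤ K ^ 3 * τ := fun s => by
    refine (h.norm_fast_le _).trans ?_
    calc K * ‖u s‖ ≤ K * (K ^ 2 * τ) := by gcongr; exact hu s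
      _ = _ := by ring
  have hCy : ∀ s, ‖C (y s)‖ ≤ 2 * K ^ 3 := fun s => by
    have e : C (y s) = C (y s + u s) - C (u s) := by rw [map_add, add_sub_cancel_right]
    rw [e]
    refine (norm_sub_le _ _).trans ?_
    have h1 : K ^ 3 * τ ≤ K ^ 3 := mul_le_of_le_one_right (by positivity) hτ1
    have h2 : K ≤ K ^ 3 := le_self_pow₀ hK (by norm_num)
    linarith [h.norm_fast_force_le s, hCu s]
  have hΨφs : |Ψ * φ - sinc z| ≤ K * |sinc z| + |sinc z| :=
    (abs_sub _ _).trans (by linarith)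
  have hΨφs2 : |Ψ * φ - sinc z| ≤ 2 * K * |sinc z| := by
    have : |sinc z| ≤ K * |sinc z| := le_mul_of_one_le_left (abs_nonneg _) hK
    linarith
  have hP : ∀ s, ‖κ • C (y s)‖ ≤ 4 * K ^ 6 * τ ^ 2 := fun s => by
    rw [norm_smul, Real.norm_eq_abs]
    calc |κ| * ‖C (y s)‖ ≤ (2 * K ^ 3 * τ ^ 2) * (2 * K ^ 3) := by gcongr; exact hCy s
      _ = _ := by ring
  set x : ℕ → X := fun k => U k - κ • C (y (t₀ + k * τ)) with hx
  set r : ℕ → X := fun k => u (t₀ + (k + 1 : ℕ) * τ + τ) + u (t₀ + (k + 1 : ℕ) * τ - τ)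
    - (2 * Real.cos z) • u (t₀ + (k + 1 : ℕ) * τ)
    - τ ^ 2 • C (σ • y (t₀ + (k + 1 : ℕ) * τ) + sinc z • u (t₀ + (k + 1 : ℕ) * τ)) with hr
  set q : ℕ → X := fun k => y (t₀ + (k + 1 : ℕ) * τ + τ) + y (t₀ + (k + 1 : ℕ) * τ - τ)
    - (2 : ℝ) • y (t₀ + (k + 1 : ℕ) * τ) with hq
  have hrb : ∀ k, ‖r k‖ ≤ 4 * K ^ 2 * τ ^ 4 := fun k => (h.two_step hτ _).2.1
  have hqb : ∀ k, ‖q k‖ ≤ 2 * K * τ ^ 2 := fun k => (h.two_step hτ _).2.2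
  set f : ℕ → X := fun k => (τ ^ 2 * Ψ) • C (Y (k + 1) + φ • U (k + 1))
    + (τ ^ 2 * (Ψ * φ - sinc z)) • C (u (t₀ + (k + 1 : ℕ) * τ)) - r k - κ • C (q k) with hf
  have hrec : ∀ k, x (k + 2) = (2 * Real.cos z) • x (k + 1) - x k + f k := by
    intro k
    have e1 : t₀ + (k + 1 : ℕ) * τ + τ = t₀ + (k + 2 : ℕ) * τ := by push_cast; ring
    have e2 : t₀ + (k + 1 : ℕ) * τ - τ = t₀ + k * τ := by push_cast; ring
    simp only [hx, hf, hr, hq, e1, e2, hY, hU, hu2, map_add, map_sub, map_smul]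
    match_scalars <;> (first | ring1 | linear_combination hκe | linear_combination -hκe)
  have hmain := norm_le_of_three_term x f hrec m
  have hnW : ∀ k, k ≤ m + 1 → |sinQuotient z k| * τ ≤ K := fun k hk => by
    refine hn.trans' ?_
    gcongr
    exact (abs_sinQuotient_le z k).trans (by exact_mod_cast hk)
  have hsW : ∀ k, |sinQuotient z k| * |sinc z| ≤ K := fun k => by
    refine (abs_sinQuotient_mul_sinc_le hz0 k).trans ?_
    rw [div_le_iff₀ hz0]; exact hz
  have hx0 : ‖x 0‖ ≤ 4 * K ^ 6 * τ ^ 2 := by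
    simp only [hx, hU0, zero_sub, norm_neg]
    exact hP _
  have hx1 : |sinQuotient z (m + 1)| * ‖x 1 - Real.cos z • x 0‖ ≤ 8 * K ^ 6 * τ ^ 2 := by
    set W := |sinQuotient z (m + 1)|
    have hW0 : 0 ≤ W := abs_nonneg _
    have hWτ : W * τ ≤ K := hnW _ le_rfl
    have e : x 1 - Real.cos z • x 0 = (τ * (Ψ - sinc z)) • β
        + (τ ^ 2 / 2 * (Ψ * φ - sinc z)) • C (u t₀)
        - (u (t₀ + τ) - Real.cos z • u t₀ - (τ * sinc z) • u' t₀
          - (τ ^ 2 / 2) • C (σ • y t₀ + sinc z • u t₀))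
        - κ • C (y (t₀ + τ) - y t₀) := by
      simp only [hx, hU, hu1, hu0, Nat.cast_zero, zero_mul, add_zero, Nat.cast_one, one_mul,
        map_add, map_sub, map_smul]
      match_scalars <;> (first | ring1 | linear_combination (-1 / 2 : ℝ) * hκe)
    have h1 : W * ‖(τ * (Ψ - sinc z)) • β‖ ≤ K ^ 3 * τ ^ 2 := by
      rw [norm_smul, Real.norm_eq_abs, abs_mul, abs_of_pos hτ, abs_sub_comm]
      have : |sinc z - Ψ| ≤ K * z ^ 2 * 1 := hΨs.trans (by gcongr; exact abs_sinc_le_one z)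
      calc W * (τ * |sinc z - Ψ| * ‖β‖) ≤ W * (τ * (K * z ^ 2 * 1) * ‖β‖) := by gcongr
        _ = (W * τ) * K * τ ^ 2 * (ω ^ 2 * ‖β‖) := by rw [hzdef]; ring
        _ ≤ K * K * τ ^ 2 * K := by gcongr
        _ = _ := by ring
    have h2 : W * ‖(τ ^ 2 / 2 * (Ψ * φ - sinc z)) • C (u t₀)‖ ≤ K ^ 5 * τ ^ 2 := by
      rw [norm_smul, Real.norm_eq_abs, abs_mul, abs_of_nonneg (by positivity)]
      have : |Ψ * φ - sinc z| ≤ 2 * K * 1 := hΨφs2.trans (by gcongr; exact abs_sinc_le_one z)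
      calc W * (τ ^ 2 / 2 * |Ψ * φ - sinc z| * ‖C (u t₀)‖)
          ≤ W * (τ ^ 2 / 2 * (2 * K * 1) * (K ^ 3 * τ)) := by gcongr; exact hCu _
        _ = (W * τ) * K ^ 4 * τ ^ 2 := by ring
        _ ≤ K * K ^ 4 * τ ^ 2 := by gcongr
        _ = _ := by ring
    have h3 : W * ‖u (t₀ + τ) - Real.cos z • u t₀ - (τ * sinc z) • u' t₀
          - (τ ^ 2 / 2) • C (σ • y t₀ + sinc z • u t₀)‖ ≤ 4 * K ^ 3 * τ ^ 2 := by
      calc _ ≤ W * (4 * K ^ 2 * τ ^ 3) := by gcongr; exact (h.one_step hτ hτ1 t₀).2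
        _ = (W * τ) * (4 * K ^ 2 * τ ^ 2) := by ring
        _ ≤ K * (4 * K ^ 2 * τ ^ 2) := by gcongr
        _ = _ := by ring
    have h4 : W * ‖κ • C (y (t₀ + τ) - y t₀)‖ ≤ 2 * K ^ 6 * τ ^ 2 := by
      have hyd : ‖y (t₀ + τ) - y t₀‖ ≤ K * τ := by
        have := norm_image_sub_le_of_norm_deriv_le_segment'
          (fun s _ => (h.deriv_y s).hasDerivWithinAt) (fun s _ => h.norm_y'_le s) (t₀ + τ)
          (Set.right_mem_Icc.2 (by linarith : t₀ ≤ t₀ + τ))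
        simpa using this
      rw [norm_smul, Real.norm_eq_abs]
      calc W * (|κ| * ‖C (y (t₀ + τ) - y t₀)‖)
          ≤ W * ((2 * K ^ 3 * τ ^ 2) * (K * (K * τ))) := by
            gcongr; exact (h.norm_fast_le _).trans (by gcongr)
        _ = (W * τ) * (2 * K ^ 5 * τ ^ 2) := by ring
        _ ≤ K * (2 * K ^ 5 * τ ^ 2) := by gcongr
        _ = _ := by ring
    have h5 : K ^ 3 * τ ^ 2 ≤ K ^ 6 * τ ^ 2 := by gcongr; norm_num
    have h6 : K ^ 5 * τ ^ 2 ≤ K ^ 6 * τ ^ 2 := by gcongr; norm_num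
    rw [e]
    calc _ ≤ W * (‖(τ * (Ψ - sinc z)) • β‖ + ‖(τ ^ 2 / 2 * (Ψ * φ - sinc z)) • C (u t₀)‖
          + ‖u (t₀ + τ) - Real.cos z • u t₀ - (τ * sinc z) • u' t₀
          - (τ ^ 2 / 2) • C (σ • y t₀ + sinc z • u t₀)‖ + ‖κ • C (y (t₀ + τ) - y t₀)‖) := by
          gcongr
          exact (norm_sub_le _ _).trans (add_le_add_left ((norm_sub_le _ _).trans
            (add_le_add_left (norm_add_le _ _) _)) _)
      _ ≤ _ := by rw [mul_add, mul_add, mul_add]; linarith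
  have hfb : ∀ k ∈ Finset.range m, |sinQuotient z (m - k)| * ‖f k‖ ≤
      K ^ 4 * τ * (‖Y (k + 1)‖ + ‖U (k + 1)‖) + 10 * K ^ 6 * τ ^ 3 := by
    intro k _
    set W := |sinQuotient z (m - k)|
    have hW0 : 0 ≤ W := abs_nonneg _
    have hWτ : W * τ ≤ K := hnW _ (by omega)
    have hWs : W * |sinc z| ≤ K := hsW _
    have hΨ1 : |Ψ| ≤ K := hΨ.trans (mul_le_of_le_one_right (by linarith) hσ1)
    have hφ1 : |φ| ≤ K := hφ.trans (mul_le_of_le_one_right (by linarith) (abs_sinc_le_one _))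
    have h1 : W * ‖(τ ^ 2 * Ψ) • C (Y (k + 1) + φ • U (k + 1))‖
        ≤ K ^ 4 * τ * (‖Y (k + 1)‖ + ‖U (k + 1)‖) := by
      rw [norm_smul, Real.norm_eq_abs, abs_mul, abs_of_nonneg (sq_nonneg τ)]
      have hYU : ‖Y (k + 1) + φ • U (k + 1)‖ ≤ K * (‖Y (k + 1)‖ + ‖U (k + 1)‖) := by
        refine (norm_add_le _ _).trans ?_
        rw [norm_smul, Real.norm_eq_abs, mul_add]
        gcongr
        exact le_mul_of_one_le_left (norm_nonneg _) hK
      calc W * (τ ^ 2 * |Ψ| * ‖C (Y (k + 1) + φ • U (k + 1))‖)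
          ≤ W * (τ ^ 2 * K * (K * (K * (‖Y (k + 1)‖ + ‖U (k + 1)‖)))) := by
            gcongr; exact (h.norm_fast_le _).trans (by gcongr)
        _ = (W * τ) * (K ^ 3 * τ * (‖Y (k + 1)‖ + ‖U (k + 1)‖)) := by ring
        _ ≤ K * (K ^ 3 * τ * (‖Y (k + 1)‖ + ‖U (k + 1)‖)) := by gcongr
        _ = _ := by ring
    have h2 : W * ‖(τ ^ 2 * (Ψ * φ - sinc z)) • C (u (t₀ + (k + 1 : ℕ) * τ))‖
        ≤ 2 * K ^ 5 * τ ^ 3 := by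
      rw [norm_smul, Real.norm_eq_abs, abs_mul, abs_of_nonneg (sq_nonneg τ)]
      calc W * (τ ^ 2 * |Ψ * φ - sinc z| * ‖C (u (t₀ + (k + 1 : ℕ) * τ))‖)
          ≤ W * (τ ^ 2 * (2 * K * |sinc z|) * (K ^ 3 * τ)) := by gcongr; exact hCu _
        _ = (W * |sinc z|) * (2 * K ^ 4 * τ ^ 3) := by ring
        _ ≤ K * (2 * K ^ 4 * τ ^ 3) := by gcongr
        _ = _ := by ring
    have h3 : W * ‖r k‖ ≤ 4 * K ^ 3 * τ ^ 3 := by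
      calc W * ‖r k‖ ≤ W * (4 * K ^ 2 * τ ^ 4) := by gcongr; exact hrb k
        _ = (W * τ) * (4 * K ^ 2 * τ ^ 3) := by ring
        _ ≤ K * (4 * K ^ 2 * τ ^ 3) := by gcongr
        _ = _ := by ring
    have h4 : W * ‖κ • C (q k)‖ ≤ 4 * K ^ 6 * τ ^ 3 := by
      rw [norm_smul, Real.norm_eq_abs]
      calc W * (|κ| * ‖C (q k)‖) ≤ W * ((2 * K ^ 3 * τ ^ 2) * (K * (2 * K * τ ^ 2))) := by
            gcongr; exact (h.norm_fast_le _).trans (by gcongr; exact hqb k)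
        _ = (W * τ) * (4 * K ^ 5 * τ ^ 3) := by ring
        _ ≤ K * (4 * K ^ 5 * τ ^ 3) := by gcongr
        _ = _ := by ring
    have h5 : 2 * K ^ 5 * τ ^ 3 ≤ 2 * K ^ 6 * τ ^ 3 := by gcongr; norm_num
    have h6 : 4 * K ^ 3 * τ ^ 3 ≤ 4 * K ^ 6 * τ ^ 3 := by gcongr; norm_num
    calc W * ‖f k‖ ≤ W * (‖(τ ^ 2 * Ψ) • C (Y (k + 1) + φ • U (k + 1))‖
          + ‖(τ ^ 2 * (Ψ * φ - sinc z)) • C (u (t₀ + (k + 1 : ℕ) * τ))‖ + ‖r k‖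
          + ‖κ • C (q k)‖) := by
          gcongr
          exact (norm_sub_le _ _).trans (add_le_add_left ((norm_sub_le _ _).trans
            (add_le_add_left (norm_add_le _ _) _)) _)
      _ ≤ _ := by rw [mul_add, mul_add, mul_add]; linarith
  have hsum : ∑ k ∈ Finset.range m, |sinQuotient z (m - k)| * ‖f k‖ ≤
      K ^ 4 * τ * ∑ k ∈ Finset.range (m + 1), (‖Y k‖ + ‖U k‖) + 10 * K ^ 7 * τ ^ 2 := by
    refine (Finset.sum_le_sum hfb).trans ?_
    rw [Finset.sum_add_distrib, ← Finset.mul_sum, Finset.sum_range_succ' _ m, hY0, hU0]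
    simp only [norm_zero, add_zero, Finset.sum_const, Finset.card_range, nsmul_eq_mul]
    have hmτ : m * τ ≤ K := by
      refine hn.trans' ?_
      gcongr
      simp
    have : (m : ℝ) * (10 * K ^ 6 * τ ^ 3) ≤ 10 * K ^ 7 * τ ^ 2 := by
      calc (m : ℝ) * (10 * K ^ 6 * τ ^ 3) = (m * τ) * (10 * K ^ 6 * τ ^ 2) := by ring
        _ ≤ K * (10 * K ^ 6 * τ ^ 2) := by gcongr
        _ = _ := by ring
    linarith
  have hfin : ‖U (m + 1)‖ ≤ ‖x (m + 1)‖ + 4 * K ^ 6 * τ ^ 2 := by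
    have e : U (m + 1) = x (m + 1) + κ • C (y (t₀ + (m + 1 : ℕ) * τ)) := by simp [hx]
    rw [e]
    exact (norm_add_le _ _).trans (by linarith [hP (t₀ + (m + 1 : ℕ) * τ)])
  have h67 : K ^ 6 * τ ^ 2 ≤ K ^ 7 * τ ^ 2 := by gcongr; norm_num
  change ‖U (m + 1)‖ ≤ 26 * K ^ 7 * τ ^ 2
    + K ^ 4 * τ * ∑ k ∈ Finset.range (m + 1), (‖Y k‖ + ‖U k‖)
  linarith

/-- Second order convergence of the two-step scheme, uniformly in the frequency. -/
theorem error_le (h : TwoScaleFlow A C ω K y y' u u') {τ : ℝ} (hτ : 0 < τ) (hτ1 : τ ≤ 1)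
    (hz : 1 ≤ K * (τ * ω)) {φ Ψ t₀ : ℝ} {β : X} (hβ : ω ^ 2 * ‖β‖ ≤ K)
    (hφ : |φ| ≤ K * |sinc (τ * ω / 2)|) (hΨ : |Ψ| ≤ K * sinc (τ * ω / 2) ^ 2)
    (hΨφ : |Ψ * φ| ≤ K * |sinc (τ * ω)|)
    (hΨs : |sinc (τ * ω) - Ψ| ≤ K * (τ * ω) ^ 2 * |sinc (τ * ω)|) {ye ue : ℕ → X}
    (hy0 : ye 0 = y t₀) (hu0 : ue 0 = u t₀)
    (hy1 : ye 1 = y t₀ + τ • y' t₀ + (τ ^ 2 / 2) • A (y t₀ + φ • u t₀))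
    (hy2 : ∀ n, ye (n + 2) = (2 : ℝ) • ye (n + 1) - ye n
      + τ ^ 2 • A (ye (n + 1) + φ • ue (n + 1)))
    (hu1 : ue 1 = Real.cos (τ * ω) • u t₀ + (τ * sinc (τ * ω)) • u' t₀
      + (τ * (Ψ - sinc (τ * ω))) • β + (τ ^ 2 / 2 * Ψ) • C (y t₀ + φ • u t₀))
    (hu2 : ∀ n, ue (n + 2) = (2 * Real.cos (τ * ω)) • ue (n + 1) - ue n
      + (τ ^ 2 * Ψ) • C (ye (n + 1) + φ • ue (n + 1)))
    {n : ℕ} (hn : n * τ ≤ K) :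
    ‖ye n + ue n - (y (t₀ + n * τ) + u (t₀ + n * τ))‖
      ≤ 47 * K ^ 7 * Real.exp (2 * K ^ 4 * K) * τ ^ 2 := by
  have hK := h.one_le
  have key := le_exp_of_le_sum
    (ε := fun k => ‖ye k - y (t₀ + k * τ)‖ + ‖ue k - u (t₀ + k * τ)‖)
    (a := 47 * K ^ 7 * τ ^ 2) (b := 2 * K ^ 4) (L := K) (by positivity) (by positivity) hτ.le
    (fun n hn => by
      have h1 := h.slow_error_le hτ hτ1 hz hφ hy0 hu0 hy1 hy2 hn
      have h2 := h.fast_error_le hτ hτ1 hz hβ hφ hΨ hΨφ hΨs hy0 hu0 hu1 hu2 hn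
      set E := ∑ k ∈ Finset.range n, (‖ye k - y (t₀ + k * τ)‖ + ‖ue k - u (t₀ + k * τ)‖) with hE
      have hE0 : 0 ≤ E := Finset.sum_nonneg fun k _ => by positivity
      have h3 : K ^ 3 * τ * E ≤ K ^ 4 * τ * E := by gcongr; norm_num
      linarith) n hn
  rw [add_sub_add_comm]
  refine (norm_add_le _ _).trans (key.trans_eq ?_)
  ring

end TwoScaleFlow

section Maxwell

variable {X : Type*} [NormedAddCommGroup X] [InnerProductSpace ℝ X]

theorem norm_map_le_of_symmetric_idempotent {Q : X →L[ℝ] X} (hQ : ∀ v, Q (Q v) = Q v)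
    (hQs : ∀ v w, inner ℝ (Q v) w = inner ℝ v (Q w)) (v : X) : ‖Q v‖ ≤ ‖v‖ := by
  have h : ‖Q v‖ * ‖Q v‖ ≤ ‖v‖ * ‖Q v‖ := by
    rw [← real_inner_self_eq_norm_mul_norm, hQs, hQ]
    exact real_inner_le_norm _ _
  rcases (norm_nonneg (Q v)).eq_or_lt with h0 | h0
  · rw [← h0]; exact norm_nonneg v
  · exact le_of_mul_le_mul_right h h0

theorem norm_sub_map_le_of_symmetric_idempotent {Q : X →L[ℝ] X} (hQ : ∀ v, Q (Q v) = Q v)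
    (hQs : ∀ v w, inner ℝ (Q v) w = inner ℝ v (Q w)) (v : X) : ‖v - Q v‖ ≤ ‖v‖ := by
  refine norm_map_le_of_symmetric_idempotent (Q := ContinuousLinearMap.id ℝ X - Q)
    (fun v => ?_) (fun v w => ?_) v
  · simp [hQ]
  · simp [inner_sub_left, inner_sub_right, hQs]

/-- Conservation of the energy of the differentiated system. -/
theorem maxwell_energy_eq {CE CB Q : X →L[ℝ] X}
    (hadj : ∀ v w, inner ℝ (CE v) w = inner ℝ v (CB w)) (hQ : ∀ v, Q (Q v) = Q v)
    (hQs : ∀ v w, inner ℝ (Q v) w = inner ℝ v (Q w)) {ω : ℝ} {p e b : ℝ → X}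
    (hp : ∀ t, HasDerivAt p (e t) t) (he : ∀ t, HasDerivAt e (CB (b t) - ω ^ 2 • Q (p t)) t)
    (hb : ∀ t, HasDerivAt b (-CE (e t)) t) (s t : ℝ) :
    ‖CB (b s) - ω ^ 2 • Q (p s)‖ ^ 2 + ‖CE (e s)‖ ^ 2 + ω ^ 2 * ‖Q (e s)‖ ^ 2
      = ‖CB (b t) - ω ^ 2 • Q (p t)‖ ^ 2 + ‖CE (e t)‖ ^ 2 + ω ^ 2 * ‖Q (e t)‖ ^ 2 := by
  have hd : ∀ t, HasDerivAt (fun t => ‖CB (b t) - ω ^ 2 • Q (p t)‖ ^ 2 + ‖CE (e t)‖ ^ 2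
      + ω ^ 2 * ‖Q (e t)‖ ^ 2) 0 t := by
    intro t
    have h1 := ((CB.hasFDerivAt.comp_hasDerivAt t (hb t)).sub
      ((Q.hasFDerivAt.comp_hasDerivAt t (hp t)).const_smul (ω ^ 2))).norm_sq
    have h2 := (CE.hasFDerivAt.comp_hasDerivAt t (he t)).norm_sq
    have h3 := ((Q.hasFDerivAt.comp_hasDerivAt t (he t)).norm_sq).const_mul (ω ^ 2)
    refine ((h1.add h2).add h3).congr_deriv ?_
    set a := CB (b t) - ω ^ 2 • Q (p t) with ha
    have e1 : inner ℝ (CE (e t)) (CE a) = inner ℝ a (CB (CE (e t))) := by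
      rw [real_inner_comm, hadj]
    have e2 : inner ℝ (Q (e t)) (Q a) = inner ℝ a (Q (e t)) := by
      rw [real_inner_comm, hQs, hQ]
    simp only [Function.comp_apply, map_neg, ← ha, e1, e2, inner_sub_right, inner_neg_right,
      inner_smul_right, Pi.sub_apply, Pi.smul_apply]
    ring
  exact is_const_of_deriv_eq_zero (fun t => (hd t).differentiableAt) (fun t => (hd t).deriv) s t

/-- The slow and fast components of the electric field of a Maxwell system. -/
theorem twoScaleFlow_maxwell {CE CB Q : X →L[ℝ] X}
    (hadj : ∀ v w, inner ℝ (CE v) w = inner ℝ v (CB w)) (hQ : ∀ v, Q (Q v) = Q v)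
    (hQs : ∀ v w, inner ℝ (Q v) w = inner ℝ v (Q w)) {ω κ L K : ℝ} (hω : 0 < ω) (hκ : 0 ≤ κ)
    (hL : 0 ≤ L) (hK : 1 ≤ K) (hκK : κ ^ 2 ≤ K) (hLK : L ≤ K) (hκLK : κ * L ≤ K)
    (hCE : ∀ v, ‖CE v‖ ≤ κ * ‖v‖) (hCB : ∀ v, ‖CB v‖ ≤ κ * ‖v‖) {p e b : ℝ → X}
    (hp : ∀ t, HasDerivAt p (e t) t) (he : ∀ t, HasDerivAt e (CB (b t) - ω ^ 2 • Q (p t)) t)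
    (hb : ∀ t, HasDerivAt b (-CE (e t)) t) {t₀ : ℝ}
    (hE : ‖CB (b t₀) - ω ^ 2 • Q (p t₀)‖ ^ 2 + ‖CE (e t₀)‖ ^ 2 + ω ^ 2 * ‖Q (e t₀)‖ ^ 2 ≤ L ^ 2) :
    TwoScaleFlow (Q ∘L CB ∘L CE - CB ∘L CE : X →L[ℝ] X).toLinearMap
      (-(Q ∘L CB ∘L CE) : X →L[ℝ] X).toLinearMap ω K
      (fun t => e t - Q (e t))
      (fun t => CB (b t) - ω ^ 2 • Q (p t) - Q (CB (b t) - ω ^ 2 • Q (p t)))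
      (fun t => Q (e t)) (fun t => Q (CB (b t) - ω ^ 2 • Q (p t))) := by
  have hQn := norm_map_le_of_symmetric_idempotent hQ hQs
  have hQn' := norm_sub_map_le_of_symmetric_idempotent hQ hQs
  have hE' : ∀ t, ‖CB (b t) - ω ^ 2 • Q (p t)‖ ^ 2 + ‖CE (e t)‖ ^ 2 + ω ^ 2 * ‖Q (e t)‖ ^ 2
      ≤ L ^ 2 := fun t => (maxwell_energy_eq hadj hQ hQs hp he hb t t₀).trans_le hE
  have hna : ∀ t, ‖CB (b t) - ω ^ 2 • Q (p t)‖ ≤ L := fun t => by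
    refine abs_le_of_sq_le_sq' ?_ hL |>.2
    nlinarith [hE' t, sq_nonneg ‖CE (e t)‖, sq_nonneg (ω * ‖Q (e t)‖)]
  have hnc : ∀ t, ‖CE (e t)‖ ≤ L := fun t => by
    refine abs_le_of_sq_le_sq' ?_ hL |>.2
    nlinarith [hE' t, sq_nonneg ‖CB (b t) - ω ^ 2 • Q (p t)‖, sq_nonneg (ω * ‖Q (e t)‖)]
  have hnu : ∀ t, ω * ‖Q (e t)‖ ≤ L := fun t => by
    refine abs_le_of_sq_le_sq' ?_ hL |>.2
    nlinarith [hE' t, sq_nonneg ‖CB (b t) - ω ^ 2 • Q (p t)‖, sq_nonneg ‖CE (e t)‖]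
  have hG : ∀ v, ‖CB (CE v)‖ ≤ K * ‖v‖ := fun v =>
    calc ‖CB (CE v)‖ ≤ κ * (κ * ‖v‖) := (hCB _).trans (by gcongr; exact hCE v)
      _ = κ ^ 2 * ‖v‖ := by ring
      _ ≤ K * ‖v‖ := by gcongr
  have hGe : ∀ t, ‖CB (CE (e t))‖ ≤ K := fun t =>
    (hCB _).trans ((by gcongr; exact hnc t : κ * ‖CE (e t)‖ ≤ κ * L).trans hκLK)
  have hA : ∀ v, ‖Q (CB (CE v)) - CB (CE v)‖ ≤ ‖CB (CE v)‖ := fun v => by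
    rw [norm_sub_rev]; exact hQn' _
  have ha : ∀ t, HasDerivAt (fun t => CB (b t) - ω ^ 2 • Q (p t))
      (-CB (CE (e t)) - ω ^ 2 • Q (e t)) t := fun t =>
    ((CB.hasFDerivAt.comp_hasDerivAt t (hb t)).sub
      ((Q.hasFDerivAt.comp_hasDerivAt t (hp t)).const_smul (ω ^ 2))).congr_deriv (by simp)
  have hQa : ∀ t, HasDerivAt (fun t => Q (CB (b t) - ω ^ 2 • Q (p t)))
      (-Q (CB (CE (e t))) - ω ^ 2 • Q (e t)) t := fun t =>
    (Q.hasFDerivAt.comp_hasDerivAt t (ha t)).congr_deriv (by simp [hQ])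
  have hQe : ∀ t, HasDerivAt (fun t => Q (e t)) (Q (CB (b t) - ω ^ 2 • Q (p t))) t := fun t =>
    Q.hasFDerivAt.comp_hasDerivAt t (he t)
  exact
  { one_le := hK
    freq_pos := hω
    norm_slow_le := fun v => (hA v).trans (hG v)
    norm_fast_le := fun v => by simpa using (hQn _).trans (hG v)
    deriv_y := fun t => (he t).sub (hQe t)
    deriv_y' := fun t => ((ha t).sub (hQa t)).congr_deriv (by
      simp only [sub_add_cancel, ContinuousLinearMap.coe_coe, sub_apply,
        ContinuousLinearMap.comp_apply]
      abel)
    deriv_u := hQe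
    deriv_u' := fun t => (hQa t).congr_deriv (by simp)
    norm_y'_le := fun t => (hQn' _).trans ((hna t).trans hLK)
    norm_u'_le := fun t => (hQn _).trans ((hna t).trans hLK)
    norm_u_le := fun t => (hnu t).trans hLK
    norm_slow_force_le := fun t => by
      simpa using (hA (e t)).trans (hGe t)
    norm_fast_force_le := fun t => by
      simpa using (hQn _).trans (hGe t) }

/-- Second order convergence of the electric field in a triple splitting scheme whose diagonal
operators act as the identity on the kernel of the projection `Q` and as scalars on its range. -/
theorem maxwell_splitting_error_le {CE CB Q : X →L[ℝ] X}
    (hadj : ∀ v w, inner ℝ (CE v) w = inner ℝ v (CB w)) (hQ : ∀ v, Q (Q v) = Q v)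
    (hQs : ∀ v w, inner ℝ (Q v) w = inner ℝ v (Q w)) {ω κ L K : ℝ} (hω : 0 < ω) (hκ : 0 ≤ κ)
    (hL : 0 ≤ L) (hK : 1 ≤ K) (hκK : κ ^ 2 ≤ K) (hLK : L ≤ K) (hκLK : κ * L ≤ K)
    (hCE : ∀ v, ‖CE v‖ ≤ κ * ‖v‖) (hCB : ∀ v, ‖CB v‖ ≤ κ * ‖v‖) {p e b : ℝ → X}
    (hp : ∀ t, HasDerivAt p (e t) t) (he : ∀ t, HasDerivAt e (CB (b t) - ω ^ 2 • Q (p t)) t)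
    (hb : ∀ t, HasDerivAt b (-CE (e t)) t) {t₀ : ℝ}
    (hE : ‖CB (b t₀) - ω ^ 2 • Q (p t₀)‖ ^ 2 + ‖CE (e t₀)‖ ^ 2 + ω ^ 2 * ‖Q (e t₀)‖ ^ 2 ≤ L ^ 2)
    (hβ : ω ^ 2 * ‖Q (CB (b t₀))‖ ≤ K) {τ : ℝ} (hτ : 0 < τ) (hτ1 : τ ≤ 1)
    (hz : 1 ≤ K * (τ * ω)) {φ ψ Ψ : ℝ} (hΨdef : Ψ = (1 / 2) * (Real.cos (τ * ω) + 1) * ψ)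
    (hφ : |φ| ≤ K * |sinc (τ * ω / 2)|) (hΨ : |Ψ| ≤ K * sinc (τ * ω / 2) ^ 2)
    (hΨφ : |Ψ * φ| ≤ K * |sinc (τ * ω)|)
    (hΨs : |sinc (τ * ω) - Ψ| ≤ K * (τ * ω) ^ 2 * |sinc (τ * ω)|) {pn en bn bh ep : ℕ → X}
    (hp0 : pn 0 = p t₀) (he0 : en 0 = e t₀) (hb0 : bn 0 = b t₀)
    (hbh : ∀ n, bh n = bn n - (τ / 2) • CE (en n - Q (en n) + φ • Q (en n)))
    (hep : ∀ n, ep n = en n + (τ / 2) • (CB (bh n) - Q (CB (bh n)) + ψ • Q (CB (bh n))))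
    (hpn : ∀ n, pn (n + 1) = pn n - Q (pn n) + Real.cos (τ * ω) • Q (pn n)
      + τ • (ep n - Q (ep n) + sinc (τ * ω) • Q (ep n)))
    (hen : ∀ n, en (n + 1) = -((ω * Real.sin (τ * ω)) • Q (pn n))
      + (ep n - Q (ep n) + Real.cos (τ * ω) • Q (ep n))
      + (τ / 2) • (CB (bh n) - Q (CB (bh n)) + ψ • Q (CB (bh n))))
    (hbn : ∀ n, bn (n + 1)
      = bh n - (τ / 2) • CE (en (n + 1) - Q (en (n + 1)) + φ • Q (en (n + 1))))
    {n : ℕ} (hn : n * τ ≤ K) :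
    ‖en n - e (t₀ + n * τ)‖ ≤ 47 * K ^ 7 * Real.exp (2 * K ^ 4 * K) * τ ^ 2 := by
  have hflow := twoScaleFlow_maxwell hadj hQ hQs hω hκ hL hK hκK hLK hκLK hCE hCB hp he hb hE
  have hz0 : τ * ω ≠ 0 := by positivity
  have hs : Real.sin (τ * ω) = τ * ω * sinc (τ * ω) := by
    rw [sinc, if_neg hz0]; field_simp
  have hsc : (τ * ω * sinc (τ * ω)) ^ 2 = 1 - Real.cos (τ * ω) ^ 2 := by
    rw [← hs, ← Real.sin_sq_add_cos_sq (τ * ω)]; ring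
  have hw : ∀ n, CB (bh (n + 1))
      = CB (bh n) - τ • CB (CE (en (n + 1) - Q (en (n + 1)) + φ • Q (en (n + 1)))) := by
    intro n
    rw [hbh (n + 1), hbn n]
    simp only [map_sub, map_smul]
    module
  have hy : ∀ n, en (n + 1) - Q (en (n + 1))
      = en n - Q (en n) + τ • (CB (bh n) - Q (CB (bh n))) := by
    intro n
    simp only [hen n, hep n, map_add, map_sub, map_neg, map_smul, hQ]
    module
  have hu : ∀ n, Q (en (n + 1)) = -((ω * (τ * ω * sinc (τ * ω))) • Q (pn n))
      + Real.cos (τ * ω) • Q (en n) + (τ * Ψ) • Q (CB (bh n)) := by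
    intro n
    simp only [hen n, hep n, map_add, map_sub, map_neg, map_smul, hQ, hΨdef, hs]
    module
  have hq : ∀ n, Q (pn (n + 1)) = Real.cos (τ * ω) • Q (pn n)
      + (τ * sinc (τ * ω)) • (Q (en n) + (τ / 2 * ψ) • Q (CB (bh n))) := by
    intro n
    simp only [hpn n, hep n, map_add, map_sub, map_smul, hQ]
    module
  have := hflow.error_le hτ hτ1 hz (t₀ := t₀) hβ hφ hΨ hΨφ hΨs
    (ye := fun n => en n - Q (en n)) (ue := fun n => Q (en n)) (by simp only [he0])
    (by simp only [he0]) ?_ ?_ ?_ ?_ hn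
  · simpa using this
  · have := hy 0
    rw [zero_add] at this
    simp only [this, hbh, he0, hb0]
    simp only [ContinuousLinearMap.coe_coe, sub_apply,
      ContinuousLinearMap.comp_apply, map_add, map_sub, map_smul, hQ]
    module
  · intro n
    simp only [hy (n + 1), hw n]
    simp only [ContinuousLinearMap.coe_coe, sub_apply,
      ContinuousLinearMap.comp_apply, map_add, map_sub, map_smul]
    linear_combination (norm := module) (-1 : ℝ) • hy n
  · have := hu 0
    rw [zero_add] at this
    simp only [this, hbh, he0, hb0, hp0]
    simp only [ContinuousLinearMap.coe_coe, neg_apply,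
      ContinuousLinearMap.comp_apply, map_add, map_sub, map_smul, hQ]
    module
  · intro n
    rw [hu (n + 1), hq n, hw n, hΨdef]
    have hun := hu n
    rw [hΨdef] at hun
    simp only [ContinuousLinearMap.coe_coe, neg_apply,
      ContinuousLinearMap.comp_apply, map_add, map_sub, map_smul]
    linear_combination (norm := skip) -Real.cos (τ * ω) • hun
    match_scalars <;>
      (first | ring1 | linear_combination -hsc | linear_combination (-(τ / 2) * ψ) * hsc)

end Maxwell

section Diagonal

variable {d : ℕ} {ωv : Fin d → ℝ} {ω : ℝ}

/-- Multiplication by a matrix as a continuous linear map of the Euclidean space. -/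
noncomputable def mulCLM (A : Matrix (Fin d) (Fin d) ℝ) :
    EuclideanSpace ℝ (Fin d) →L[ℝ] EuclideanSpace ℝ (Fin d) :=
  LinearMap.toContinuousLinearMap (Matrix.toEuclideanLin A)

theorem mulE_eq (A : Matrix (Fin d) (Fin d) ℝ) (v : EuclideanSpace ℝ (Fin d)) :
    mulE A v = mulCLM A v := rfl

theorem inner_mulCLM (A : Matrix (Fin d) (Fin d) ℝ) (v w : EuclideanSpace ℝ (Fin d)) :
    inner ℝ (mulCLM A v) w = inner ℝ v (mulCLM A.transpose w) := by
  change inner ℝ (Matrix.toEuclideanLin A v) w = inner ℝ v (Matrix.toEuclideanLin A.transpose w)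
  rw [← Matrix.conjTranspose_eq_transpose_of_trivial,
    Matrix.toEuclideanLin_conjTranspose_eq_adjoint, LinearMap.adjoint_inner_right]

theorem mulE_diagonal_apply (f : Fin d → ℝ) (v : EuclideanSpace ℝ (Fin d)) (i : Fin d) :
    mulE (Matrix.diagonal f) v i = f i * v i :=
  Matrix.mulVec_diagonal f _ i

/-- The projection onto the coordinates with nonzero frequency. -/
noncomputable def fastProj (ωv : Fin d → ℝ) :
    EuclideanSpace ℝ (Fin d) →L[ℝ] EuclideanSpace ℝ (Fin d) :=
  mulCLM (Matrix.diagonal fun i => if ωv i = 0 then 0 else 1)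

theorem fastProj_apply (v : EuclideanSpace ℝ (Fin d)) (i : Fin d) :
    fastProj ωv v i = if ωv i = 0 then 0 else v i := by
  rw [fastProj, ← mulE_eq, mulE_diagonal_apply]
  split_ifs <;> simp

theorem fastProj_idem (v : EuclideanSpace ℝ (Fin d)) :
    fastProj ωv (fastProj ωv v) = fastProj ωv v := by
  ext i
  simp only [fastProj_apply]
  split_ifs <;> rfl

theorem inner_fastProj (v w : EuclideanSpace ℝ (Fin d)) :
    inner ℝ (fastProj ωv v) w = inner ℝ v (fastProj ωv w) := by
  rw [fastProj, inner_mulCLM, Matrix.diagonal_transpose]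

theorem mulE_fDiag (hω : 0 < ω) (hv : ∀ i, ωv i = 0 ∨ ωv i = ω) {f : ℝ → ℝ} (hf : f 0 = 1) (s : ℝ)
    (v : EuclideanSpace ℝ (Fin d)) :
    mulE (fDiag f s ωv) v = v - fastProj ωv v + f (s * ω) • fastProj ωv v := by
  ext i
  rw [fDiag, mulE_diagonal_apply]
  simp only [PiLp.add_apply, PiLp.sub_apply, PiLp.smul_apply, fastProj_apply, smul_eq_mul]
  rcases hv i with h | h
  · simp [h, hf]
  · simp [h, hω.ne']

theorem mulE_diagonal_of_zero (hω : 0 < ω) (hv : ∀ i, ωv i = 0 ∨ ωv i = ω) {f : ℝ → ℝ}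
    (hf : f 0 = 0) (v : EuclideanSpace ℝ (Fin d)) :
    mulE (Matrix.diagonal fun i => f (ωv i)) v = f ω • fastProj ωv v := by
  ext i
  rw [mulE_diagonal_apply]
  simp only [PiLp.smul_apply, fastProj_apply, smul_eq_mul]
  rcases hv i with h | h
  · simp [h, hf]
  · simp [h, hω.ne']

theorem mulE_diagonal (hω : 0 < ω) (hv : ∀ i, ωv i = 0 ∨ ωv i = ω)
    (v : EuclideanSpace ℝ (Fin d)) : mulE (Matrix.diagonal ωv) v = ω • fastProj ωv v :=
  mulE_diagonal_of_zero hω hv (f := fun x => x) rfl v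

theorem mulE_diagonal_sq (hω : 0 < ω) (hv : ∀ i, ωv i = 0 ∨ ωv i = ω)
    (v : EuclideanSpace ℝ (Fin d)) :
    mulE ((Matrix.diagonal ωv) ^ 2) v = ω ^ 2 • fastProj ωv v := by
  rw [Matrix.diagonal_pow]
  exact mulE_diagonal_of_zero hω hv (f := fun x => x ^ 2) (by simp) v

end Diagonal

/-- Second order error bound for the electric field: under filter
conditions (i)–(v), the initial-data bounds and `0 < τ ≤ τ₀`, `τ·ω̃ ≥ c₀`, the
electric-field iterates of the triple splitting scheme satisfy
`‖e_n − e(t_n)‖ ≤ C·τ²` for all `n` with `t_n = t₀ + n·τ ≤ T`, with `τ₀, C`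
independent of `ω̃`, `τ`, `n`, `d`. -/
theorem stmt3
    (t0 T c0 H0 Cc C1 C2 C3 C4 C5 : ℝ)
    (hT : t0 < T) (hc0 : 0 < c0) (hH0 : 0 < H0) (hCc : 0 < Cc) :
    ∃ τ0 : ℝ, 0 < τ0 ∧ ∃ C : ℝ, 0 < C ∧
      ∀ (d : ℕ), 1 ≤ d →
      ∀ (CE CB : Matrix (Fin d) (Fin d) ℝ), CB = CE.transpose →
      ∀ (ow : ℝ), 0 < ow →
      ∀ (ωv : Fin d → ℝ), (∀ i, ωv i = 0 ∨ ωv i = ow) →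
      (∀ v : EuclideanSpace ℝ (Fin d), ‖mulE CE v‖ ≤ Cc * ‖v‖) →
      (∀ v : EuclideanSpace ℝ (Fin d), ‖mulE CB v‖ ≤ Cc * ‖v‖) →
      ∀ (ψE φE : ℝ → ℝ),
        (∀ z, ψE (-z) = ψE z) → (∀ z, φE (-z) = φE z) → ψE 0 = 1 → φE 0 = 1 →
        (∀ z : ℝ, |(Real.cos z + 1) * ψE (z/2)| ≤ C1 * (sinc (z/2))^2) →
        (∀ z : ℝ, |φE (z/2)| ≤ C2 * |sinc (z/2)|) →
        (∀ z : ℝ, |(Real.cos z + 1) * ψE (z/2) * φE (z/2)| ≤ C3 * |sinc z|) →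
        (∀ z : ℝ, |(Real.cos z + 1) * ψE (z/2)| ≤ C4 * |sinc z|) →
        (∀ z : ℝ, |sinc z - (1/2) * (Real.cos z + 1) * ψE (z/2)| ≤ C5 * z^2 * |sinc z|) →
      ∀ (p0 e0 b0 : EuclideanSpace ℝ (Fin d)),
        ‖mulE (Matrix.diagonal ωv) e0‖^2 ≤ (2/3) * H0 →
        ‖mulE CB b0‖^2 ≤ (1/3) * min 1 (4 / C4^2) * H0 →
        ‖mulE ((Matrix.diagonal ωv)^2) p0‖^2 ≤ (1/3) * H0 →
        ‖mulE CE e0‖^2 ≤ 2 * H0 →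
        ‖e0‖^2 ≤ H0 →
        ‖b0‖^2 ≤ H0 →
        ‖mulE ((Matrix.diagonal ωv)^2) (mulE CB b0)‖^2 ≤ H0 →
      ∀ (p e b : ℝ → EuclideanSpace ℝ (Fin d)),
        (∀ t, HasDerivAt p (e t) t) →
        (∀ t, HasDerivAt e (mulE CB (b t) - mulE ((Matrix.diagonal ωv)^2) (p t)) t) →
        (∀ t, HasDerivAt b (-mulE CE (e t)) t) →
        p t0 = p0 → e t0 = e0 → b t0 = b0 →
      ∀ (τ : ℝ), 0 < τ → τ ≤ τ0 → c0 ≤ τ * ow →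
      ∀ n : ℕ, t0 + (n : ℝ) * τ ≤ T →
        ‖((tripleSplitStep CE CB ψE φE τ ωv)^[n] (p0, e0, b0)).2.1
            - e (t0 + (n : ℝ) * τ)‖ ≤ C * τ^2 := by

  set L := 2 * Real.sqrt H0 with hLdef
  have hsq : Real.sqrt H0 ^ 2 = H0 := Real.sq_sqrt hH0.le
  have hL0 : 0 ≤ L := by positivity
  have hCL : 0 ≤ Cc * L := by positivity
  set K := 1 + |T - t0| + 1 / c0 + Cc ^ 2 + L + Cc * L + |C1| + |C2| + |C3| + |C5| with hK
  have hc0' : 0 < 1 / c0 := by positivity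
  have := abs_nonneg (T - t0)
  have := abs_nonneg C1
  have := abs_nonneg C2
  have := abs_nonneg C3
  have := abs_nonneg C5
  have := sq_nonneg Cc
  have hK1 : 1 ≤ K := by linarith
  refine ⟨1, one_pos, 47 * K ^ 7 * Real.exp (2 * K ^ 4 * K), by positivity, ?_⟩
  intro d _ CE CB hCB ow how ωv hωv hCEn hCBn ψE φE _ _ hψ0 hφ0 h1 h2 h3 _ h5 p0 e0 b0
    hi1 hi2 hi3 hi4 _ _ hi7 p e b hp he hb hp0 he0 hb0 τ hτ hτ1 hc n hn
  have hadj : ∀ v w, inner ℝ (mulCLM CE v) w = inner ℝ v (mulCLM CB w) := by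
    rw [hCB]; exact inner_mulCLM CE
  set s : ℕ → _ := fun n => (tripleSplitStep CE CB ψE φE τ ωv)^[n] (p0, e0, b0) with hs
  have hstep : ∀ n, s (n + 1) = tripleSplitStep CE CB ψE φE τ ωv (s n) := fun n =>
    Function.iterate_succ_apply' _ _ _
  have hsin : ∀ v, mulE (Matrix.diagonal fun i => ωv i * Real.sin (τ * ωv i)) v
      = (ow * Real.sin (τ * ow)) • fastProj ωv v :=
    mulE_diagonal_of_zero how hωv (f := fun x => x * Real.sin (τ * x)) (by simp)
  have hz : τ / 2 * ow = τ * ow / 2 := by ring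
  have hsinc : sinc 0 = 1 := by simp [sinc]
  set Ψ := (1 / 2) * (Real.cos (τ * ow) + 1) * ψE (τ * ow / 2) with hΨ
  have e1 : (Real.cos (τ * ow) + 1) * ψE (τ * ow / 2) = 2 * Ψ := by rw [hΨ]; ring
  have g1 := h1 (τ * ow)
  have g2 := h2 (τ * ow)
  have g3 := h3 (τ * ow)
  have g5 := h5 (τ * ow)
  rw [e1, abs_mul, abs_two] at g1
  rw [e1, mul_assoc, abs_mul, abs_two] at g3
  rw [← hΨ] at g5
  simp only [mulE_diagonal how hωv, mulE_diagonal_sq how hωv, mulE_eq] at hi1 hi2 hi3 hi4 hi7 he hb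
  rw [norm_smul, Real.norm_eq_abs, abs_of_pos how] at hi1
  have hE : ‖mulCLM CB (b t0) - ow ^ 2 • fastProj ωv (p t0)‖ ^ 2 + ‖mulCLM CE (e t0)‖ ^ 2
      + ow ^ 2 * ‖fastProj ωv (e t0)‖ ^ 2 ≤ L ^ 2 := by
    rw [hp0, he0, hb0]
    have hm : min 1 (4 / C4 ^ 2) ≤ 1 := min_le_left _ _
    have hi2' : ‖mulCLM CB b0‖ ^ 2 ≤ (1 / 3) * 1 * H0 := hi2.trans (by gcongr)
    have hsub : ‖mulCLM CB b0 - ow ^ 2 • fastProj ωv p0‖ ^ 2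
        ≤ (‖mulCLM CB b0‖ + ‖ow ^ 2 • fastProj ωv p0‖) ^ 2 := by
      gcongr; exact norm_sub_le _ _
    have := sq_nonneg (‖mulCLM CB b0‖ - ‖ow ^ 2 • fastProj ωv p0‖)
    rw [mul_pow] at hi1
    rw [hLdef, mul_pow, hsq]
    linarith
  have hβ : ow ^ 2 * ‖fastProj ωv (mulCLM CB (b t0))‖ ≤ K := by
    rw [hb0]
    rw [norm_smul, Real.norm_eq_abs, abs_of_pos (by positivity)] at hi7
    have : ow ^ 2 * ‖fastProj ωv (mulCLM CB b0)‖ ≤ Real.sqrt H0 := Real.le_sqrt_of_sq_le hi7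
    linarith [Real.sqrt_nonneg H0]
  have hzK : 1 ≤ K * (τ * ow) := by
    calc 1 = 1 / c0 * c0 := by field_simp
      _ ≤ K * (τ * ow) := by gcongr; linarith
  refine maxwell_splitting_error_le (κ := Cc) (L := L) (pn := fun n => (s n).1)
    (en := fun n => (s n).2.1) (bn := fun n => (s n).2.2)
    (bh := fun n => (s n).2.2 - (τ / 2) • mulCLM CE ((s n).2.1 - fastProj ωv (s n).2.1
      + φE (τ * ow / 2) • fastProj ωv (s n).2.1)) (ep := fun n => _)
    hadj fastProj_idem inner_fastProj how hCc.le hL0 hK1 (by linarith) (by linarith) (by linarith)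
    hCEn hCBn hp he hb hE hβ hτ hτ1 hzK hΨ (g2.trans ?_) ?_ ?_ (g5.trans ?_)
    hp0.symm he0.symm hb0.symm (fun n => rfl) (fun n => rfl) (fun n => ?_) (fun n => ?_)
    (fun n => ?_) ?_
  · gcongr
    linarith [le_abs_self C2]
  · have : C1 * sinc (τ * ow / 2) ^ 2 ≤ K * sinc (τ * ow / 2) ^ 2 := by
      gcongr
      linarith [le_abs_self C1]
    linarith [abs_nonneg Ψ]
  · have : C3 * |sinc (τ * ow)| ≤ K * |sinc (τ * ow)| := by
      gcongr
      linarith [le_abs_self C3]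
    linarith [abs_nonneg (Ψ * φE (τ * ow / 2))]
  · gcongr
    linarith [le_abs_self C5]
  · simp only [hstep n, tripleSplitStep, hsin, mulE_fDiag how hωv hψ0, mulE_fDiag how hωv hφ0,
      mulE_fDiag how hωv hsinc, mulE_fDiag how hωv Real.cos_zero, mulE_eq, hz]
  · simp only [hstep n, tripleSplitStep, hsin, mulE_fDiag how hωv hψ0, mulE_fDiag how hωv hφ0,
      mulE_fDiag how hωv Real.cos_zero, mulE_eq, hz]
  · simp only [hstep n, tripleSplitStep, hsin, mulE_fDiag how hωv hψ0, mulE_fDiag how hωv hφ0,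
      mulE_fDiag how hωv Real.cos_zero, mulE_eq, hz]
  · linarith [le_abs_self (T - t0)]
end
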